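/- Let X ⊆ P^r_K be a variety of almost minimal degree with codepth A_X = 1 and c := codim X ≥ 4. Then the defining ideal I_X of X is minimally generated by binom(c+1, 2) − 2 quadrics and at most one cubic. -/

import Mathlib

noncomputable section

open MvPolynomial

/-- The polynomial ring `S = K[x_0, …, x_r]`, the homogeneous coordinate ring of `ℙ^r_K`. -/
abbrev PS (K : Type) [Field K] (r : ℕ) : Type := MvPolynomial (Fin (r + 1)) K

namespace AMD

variable (K : Type) [Field K] (r : ℕ)

/-- `I` is a homogeneous ideal of `S = K[x_0, …, x_r]`. -/
def IsHomIdeal (I : Ideal (PS K r)) : Prop :=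
  ∀ p ∈ I, ∀ n : ℕ, homogeneousComponent n p ∈ I

/-- `X = V_+(I)` is non-degenerate: `I` contains no nonzero linear form. -/
def Nondeg (I : Ideal (PS K r)) : Prop :=
  ∀ p ∈ I, p.IsHomogeneous 1 → p = 0

/-- The irrelevant maximal ideal of the homogeneous coordinate ring `A_X = S/I`. -/
def maxIdl (I : Ideal (PS K r)) : Ideal (PS K r ⧸ I) :=
  (Ideal.span (Set.range (X : Fin (r + 1) → PS K r))).map (Ideal.Quotient.mk I)

/-- `dim X = d`, i.e. the Krull dimension of `A_X = S/I` equals `d + 1`. -/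
def DimEq (I : Ideal (PS K r)) (d : ℕ) : Prop :=
  ringKrullDim (PS K r ⧸ I) = (((d : ℕ∞) + 1 : ℕ∞) : WithBot ℕ∞)

/-- The degree-`n` homogeneous component of `A_X = S/I`, as a `K`-subspace. -/
def quotComponent (I : Ideal (PS K r)) (n : ℕ) : Submodule K (PS K r ⧸ I) :=
  (homogeneousSubmodule (Fin (r + 1)) K n).map (Ideal.Quotient.mkₐ K I).toLinearMap

/-- The Hilbert series of the graded algebra `A_X = S/I`. -/
def hilbSeries (I : Ideal (PS K r)) : PowerSeries ℤ :=
  PowerSeries.mk fun n => (Module.finrank K (quotComponent K r I n) : ℤ)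

/-- `deg X = e`, where `d = dim X`:  the numerator polynomial of the Hilbert series of
`A_X` with respect to the denominator `(1 - λ)^(d+1)` takes the value `e` at `λ = 1`. -/
def DegreeEq (I : Ideal (PS K r)) (d e : ℕ) : Prop :=
  ∃ h : Polynomial ℤ,
    hilbSeries K r I * (1 - PowerSeries.X) ^ (d + 1) = PowerSeries.mk (fun n => h.coeff n) ∧
    h.eval 1 = (e : ℤ)

/-- A graded automorphism of `S`, i.e. a linear change of coordinates of `ℙ^r_K`. -/
def IsGrAut (φ : PS K r ≃ₐ[K] PS K r) : Prop :=
  ∀ i, (φ (X i)).IsHomogeneous 1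

/-- `X = V_+(I) ⊆ ℙ^r_K` is a cone (over a variety lying in some hyperplane): after a
linear change of coordinates, `I` is generated by polynomials not involving the last
variable. -/
def IsConeIdeal (I : Ideal (PS K r)) : Prop :=
  ∃ φ : PS K r ≃ₐ[K] PS K r, IsGrAut K r φ ∧
    ∃ J : Ideal (MvPolynomial (Fin r) K),
      Ideal.map φ I = Ideal.map (rename (Fin.castSucc : Fin r → Fin (r + 1))) J

/-- A (weakly) regular sequence on the ring `A`. -/
def IsRegSeq {A : Type} [CommRing A] (rs : List A) : Prop :=
  ∀ (i : Fin rs.length) (y : A),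
    rs.get i * y ∈ Ideal.span {x | x ∈ rs.take i.1} → y ∈ Ideal.span {x | x ∈ rs.take i.1}

/-- `depth A_X = t`: the maximal length of a regular sequence on `A_X = S/I` consisting
of elements of the irrelevant maximal ideal is `t`. -/
def DepthEq (I : Ideal (PS K r)) (t : ℕ) : Prop :=
  (∃ rs : List (PS K r ⧸ I), rs.length = t ∧ (∀ x ∈ rs, x ∈ maxIdl K r I) ∧ IsRegSeq rs) ∧
  ∀ rs : List (PS K r ⧸ I), (∀ x ∈ rs, x ∈ maxIdl K r I) → IsRegSeq rs → rs.length ≤ t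

/-- `X` is arithmetically Cohen-Macaulay: `depth A_X = dim A_X`. -/
def IsACM (I : Ideal (PS K r)) : Prop :=
  ∃ t : ℕ, ringKrullDim (PS K r ⧸ I) = ((t : ℕ∞) : WithBot ℕ∞) ∧ DepthEq K r I t

/-- The socle `{y | m·y = 0}` of `B`, as a `K`-subspace of `B`. -/
def socle (B : Type) [CommRing B] [Algebra K B] (m : Ideal B) : Submodule K B where
  carrier := {y | ∀ z ∈ m, z * y = 0}
  add_mem' := by
    intro a b ha hb z hz
    rw [mul_add, ha z hz, hb z hz, add_zero]
  zero_mem' := by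
    intro z hz
    rw [mul_zero]
  smul_mem' := by
    intro c y hy z hz
    rw [mul_smul_comm, hy z hz, smul_zero]

/-- `X` is arithmetically Gorenstein: `A_X = S/I` is Cohen-Macaulay and its Artinian
reduction by a maximal regular sequence has a one-dimensional socle. -/
def IsArithGorenstein (I : Ideal (PS K r)) : Prop :=
  ∃ (t : ℕ) (rs : List (PS K r ⧸ I)),
    ringKrullDim (PS K r ⧸ I) = ((t : ℕ∞) : WithBot ℕ∞) ∧ rs.length = t ∧
    (∀ x ∈ rs, x ∈ maxIdl K r I) ∧ IsRegSeq rs ∧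
    Module.finrank K
      (socle K ((PS K r ⧸ I) ⧸ Ideal.span {x | x ∈ rs})
        (Ideal.map (Ideal.Quotient.mk (Ideal.span {x | x ∈ rs})) (maxIdl K r I))) = 1

/-- The graded free `S`-module with `β j` generators in "row `j`" for each `j : ℕ`. -/
abbrev FreeGr (β : ℕ → ℕ) : Type := ((j : ℕ) × Fin (β j)) →₀ PS K r

/-- `φ` is a minimal graded homomorphism of graded free modules, where the generator
`(j, t)` of the source has degree `m₁ + j` and the generator `(j', t')` of the target
has degree `m₂ + j'`: every matrix entry of `φ` is either zero or homogeneous of the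
appropriate positive degree. -/
def IsMinGrMap (b₁ b₂ : ℕ → ℕ) (m₁ m₂ : ℕ)
    (φ : FreeGr K r b₁ →ₗ[PS K r] FreeGr K r b₂) : Prop :=
  ∀ (j : ℕ) (t : Fin (b₁ j)) (j' : ℕ) (t' : Fin (b₂ j')),
    (φ (Finsupp.single ⟨j, t⟩ 1)) ⟨j', t'⟩ = 0 ∨
      ∃ dd : ℕ, 1 ≤ dd ∧ dd + (m₂ + j') = m₁ + j ∧
        ((φ (Finsupp.single ⟨j, t⟩ 1)) ⟨j', t'⟩).IsHomogeneous dd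

/-- `b` is the Betti diagram of the ideal `I ⊆ S`, i.e.
`b i j = dim_K Tor_i^S(K, S/I)_{i+j}` for all `i ≥ 1`.  This is expressed by the
existence of a minimal graded free resolution `⋯ → F₂ → F₁ → S → S/I → 0` of `S/I`
in which, for `i ≥ 1`, the free module `F_i` has exactly `b i j` generators of degree
`i + j`. -/
def HasBettiDiagram (I : Ideal (PS K r)) (b : ℕ → ℕ → ℕ) : Prop :=
  ∃ (φ : (i : ℕ) → (FreeGr K r (b (i + 2)) →ₗ[PS K r] FreeGr K r (b (i + 1))))
    (ε : FreeGr K r (b 1) →ₗ[PS K r] PS K r),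
    (∀ (j : ℕ) (t : Fin (b 1 j)), (ε (Finsupp.single ⟨j, t⟩ 1)).IsHomogeneous (1 + j)) ∧
    (∀ i, IsMinGrMap K r (b (i + 2)) (b (i + 1)) (i + 2) (i + 1) (φ i)) ∧
    LinearMap.range ε = I ∧
    LinearMap.ker ε = LinearMap.range (φ 0) ∧
    ∀ i, LinearMap.ker (φ i) = LinearMap.range (φ (i + 1))

/-- The Pfaffian of a (skew-symmetric) `4 × 4` matrix. -/
def pfaff4 {R : Type} [CommRing R] (N : Matrix (Fin 4) (Fin 4) R) : R :=
  N 0 1 * N 2 3 - N 0 2 * N 1 3 + N 0 3 * N 1 2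

/-- The five submaximal (`4 × 4`) Pfaffians of a skew-symmetric `5 × 5` matrix. -/
def subPfaffian {R : Type} [CommRing R] (M : Matrix (Fin 5) (Fin 5) R) (i : Fin 5) : R :=
  pfaff4 (M.submatrix i.succAbove i.succAbove)

/-- `X = V_+(I)` is the Pfaffian variety defined by the five `4 × 4` Pfaffians of a
skew-symmetric `5 × 5` matrix of linear forms. -/
def IsPfaffianVariety (I : Ideal (PS K r)) : Prop :=
  ∃ M : Matrix (Fin 5) (Fin 5) (PS K r),
    M.transpose = -M ∧ (∀ i j, (M i j).IsHomogeneous 1) ∧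
    I = Ideal.span (Set.range (subPfaffian M))

/-- The vanishing ideal of the coordinate point `(0 : ⋯ : 0 : 1) ∈ ℙ^{r+1}_K`. -/
def pointIdl : Ideal (PS K (r + 1)) :=
  Ideal.span ((X : Fin (r + 2) → PS K (r + 1)) '' {i : Fin (r + 2) | i ≠ Fin.last (r + 1)})

/-- `X = V_+(I) ⊆ ℙ^r_K` is the image of `Z = V_+(J) ⊆ ℙ^{r+1}_K` under the projection
from a point `P ∈ ℙ^{r+1}_K ∖ Z`: after a linear change of coordinates moving `P` to
`(0 : ⋯ : 0 : 1)`, the ideal `I` is the contraction of `J` to `K[x_0, …, x_r]`. -/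
def IsProjectionOf (I : Ideal (PS K r)) (J : Ideal (PS K (r + 1))) : Prop :=
  ∃ ψ : PS K (r + 1) ≃ₐ[K] PS K (r + 1), IsGrAut K (r + 1) ψ ∧
    ¬ Ideal.map ψ J ≤ pointIdl K r ∧
    I = Ideal.comap (rename (Fin.castSucc : Fin (r + 1) → Fin (r + 2))) (Ideal.map ψ J)

/-- The ideal of the Veronese surface `F ⊆ ℙ^5_K`, generated by the `2 × 2` minors of
the generic symmetric `3 × 3` matrix with rows `(x₀,x₁,x₂), (x₁,x₃,x₄), (x₂,x₄,x₅)`. -/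
def veroneseIdeal : Ideal (PS K 5) :=
  Ideal.span {X 0 * X 3 - X 1 * X 1, X 0 * X 4 - X 1 * X 2, X 1 * X 4 - X 2 * X 3,
    X 0 * X 5 - X 2 * X 2, X 1 * X 5 - X 2 * X 4, X 3 * X 5 - X 4 * X 4}

/-- The determinant of the generic symmetric `3 × 3` matrix defining the Veronese
surface; it cuts out the secant variety of `F ⊆ ℙ^5_K`. -/
def veroneseDet : PS K 5 :=
  X 0 * X 3 * X 5 - X 0 * X 4 * X 4 - X 1 * X 1 * X 5 + 2 * (X 1 * X 2 * X 4) -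
    X 2 * X 2 * X 3

/-- `X = V_+(I) ⊆ ℙ^4_K` is a generic projection of the Veronese surface `F ⊆ ℙ^5_K`,
i.e. the projection of `F` from a point `P ∈ ℙ^5_K ∖ F` at which the generic symmetric
`3 × 3` matrix `M` has rank `3` (equivalently, `P` does not lie on the secant variety
`{det M = 0}` of `F`). -/
def IsGenProjVeronese4 (I : Ideal (PS K 4)) : Prop :=
  ∃ ψ : PS K 5 ≃ₐ[K] PS K 5, IsGrAut K 5 ψ ∧
    ¬ Ideal.map ψ (Ideal.span {veroneseDet K}) ≤ pointIdl K 4 ∧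
    I = Ideal.comap (rename (Fin.castSucc : Fin 5 → Fin 6)) (Ideal.map ψ (veroneseIdeal K))

/-- `X = V_+(I) ⊆ ℙ^r_K` is a generic projection of the Veronese surface (which forces
`r = 4`). -/
def IsGenProjVeronese (I : Ideal (PS K r)) : Prop :=
  ∃ h : r + 1 = 5, IsGenProjVeronese4 K (Ideal.map (rename (Fin.cast h)) I)

/-- `X = V_+(I) ⊆ ℙ^r_K` is a generic projection of (a cone over) the Veronese surface
`F ⊆ ℙ^5_K`:  `X` is the projection of a cone `Z ⊆ ℙ^{r+1}_K` over `F` from a point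
not lying on the (cone over the) secant variety of `F`. -/
def IsGenProjVeroneseCone (I : Ideal (PS K r)) : Prop :=
  ∃ (h : 6 ≤ r + 2) (ψ : PS K (r + 1) ≃ₐ[K] PS K (r + 1)), IsGrAut K (r + 1) ψ ∧
    ¬ Ideal.map ψ (Ideal.map (rename (Fin.castLE h))
        (Ideal.span {veroneseDet K})) ≤ pointIdl K r ∧
    I = Ideal.comap (rename (Fin.castSucc : Fin (r + 1) → Fin (r + 2)))
      (Ideal.map ψ (Ideal.map (rename (Fin.castLE h)) (veroneseIdeal K)))

/-- The ideal of the rational normal scroll `S(a_1, …, a_k)`, generated by the `2 × 2`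
minors of the standard `2 × (Σ a_i)` matrix of indeterminates. -/
def scrollIdeal (k : ℕ) (a : Fin k → ℕ) :
    Ideal (MvPolynomial ((i : Fin k) × Fin (a i + 1)) K) :=
  Ideal.span {p | ∃ (i : Fin k) (j : Fin (a i)) (i' : Fin k) (j' : Fin (a i')),
    p = X ⟨i, j.castSucc⟩ * X ⟨i', j'.succ⟩ - X ⟨i, j.succ⟩ * X ⟨i', j'.castSucc⟩}

/-- The affine cone in `K^{r+2}` of the projective scheme `V_+(J) ⊆ ℙ^{r+1}_K`. -/
def zeroSet (J : Ideal (PS K (r + 1))) : Set (Fin (r + 2) → K) :=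
  {v | ∀ f ∈ J, MvPolynomial.eval v f = 0}

/-- Restriction of polynomials to the plane spanned by the vectors `p` and `q`
(i.e. to the line through the corresponding projective points). -/
def lineRestrict (p q : Fin (r + 2) → K) : PS K (r + 1) →ₐ[K] MvPolynomial (Fin 2) K :=
  aeval fun i => MvPolynomial.C (p i) * X 0 + MvPolynomial.C (q i) * X 1

/-- The line through the (independent) points `p`, `q` is a secant line of
`Z = V_+(J)`: the scheme `Z ∩ L ⊆ L ≅ ℙ^1` has length at least `2`, i.e. the
restriction of `J` to the line is contained in a principal ideal generated by a
form of degree `≥ 2` (or is zero, in which case `L ⊆ Z`). -/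
def IsSecantLine (J : Ideal (PS K (r + 1))) (p q : Fin (r + 2) → K) : Prop :=
  ∃ h : MvPolynomial (Fin 2) K,
    (∀ f ∈ J, lineRestrict K r p q f ∈ Ideal.span {h}) ∧
    (h = 0 ∨ ∃ dd : ℕ, 2 ≤ dd ∧ h.IsHomogeneous dd)

/-- The (affine cone over the) secant cone `Sec_P(Z)` of `Z = V_+(J)` with respect to
the point `P = [p]`: the union of `{P}` and of all secant lines of `Z` through `P`. -/
def secantCone (J : Ideal (PS K (r + 1))) (p : Fin (r + 2) → K) : Set (Fin (r + 2) → K) :=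
  {v | ∃ a : K, v = a • p} ∪
    {v | ∃ q : Fin (r + 2) → K, LinearIndependent K ![p, q] ∧ IsSecantLine K r J p q ∧
      ∃ a b : K, v = a • p + b • q}

/-- The (homogeneous) vanishing ideal of a subset of the affine cone `K^{r+2}`. -/
def vanishingIdl (T : Set (Fin (r + 2) → K)) : Ideal (PS K (r + 1)) where
  carrier := {f | ∀ v ∈ T, MvPolynomial.eval v f = 0}
  add_mem' := by
    intro a b ha hb v hv
    rw [map_add, ha v hv, hb v hv, add_zero]
  zero_mem' := by
    intro v hv
    rw [map_zero]
  smul_mem' := by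
    intro c f hf v hv
    rw [smul_eq_mul, map_mul, hf v hv, mul_zero]

/-- `X = V_+(I) ⊆ ℙ^r_K` is the image of `Z = V_+(J) ⊆ ℙ^{r+1}_K` under the linear
projection `π : ℙ^{r+1}_K ∖ {P} → ℙ^r_K` from the point `P = [p]`:  `I` is the
contraction of `J` along the substitution homomorphism induced by a surjective linear
map `K^{r+2} → K^{r+1}` with kernel `K·p`. -/
def IsProjectionFromPoint (I : Ideal (PS K r)) (J : Ideal (PS K (r + 1)))
    (p : Fin (r + 2) → K) : Prop :=
  ∃ π : (Fin (r + 2) → K) →ₗ[K] (Fin (r + 1) → K),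
    Function.Surjective π ∧ LinearMap.ker π = Submodule.span K {p} ∧
    I = Ideal.comap
      (aeval (fun j : Fin (r + 1) =>
        ∑ i : Fin (r + 2), MvPolynomial.C (π (Pi.single i 1) j) * X i) :
          PS K r →ₐ[K] PS K (r + 1)) J

end AMD

namespace QC

section LA
variable {k M N : Type*} [Field k] [AddCommGroup M] [Module k M] [AddCommGroup N] [Module k N]

lemma exists_compl_fin (W V : Submodule k M) [FiniteDimensional k V] (h : W ≤ V) :
    ∃ C : Submodule k M, C ≤ V ∧ W ⊔ C = V ∧ W ⊓ C = ⊥ ∧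
      Module.finrank k C + Module.finrank k W = Module.finrank k V := by
  obtain ⟨C', hC'⟩ := Submodule.exists_isCompl (W.comap V.subtype)
  have e1 : (W.comap V.subtype).map V.subtype = W := by
    rw [Submodule.map_comap_subtype]; exact inf_eq_right.mpr h
  refine ⟨C'.map V.subtype, ?_, ?_, ?_, ?_⟩
  · exact Submodule.map_subtype_le V C'
  · rw [← e1, ← Submodule.map_sup, hC'.sup_eq_top, Submodule.map_top, Submodule.range_subtype]
  · rw [← e1, ← Submodule.map_inf _ V.injective_subtype, hC'.inf_eq_bot, Submodule.map_bot]
  · have h1 := Submodule.finrank_add_eq_of_isCompl hC'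
    have h2 : Module.finrank k (C'.map V.subtype) = Module.finrank k C' :=
      (Submodule.equivMapOfInjective V.subtype V.injective_subtype C').finrank_eq.symm
    have h3 : Module.finrank k W = Module.finrank k (W.comap V.subtype) := by
      conv_lhs => rw [← e1]
      exact (Submodule.equivMapOfInjective V.subtype V.injective_subtype _).finrank_eq.symm
    omega

lemma exists_sup_span_singleton (W V : Submodule k M) [FiniteDimensional k V] (h : W ≤ V)
    (hd : Module.finrank k V ≤ Module.finrank k W + 1) :
    ∃ v ∈ V, V = W ⊔ Submodule.span k {v} := by
  obtain ⟨C, hCV, hC, -, hf⟩ := exists_compl_fin W V h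
  have hC1 : Module.finrank k C ≤ 1 := by omega
  have : FiniteDimensional k C := Submodule.finiteDimensional_of_le hCV
  obtain ⟨v, hv⟩ := finrank_le_one_iff.mp hC1
  refine ⟨v, hCV v.2, ?_⟩
  rw [← hC]
  congr 1
  apply le_antisymm
  · intro x hx
    obtain ⟨c, hc⟩ := hv ⟨x, hx⟩
    rw [Submodule.mem_span_singleton]
    exact ⟨c, by simpa using congrArg Subtype.val hc⟩
  · rw [Submodule.span_singleton_le_iff_mem]; exact v.2

lemma finrank_map_inj (f : M →ₗ[k] N) (hf : Function.Injective f) (p : Submodule k M) :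
    Module.finrank k (p.map f) = Module.finrank k p :=
  (Submodule.equivMapOfInjective f hf p).finrank_eq.symm

/-- dimension of intersection with kernel of functional -/
lemma finrank_inf_ker_add (E : Submodule k M) [FiniteDimensional k E] (f : M →ₗ[k] k) :
    Module.finrank k E ≤ Module.finrank k (E ⊓ LinearMap.ker f : Submodule k M) + 1 := by
  have h := LinearMap.finrank_range_add_finrank_ker (f.domRestrict E)
  have h1 : Module.finrank k (LinearMap.range (f.domRestrict E)) ≤ 1 := by
    simpa using Submodule.finrank_le (LinearMap.range (f.domRestrict E))
  have h2 : Module.finrank k (LinearMap.ker (f.domRestrict E)) =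
      Module.finrank k (E ⊓ LinearMap.ker f : Submodule k M) := by
    rw [← finrank_map_inj E.subtype E.injective_subtype]
    have : (LinearMap.ker (f.domRestrict E)).map E.subtype = E ⊓ LinearMap.ker f := by
      ext x; simp [LinearMap.mem_ker, and_comm]
    rw [this]
  omega

lemma finrank_inf_ker_lt (E : Submodule k M) [FiniteDimensional k E] (f : M →ₗ[k] k)
    {e : M} (he : e ∈ E) (hfe : f e ≠ 0) :
    Module.finrank k (E ⊓ LinearMap.ker f : Submodule k M) + 1 = Module.finrank k E := by
  have h1 := finrank_inf_ker_add E f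
  have h2 : Module.finrank k (E ⊓ LinearMap.ker f : Submodule k M) < Module.finrank k E := by
    apply Submodule.finrank_lt_finrank_of_lt
    refine lt_of_le_of_ne inf_le_left ?_
    intro h
    have : e ∈ E ⊓ LinearMap.ker f := by rw [h]; exact he
    exact hfe this.2
  omega

lemma functional_factor (E : Submodule k M) (f g : M →ₗ[k] k)
    (h : ∀ x ∈ E, f x = 0 → g x = 0) : ∃ a : k, ∀ x ∈ E, g x = a * f x := by
  by_cases hf : ∃ e ∈ E, f e ≠ 0
  · obtain ⟨e, he, hfe⟩ := hf
    refine ⟨g e / f e, fun x hx => ?_⟩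
    have := h (x - (f x / f e) • e) (E.sub_mem hx (E.smul_mem _ he)) (by
      simp [hfe])
    simp only [map_sub, map_smul, smul_eq_mul] at this
    rw [sub_eq_zero.mp this]; field_simp
  · push Not at hf
    exact ⟨0, fun x hx => by rw [h x hx (hf x hx)]; simp⟩

end LA
end QC

namespace QC

section PolyDeg
variable {k : Type*} [Field k]

/-- polynomials of degree at most `n` -/
def PD (k : Type*) [Field k] (n : ℕ) : Submodule k (Polynomial k) := Polynomial.degreeLT k (n + 1)

lemma mem_PD {n : ℕ} {p : Polynomial k} : p ∈ PD k n ↔ p.natDegree ≤ n := by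
  rw [PD, Polynomial.mem_degreeLT, Polynomial.degree_lt_iff_coeff_zero,
    Polynomial.natDegree_le_iff_coeff_eq_zero]
  exact Iff.rfl

instance (n : ℕ) : FiniteDimensional k (PD k n) :=
  Module.Finite.equiv (Polynomial.degreeLTEquiv k (n + 1)).symm

lemma finrank_PD (n : ℕ) : Module.finrank k (PD k n) = n + 1 := by
  rw [PD, (Polynomial.degreeLTEquiv k (n + 1)).finrank_eq]; simp

lemma PD_mul {a b c : ℕ} {p q : Polynomial k} (hp : p ∈ PD k a) (hq : q ∈ PD k b)
    (h : a + b ≤ c) : p * q ∈ PD k c := by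
  rw [mem_PD] at *
  exact (Polynomial.natDegree_mul_le_of_le hp hq).trans h

lemma PD_mono {a b : ℕ} (h : a ≤ b) : PD k a ≤ PD k b := by
  intro p hp; rw [mem_PD] at *; omega

lemma X_mem_PD {n : ℕ} (h : 1 ≤ n) : (Polynomial.X : Polynomial k) ∈ PD k n := by
  rw [mem_PD]; exact Polynomial.natDegree_X_le.trans h

lemma one_mem_PD {n : ℕ} : (1 : Polynomial k) ∈ PD k n := by
  rw [mem_PD]; simp

lemma C_mem_PD {n : ℕ} (a : k) : (Polynomial.C a : Polynomial k) ∈ PD k n := by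
  rw [mem_PD]; simp

/-- multiplication as linear map -/
def pm (q : Polynomial k) : Polynomial k →ₗ[k] Polynomial k := LinearMap.mulLeft k q

@[simp] lemma pm_apply (q p : Polynomial k) : pm q p = q * p := rfl

lemma pm_inj {q : Polynomial k} (hq : q ≠ 0) : Function.Injective (pm q) :=
  fun _ _ h => mul_left_cancel₀ hq h

end PolyDeg

section Cubic
variable {k : Type*} [Field k] {m : ℕ}

/-- the hyperplane `V` of polynomials of degree at most `m` killed by `l` -/
def VH (m : ℕ) (l : Polynomial k →ₗ[k] k) : Submodule k (Polynomial k) := PD k m ⊓ LinearMap.ker l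

lemma mem_VH {l : Polynomial k →ₗ[k] k} {p : Polynomial k} :
    p ∈ VH m l ↔ p ∈ PD k m ∧ l p = 0 := Iff.rfl

lemma VH_le {l : Polynomial k →ₗ[k] k} : VH m l ≤ PD k m := inf_le_left

instance (l : Polynomial k →ₗ[k] k) : FiniteDimensional k (VH m l) :=
  Submodule.finiteDimensional_of_le (VH_le (m := m) (l := l))

lemma R3 (hm : 6 ≤ m) (l : Polynomial k →ₗ[k] k) 
    (w : Polynomial k) (hw : w ∈ PD k m) (hlw : l w = 1)
    (hVV : PD k (2 * m) ≤ VH m l * VH m l)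
    (q : Polynomial k) (hq : q ≠ 0) (hq2 : q ∈ PD k 2)
    (h : ∀ p ∈ PD k (m - 2), l (q * p) = 0) : False := by
  have hV : Module.finrank k (VH m l) + 1 = m + 1 := by
    rw [VH, finrank_inf_ker_lt (PD k m) l hw (by rw [hlw]; exact one_ne_zero), finrank_PD]
  set W := (PD k (m - 2)).map (pm q) with hW
  have hWf : Module.finrank k W = m - 2 + 1 := by
    rw [hW, finrank_map_inj _ (pm_inj hq), finrank_PD]
  have hWV : W ≤ VH m l := by
    rintro _ ⟨p, hp, rfl⟩
    exact ⟨PD_mul hq2 hp (by omega), h p hp⟩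
  obtain ⟨v, hvV, hv⟩ := exists_sup_span_singleton W (VH m l) hWV (by omega)
  have hqW : (PD k (m - 4)).map (pm q) ≤ PD k (m - 2) := by
    rintro _ ⟨p, hp, rfl⟩
    exact PD_mul hq2 hp (by omega)
  obtain ⟨C, hC, hC1, -, hC2⟩ := exists_compl_fin _ _ hqW
  rw [finrank_map_inj _ (pm_inj hq), finrank_PD, finrank_PD] at hC2
  have : FiniteDimensional k C := Submodule.finiteDimensional_of_le hC
  set A1 := (PD k (2 * m - 4)).map (pm (q * q))
  set A2 := C.map (pm (v * q))
  set A3 := Submodule.span k {v * v}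
  have hA1 : Module.finrank k A1 ≤ 2 * m - 4 + 1 := by
    refine (Submodule.finrank_map_le _ _).trans ?_
    rw [finrank_PD]
  have hA2 : Module.finrank k A2 ≤ 2 := by
    refine (Submodule.finrank_map_le _ _).trans ?_
    omega
  have hA3 : Module.finrank k A3 ≤ 1 := by
    simpa using finrank_span_le_card (R := k) {v * v}
  have hvw : ∀ p ∈ PD k (m - 2), v * (q * p) ∈ A1 ⊔ A2 := by
    intro p hp
    rw [← hC1] at hp
    obtain ⟨_, ⟨p', hp', rfl⟩, c, hc, rfl⟩ := Submodule.mem_sup.mp hp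
    refine Submodule.mem_sup.mpr ⟨q * q * (v * p'), ⟨_, PD_mul hvV.1 hp' (by omega), rfl⟩, v * q * c,
      ⟨_, hc, rfl⟩, ?_⟩
    simp only [pm_apply]; ring
  have hle : VH m l * VH m l ≤ A1 ⊔ A2 ⊔ A3 := by
    rw [Submodule.mul_le]
    intro a ha b hb
    rw [hv] at ha hb
    obtain ⟨_, ⟨p, hp, rfl⟩, x, hx, rfl⟩ := Submodule.mem_sup.mp ha
    obtain ⟨_, ⟨p', hp', rfl⟩, x', hx', rfl⟩ := Submodule.mem_sup.mp hb
    obtain ⟨c, rfl⟩ := Submodule.mem_span_singleton.mp hx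
    obtain ⟨c', rfl⟩ := Submodule.mem_span_singleton.mp hx'
    have e : (pm q p + c • v) * (pm q p' + c' • v) =
      (q * q * (p * p')) + (c' • (v * (q * p)) + c • (v * (q * p'))) + (c * c') • (v * v) := by
      simp only [pm_apply, Polynomial.smul_eq_C_mul, map_mul]; ring
    rw [e]
    refine Submodule.add_mem_sup (Submodule.add_mem _ (Submodule.mem_sup_left ?_) 
      (Submodule.add_mem _ (Submodule.smul_mem _ _ (hvw p hp)) (Submodule.smul_mem _ _ (hvw p' hp')))) 
      (Submodule.smul_mem _ _ (Submodule.mem_span_singleton_self _))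
    exact ⟨p * p', PD_mul hp hp' (by omega), rfl⟩
  have hfin := Submodule.finrank_mono (hVV.trans hle)
  rw [finrank_PD] at hfin
  have := Submodule.finrank_add_le_finrank_add_finrank (A1 ⊔ A2) A3
  have := Submodule.finrank_add_le_finrank_add_finrank A1 A2
  omega

/-- `G` -/
def GH (m : ℕ) (l : Polynomial k →ₗ[k] k) : Submodule k (Polynomial k) :=
  PD k (m - 1) ⊓ LinearMap.ker l ⊓ LinearMap.ker (l ∘ₗ pm Polynomial.X)

/-- `G'` -/
def GH' (m : ℕ) (l : Polynomial k →ₗ[k] k) : Submodule k (Polynomial k) :=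
  PD k (m - 2) ⊓ LinearMap.ker l ⊓ LinearMap.ker (l ∘ₗ pm Polynomial.X) ⊓
    LinearMap.ker (l ∘ₗ pm (Polynomial.X * Polynomial.X))

lemma mem_GH {l : Polynomial k →ₗ[k] k} {p : Polynomial k} :
    p ∈ GH m l ↔ p ∈ PD k (m - 1) ∧ l p = 0 ∧ l (Polynomial.X * p) = 0 := by
  simp [GH, and_assoc]

lemma mem_GH' {l : Polynomial k →ₗ[k] k} {p : Polynomial k} :
    p ∈ GH' m l ↔ p ∈ PD k (m - 2) ∧ l p = 0 ∧ l (Polynomial.X * p) = 0 ∧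
      l (Polynomial.X * (Polynomial.X * p)) = 0 := by
  simp [GH', and_assoc, mul_assoc]

instance (l : Polynomial k →ₗ[k] k) : FiniteDimensional k (GH m l) :=
  Submodule.finiteDimensional_of_le (inf_le_left.trans inf_le_left : GH m l ≤ PD k (m - 1))
instance (l : Polynomial k →ₗ[k] k) : FiniteDimensional k (GH' m l) :=
  Submodule.finiteDimensional_of_le 
    (inf_le_left.trans (inf_le_left.trans inf_le_left) : GH' m l ≤ PD k (m - 2))

section
variable (hm : 6 ≤ m) (l : Polynomial k →ₗ[k] k) 
    (hR : ∀ q : Polynomial k, q ≠ 0 → q ∈ PD k 2 → (∀ p ∈ PD k (m - 2), l (q * p) = 0) → False)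
include hm hR

lemma exists_e0 : ∃ e ∈ PD k (m - 1), l e = 0 ∧ l (Polynomial.X * e) = 1 := by
  by_cases h : ∃ e ∈ PD k (m - 1), l e = 0 ∧ l (Polynomial.X * e) ≠ 0
  · obtain ⟨e, he, h1, h2⟩ := h
    refine ⟨(l (Polynomial.X * e))⁻¹ • e, Submodule.smul_mem _ _ he, by simp [h1], by simp [h2]⟩
  · exfalso
    push Not at h
    obtain ⟨a, ha⟩ := functional_factor (PD k (m - 1)) l (l ∘ₗ pm Polynomial.X) h
    refine hR (Polynomial.X - Polynomial.C a) (Polynomial.X_sub_C_ne_zero a)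
      (Submodule.sub_mem _ (X_mem_PD (by omega)) (C_mem_PD a)) fun p hp => ?_
    have := ha p (PD_mono (by omega) hp)
    simp only [LinearMap.comp_apply, pm_apply] at this
    rw [sub_mul, map_sub, this, ← Polynomial.smul_eq_C_mul, map_smul, smul_eq_mul, sub_self]

lemma exists_e1 : ∃ e ∈ PD k (m - 1), l e = -1 ∧ l (Polynomial.X * e) = 0 := by
  obtain ⟨e0, he0, h0, h1⟩ := exists_e0 hm l hR
  by_cases h : ∃ e ∈ PD k (m - 1), l e ≠ 0
  · obtain ⟨e, he, h2⟩ := h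
    refine ⟨-(l e)⁻¹ • (e - l (Polynomial.X * e) • e0), Submodule.smul_mem _ _
      (Submodule.sub_mem _ he (Submodule.smul_mem _ _ he0)), ?_, ?_⟩
    · simp [h0, h2]
    · simp [mul_sub, h1]
  · exfalso
    push Not at h
    exact hR 1 one_ne_zero one_mem_PD fun p hp => by
      rw [one_mul]; exact h p (PD_mono (by omega) hp)

lemma exists_e2 : ∃ e ∈ PD k (m - 2), l e = 0 ∧ l (Polynomial.X * e) = 0 ∧
    l (Polynomial.X * (Polynomial.X * e)) ≠ 0 := by
  by_contra h
  push Not at h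
  obtain ⟨a, ha⟩ := functional_factor (PD k (m - 2) ⊓ LinearMap.ker l) (l ∘ₗ pm Polynomial.X) 
    (l ∘ₗ pm (Polynomial.X * Polynomial.X)) (by
      intro x hx h1
      simpa [mul_assoc] using h x hx.1 hx.2 h1)
  obtain ⟨b, hb⟩ := functional_factor (PD k (m - 2)) l 
    (l ∘ₗ pm (Polynomial.X * Polynomial.X) - a • (l ∘ₗ pm Polynomial.X)) (by
      intro x hx h1
      simp only [LinearMap.sub_apply, LinearMap.smul_apply, smul_eq_mul]
      rw [ha x ⟨hx, h1⟩, sub_self])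
  have hd : (Polynomial.X * Polynomial.X - Polynomial.C a * Polynomial.X - Polynomial.C b : Polynomial k).coeff 2 = 1 := by
    simp
  refine hR (Polynomial.X * Polynomial.X - Polynomial.C a * Polynomial.X - Polynomial.C b) ?_ ?_ ?_
  · intro h0; rw [h0] at hd; simp at hd
  · refine Submodule.sub_mem _ (Submodule.sub_mem _ ?_ ?_) (C_mem_PD b)
    · exact PD_mul (X_mem_PD le_rfl) (X_mem_PD le_rfl) (by omega)
    · exact PD_mul (C_mem_PD a) (X_mem_PD le_rfl) (b := 1) (a := 0) (by omega)
  · intro p hp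
    have := hb p hp
    simp only [LinearMap.sub_apply, LinearMap.smul_apply, smul_eq_mul, LinearMap.comp_apply, pm_apply] at this
    rw [sub_mul, sub_mul, map_sub, map_sub, mul_assoc (Polynomial.C a), ← Polynomial.smul_eq_C_mul,
      ← Polynomial.smul_eq_C_mul, map_smul, map_smul, smul_eq_mul, smul_eq_mul, this, sub_self]

lemma finrank_GH : Module.finrank k (GH m l) = m - 2 := by
  obtain ⟨e0, he0, h0, h1⟩ := exists_e0 hm l hR
  obtain ⟨e1, he1, h2, h3⟩ := exists_e1 hm l hR
  have a1 := finrank_inf_ker_lt (PD k (m - 1)) l he1 (by rw [h2]; simp)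
  have : FiniteDimensional k (PD k (m - 1) ⊓ LinearMap.ker l : Submodule k (Polynomial k)) :=
    Submodule.finiteDimensional_inf_left _ _
  have a2 := finrank_inf_ker_lt (PD k (m - 1) ⊓ LinearMap.ker l) (l ∘ₗ pm Polynomial.X) 
    (e := e0) ⟨he0, h0⟩ (by simp [h1])
  rw [finrank_PD] at a1
  rw [GH]; omega

lemma finrank_GH' : Module.finrank k (GH' m l) = m - 4 := by
  obtain ⟨e2, he2, h2, h3, h4⟩ := exists_e2 hm l hR
  have : FiniteDimensional k (PD k (m - 2) ⊓ LinearMap.ker l : Submodule k (Polynomial k)) :=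
    Submodule.finiteDimensional_inf_left _ _
  have : FiniteDimensional k (PD k (m - 2) ⊓ LinearMap.ker l ⊓ LinearMap.ker (l ∘ₗ pm Polynomial.X) : Submodule k (Polynomial k)) :=
    Submodule.finiteDimensional_inf_left _ _
  have a3 := finrank_inf_ker_lt (PD k (m - 2) ⊓ LinearMap.ker l ⊓ LinearMap.ker (l ∘ₗ pm Polynomial.X)) 
    (l ∘ₗ pm (Polynomial.X * Polynomial.X)) 
    (e := e2) ⟨⟨he2, h2⟩, h3⟩ (by simpa [mul_assoc] using h4)
  have u1 := finrank_inf_ker_add (PD k (m - 2)) l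
  have u2 := finrank_inf_ker_add (PD k (m - 2) ⊓ LinearMap.ker l) (l ∘ₗ pm Polynomial.X)
  have u3 : Module.finrank k (PD k (m - 2) ⊓ LinearMap.ker l ⊓ LinearMap.ker (l ∘ₗ pm Polynomial.X) : Submodule k (Polynomial k)) + 2 ≤ m - 2 + 1 := by
    have b1 : ∃ e ∈ PD k (m - 2), l e ≠ 0 := by
      by_contra h; push Not at h
      exact hR 1 one_ne_zero one_mem_PD fun p hp => by
        rw [one_mul]; exact h p hp
    obtain ⟨e, he, hle⟩ := b1
    have b2 : ∃ e ∈ PD k (m - 2) ⊓ LinearMap.ker l, (l ∘ₗ pm Polynomial.X) e ≠ 0 := by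
      by_contra h; push Not at h
      obtain ⟨a, ha⟩ := functional_factor (PD k (m - 2)) l (l ∘ₗ pm Polynomial.X) 
        (fun x hx h1 => h x ⟨hx, h1⟩)
      refine hR (Polynomial.X - Polynomial.C a) (Polynomial.X_sub_C_ne_zero a)
        (Submodule.sub_mem _ (X_mem_PD (by omega)) (C_mem_PD a)) fun p hp => ?_
      have := ha p hp
      simp only [LinearMap.comp_apply, pm_apply] at this
      rw [sub_mul, map_sub, this, ← Polynomial.smul_eq_C_mul, map_smul, smul_eq_mul, sub_self]
    obtain ⟨e', he', hle'⟩ := b2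
    have := finrank_inf_ker_lt _ _ he hle
    have := finrank_inf_ker_lt _ _ he' hle'
    rw [finrank_PD] at *
    omega
  rw [finrank_PD] at u1
  rw [GH']; omega

lemma VH_eq (w : Polynomial k) (hw : w ∈ PD k m) (hlw : l w = 1) :
    GH m l ⊔ (GH m l).map (pm Polynomial.X) = VH m l := by
  have hV : Module.finrank k (VH m l) + 1 = m + 1 := by
    rw [VH, finrank_inf_ker_lt (PD k m) l hw (by rw [hlw]; exact one_ne_zero), finrank_PD]
  have hX : Function.Injective (pm (Polynomial.X : Polynomial k)) := pm_inj Polynomial.X_ne_zero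
  apply Submodule.eq_of_le_of_finrank_le
  · refine sup_le ?_ ?_
    · intro p hp
      rw [mem_GH] at hp
      exact ⟨PD_mono (by omega) hp.1, hp.2.1⟩
    · rintro _ ⟨p, hp, rfl⟩
      rw [SetLike.mem_coe, mem_GH] at hp
      exact ⟨PD_mul (X_mem_PD le_rfl) hp.1 (by omega), hp.2.2⟩
  · have h1 := Submodule.finrank_sup_add_finrank_inf_eq (GH m l) ((GH m l).map (pm Polynomial.X))
    have h2 : GH m l ⊓ (GH m l).map (pm Polynomial.X) ≤ (GH' m l).map (pm Polynomial.X) := by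
      rintro _ ⟨h, ⟨p, hp, rfl⟩⟩
      refine ⟨p, ?_, rfl⟩
      simp only [SetLike.mem_coe, mem_GH, pm_apply, mem_GH'] at *
      refine ⟨?_, hp.2.1, hp.2.2, h.2.2⟩
      by_cases h0 : p = 0
      · rw [h0]; exact Submodule.zero_mem _
      · have := h.1
        rw [mem_PD, Polynomial.natDegree_X_mul h0] at this
        rw [mem_PD]; omega
    have h3 := Submodule.finrank_mono h2
    rw [finrank_map_inj _ hX, finrank_GH' hm l hR] at h3
    rw [finrank_map_inj _ hX, finrank_GH hm l hR] at h1
    omega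

lemma exists_g0 : ∃ g0 ∈ GH m l, GH m l = 
    GH' m l ⊔ (GH' m l).map (pm Polynomial.X) ⊔ Submodule.span k {g0} := by
  have hX : Function.Injective (pm (Polynomial.X : Polynomial k)) := pm_inj Polynomial.X_ne_zero
  apply exists_sup_span_singleton
  · refine sup_le ?_ ?_
    · intro p hp
      rw [mem_GH'] at hp
      rw [mem_GH]
      exact ⟨PD_mono (by omega) hp.1, hp.2.1, hp.2.2.1⟩
    · rintro _ ⟨p, hp, rfl⟩
      rw [SetLike.mem_coe, mem_GH'] at hp
      rw [mem_GH]
      exact ⟨PD_mul (X_mem_PD le_rfl) hp.1 (by omega), hp.2.2⟩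
  · rw [finrank_GH hm l hR]
    have h4 := finrank_GH' hm l hR
    have : Module.finrank k (GH' m l) < 
      Module.finrank k (GH' m l ⊔ (GH' m l).map (pm Polynomial.X) : Submodule k (Polynomial k)) := by
      apply Submodule.finrank_lt_finrank_of_lt
      refine lt_of_le_of_ne le_sup_left ?_
      intro h
      have h5 : (GH' m l).map (pm Polynomial.X) ≤ GH' m l := by
        conv_rhs => rw [h]
        exact le_sup_right
      have h6 : ∃ p ∈ GH' m l, p ≠ 0 := by
        apply Submodule.exists_mem_ne_zero_of_ne_bot
        intro h0; rw [h0] at h4; simp at h4; omega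
      obtain ⟨p, hp, hp0⟩ := h6
      have h7 : ∀ n : ℕ, Polynomial.X ^ n * p ∈ GH' m l := by
        intro n
        induction n with
        | zero => simpa using hp
        | succ n ih => 
          rw [pow_succ', mul_assoc]
          exact h5 ⟨_, ih, rfl⟩
      have h8 := (mem_GH'.mp (h7 (m + 1))).1
      rw [mem_PD, Polynomial.natDegree_X_pow_mul _ hp0] at h8
      omega
    omega

lemma killer_zero (w : Polynomial k) (hw : w ∈ PD k m) (hlw : l w = 1)
    (g0 : Polynomial k)
    (hG0 : GH m l = GH' m l ⊔ (GH' m l).map (pm Polynomial.X) ⊔ Submodule.span k {g0})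
    (D : Polynomial k →ₗ[k] k) (hD : ∀ v ∈ VH m l, ∀ g ∈ GH m l, D (g * v) = 0)
    (h0 : D (g0 * w) = 0) : ∀ p ∈ PD k (2 * m - 1), D p = 0 := by
  -- D (g x) = D (g w) * l x
  have hx : ∀ g ∈ GH m l, ∀ x ∈ PD k m, D (g * x) = D (g * w) * l x := by
    intro g hg x hx
    have := hD (x - l x • w) ⟨Submodule.sub_mem _ hx (Submodule.smul_mem _ _ hw), by simp [hlw]⟩ g hg
    rw [mul_sub, map_sub, mul_smul_comm, map_smul, smul_eq_mul, sub_eq_zero] at this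
    rw [this, mul_comm]
  -- a linear form killing
  have hlin : ∀ α β : k, (∀ x ∈ PD k (m - 1), α * l x = β * l (Polynomial.X * x)) → α = 0 ∧ β = 0 := by
    intro α β h
    obtain ⟨e0, he0, h0, h1⟩ := exists_e0 hm l hR
    obtain ⟨e1, he1, h2, h3⟩ := exists_e1 hm l hR
    have u := h e0 he0
    have u' := h e1 he1
    rw [h0, h1] at u
    rw [h2, h3] at u'
    constructor
    · simpa using u'
    · simpa using u.symm
  have hG'le : ∀ g ∈ GH' m l, g ∈ GH m l ∧ Polynomial.X * g ∈ GH m l := by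
    intro g hg
    rw [hG0]
    exact ⟨Submodule.mem_sup_left (Submodule.mem_sup_left hg), 
      Submodule.mem_sup_left (Submodule.mem_sup_right ⟨g, hg, rfl⟩)⟩
  have hG' : ∀ g ∈ GH' m l, D (g * w) = 0 ∧ D (Polynomial.X * g * w) = 0 := by
    intro g hg
    obtain ⟨h1, h2⟩ := hG'le g hg
    have := hlin (D (Polynomial.X * g * w)) (D (g * w)) (by
      intro x hxm
      rw [← hx _ h2 x (PD_mono (by omega) hxm), ← hx _ h1 (Polynomial.X * x) 
        (PD_mul (X_mem_PD le_rfl) hxm (by omega))]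
      congr 1; ring)
    exact ⟨this.2, this.1⟩
  have hGw : ∀ g ∈ GH m l, D (g * w) = 0 := by
    intro g hg
    rw [hG0] at hg
    obtain ⟨u, hu, v, hv, rfl⟩ := Submodule.mem_sup.mp hg
    obtain ⟨u1, hu1, _, ⟨u2, hu2, rfl⟩, rfl⟩ := Submodule.mem_sup.mp hu
    obtain ⟨c, rfl⟩ := Submodule.mem_span_singleton.mp hv
    simp only [add_mul, map_add, pm_apply, (hG' u1 hu1).1, (hG' u2 hu2).2, smul_mul_assoc, map_smul, h0,
      smul_zero, add_zero]
  have hGx : ∀ g ∈ GH m l, ∀ x ∈ PD k m, D (g * x) = 0 := by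
    intro g hg x h
    rw [hx g hg x h, hGw g hg, zero_mul]
  have hVx : ∀ v ∈ VH m l, ∀ x ∈ PD k (m - 1), D (v * x) = 0 := by
    intro v hv x hxm
    rw [← VH_eq hm l hR w hw hlw] at hv
    obtain ⟨u1, hu1, _, ⟨u2, hu2, rfl⟩, rfl⟩ := Submodule.mem_sup.mp hv
    have e : (u1 + pm Polynomial.X u2) * x = u1 * x + u2 * (Polynomial.X * x) := by
      simp only [pm_apply]; ring
    rw [e, map_add, hGx u1 hu1 x (PD_mono (by omega) hxm), 
      hGx u2 hu2 _ (PD_mul (X_mem_PD le_rfl) hxm (by omega)), add_zero]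
  have hxe : ∀ x ∈ PD k m, ∀ e ∈ PD k (m - 1), D (x * e) = D (w * e) * l x := by
    intro x hx e he
    have := hVx (x - l x • w) ⟨Submodule.sub_mem _ hx (Submodule.smul_mem _ _ hw), by simp [hlw]⟩ e he
    rw [sub_mul, map_sub, smul_mul_assoc, map_smul, smul_eq_mul, sub_eq_zero] at this
    rw [this, mul_comm]
  have hwe : ∀ e ∈ PD k (m - 2), D (w * e) = 0 ∧ D (w * (Polynomial.X * e)) = 0 := by
    intro e he
    have := hlin (D (w * (Polynomial.X * e))) (D (w * e)) (by
      intro x hxm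
      rw [← hxe x (PD_mono (by omega) hxm) _ (PD_mul (X_mem_PD le_rfl) he (by omega)),
        ← hxe _ (PD_mul (X_mem_PD le_rfl) hxm (by omega)) e (PD_mono (by omega) he)]
      congr 1; ring)
    exact ⟨this.2, this.1⟩
  have hwe' : ∀ e ∈ PD k (m - 1), D (w * e) = 0 := by
    intro e he
    rw [mem_PD] at he
    rw [← Polynomial.divX_mul_X_add e, mul_add, map_add]
    have h1 := (hwe (Polynomial.divX e) (by rw [mem_PD, Polynomial.natDegree_divX_eq_natDegree_tsub_one]; omega)).2
    have h2 := (hwe (Polynomial.C (e.coeff 0)) (C_mem_PD _)).1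
    rw [mul_comm (Polynomial.divX e), h1, h2, add_zero]
  intro p hp
  -- p = X^m * q + r
  have hdiv := Polynomial.modByMonic_add_div p (Polynomial.X ^ m : Polynomial k)
  have hmon : (Polynomial.X ^ m : Polynomial k).Monic := Polynomial.monic_X_pow m
  have hr : p %ₘ (Polynomial.X ^ m) ∈ PD k (m - 1) := by
    have := Polynomial.natDegree_modByMonic_lt p hmon (by
      intro h; have := congrArg Polynomial.natDegree h; simp at this; omega)
    rw [Polynomial.natDegree_X_pow] at this
    rw [mem_PD]; omega
  have hq : p /ₘ (Polynomial.X ^ m) ∈ PD k (m - 1) := by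
    rw [mem_PD, Polynomial.natDegree_divByMonic _ hmon, Polynomial.natDegree_X_pow]
    rw [mem_PD] at hp; omega
  rw [← hdiv, map_add, hxe _ (by rw [mem_PD, Polynomial.natDegree_X_pow]) _ hq, hwe' _ hq, zero_mul, add_zero]
  have := hxe 1 one_mem_PD _ hr
  rw [one_mul] at this
  rw [this, hwe' _ hr, zero_mul]

end

theorem cubic_poly (hm : 6 ≤ m) (l : Polynomial k →ₗ[k] k) 
    (w : Polynomial k) (hw : w ∈ PD k m) (hlw : l w = 1)
    (hVV : PD k (2 * m) ≤ VH m l * VH m l)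
    (a b : Polynomial k) (ha : a ∈ VH m l) (hb : b ∈ VH m l)
    (hab : ∀ q ∈ PD k (2 * m), ∃ x ∈ PD k m, ∃ y ∈ PD k m, q = a * x + b * y) :
    ∃ p1 ∈ VH m l, ∃ q1 ∈ PD k (2 * m), ∃ p2 ∈ VH m l, ∃ q2 ∈ PD k (2 * m),
      ∀ f : Polynomial k →ₗ[k] Polynomial k →ₗ[k] k,
        (∀ v ∈ VH m l, ∀ v' ∈ VH m l, ∀ x ∈ VH m l, f v (v' * x) = f v' (v * x)) →
        f p1 q1 = f p2 q2 → ∃ g : Polynomial k →ₗ[k] k,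
          ∀ v ∈ VH m l, ∀ q ∈ PD k (2 * m), f v q = g (v * q) := by
  have hR := R3 hm l w hw hlw hVV
  obtain ⟨g0, hg0, hG0⟩ := exists_g0 hm l hR
  have hg0' := mem_GH.mp hg0
  have GV : ∀ g ∈ GH m l, g ∈ VH m l ∧ Polynomial.X * g ∈ VH m l := by
    intro g hg
    have := mem_GH.mp hg
    exact ⟨⟨PD_mono (by omega) this.1, this.2.1⟩, 
      ⟨PD_mul (X_mem_PD le_rfl) this.1 (by omega), this.2.2⟩⟩
  refine ⟨g0, (GV g0 hg0).1, Polynomial.X * (g0 * w), 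
    PD_mul (X_mem_PD le_rfl) (PD_mul hg0'.1 hw le_rfl) (by omega), Polynomial.X * g0, (GV g0 hg0).2,
    g0 * w, PD_mul hg0'.1 hw (by omega), ?_⟩
  intro f hf hfg
  -- phi
  set φ : Polynomial k → Polynomial k → k := fun v v' => f v' (v * w) - f v (v' * w) with hφ
  have hanti : ∀ v v', φ v v' = - φ v' v := by intro v v'; simp only [hφ]; ring
  have hcomm : ∀ v ∈ VH m l, ∀ v' ∈ VH m l, ∀ x ∈ PD k m, 
      f v (v' * x) = f v' (v * x) - l x * φ v v' := by
    intro v hv v' hv' x hx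
    have := hf v hv v' hv' (x - l x • w) ⟨Submodule.sub_mem _ hx (Submodule.smul_mem _ _ hw), by simp [hlw]⟩
    simp only [mul_sub, map_sub, mul_smul_comm, map_smul, smul_eq_mul] at this
    simp only [hφ]
    linear_combination this
  let D : Polynomial k → Polynomial k →ₗ[k] k := fun g => 
    (f g) ∘ₗ (pm Polynomial.X) - f (Polynomial.X * g)
  have hDdef : ∀ g c, D g c = f g (Polynomial.X * c) - f (Polynomial.X * g) c := fun g c => rfl
  have hDve : ∀ g ∈ GH m l, ∀ v ∈ VH m l, ∀ e ∈ PD k (m - 1), 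
      D g (v * e) = l (Polynomial.X * e) * φ v g - l e * φ v (Polynomial.X * g) := by
    intro g hg v hv e he
    obtain ⟨h1, h2⟩ := GV g hg
    have e1 := hcomm g h1 v hv (Polynomial.X * e) (PD_mul (X_mem_PD le_rfl) he (by omega))
    have e2 := hcomm (Polynomial.X * g) h2 v hv e (PD_mono (by omega) he)
    have e3 : Polynomial.X * (v * e) = v * (Polynomial.X * e) := by ring
    have e4 : Polynomial.X * g * e = g * (Polynomial.X * e) := by ring
    rw [hDdef, e3, e1, e2, e4, hanti g v, hanti _ v]; ring
  have hDk : ∀ g ∈ GH m l, D g (g0 * w) = 0 → ∀ p ∈ PD k (2 * m - 1), D g p = 0 := by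
    intro g hg h0
    refine killer_zero hm l hR w hw hlw g0 hG0 (D g) ?_ h0
    intro v hv g' hg'
    have := mem_GH.mp hg'
    rw [mul_comm, hDve g hg v hv g' this.1, this.2.1, this.2.2]; simp
  obtain ⟨e0, he0, h00, h01⟩ := exists_e0 hm l hR
  obtain ⟨e1, he1, h10, h11⟩ := exists_e1 hm l hR
  have hp0 : ∀ v ∈ VH m l, ∀ g ∈ GH m l, φ v g = D g (v * e0) := by
    intro v hv g hg
    rw [hDve g hg v hv e0 he0, h00, h01]; ring
  have hp1 : ∀ v ∈ VH m l, ∀ g ∈ GH m l, φ v (Polynomial.X * g) = D g (v * e1) := by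
    intro v hv g hg
    rw [hDve g hg v hv e1 he1, h10, h11]; ring
  have hgx : ∀ g ∈ GH m l, ∀ g' ∈ GH m l, ∀ x ∈ PD k m, D g (g' * x) = D g (g' * w) * l x := by
    intro g hg g' hg' x hx
    have h1 := mem_GH.mp hg'
    have := hDve g hg (x - l x • w) ⟨Submodule.sub_mem _ hx (Submodule.smul_mem _ _ hw), by simp [hlw]⟩ g' h1.1
    rw [h1.2.1, h1.2.2, sub_mul, map_sub, smul_mul_assoc, map_smul, smul_eq_mul] at this
    rw [mul_comm g' x, mul_comm g' w]
    linear_combination this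
  have hsymm : ∀ g ∈ GH m l, ∀ g' ∈ GH m l, D g (g' * w) = D g' (g * w) := by
    intro g hg g' hg'
    have h1 := hp0 _ (GV g' hg').2 g hg
    have h2 := hp1 g (GV g hg).1 g' hg'
    have e : Polynomial.X * g' * e0 = g' * (Polynomial.X * e0) := by ring
    rw [e, hgx g hg g' hg' _ (PD_mul (X_mem_PD le_rfl) he0 (by omega)), h01] at h1
    rw [hgx g' hg' g hg _ (PD_mono (by omega) he1), h10, hanti] at h2
    rw [h1] at h2
    linear_combination -h2
  have hDall : ∀ g ∈ GH m l, ∀ p ∈ PD k (2 * m - 1), D g p = 0 := by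
    have h1 : ∀ p ∈ PD k (2 * m - 1), D g0 p = 0 := by
      apply hDk g0 hg0
      rw [hDdef, hfg, sub_self]
    intro g hg
    apply hDk g hg
    rw [hsymm g hg g0 hg0]
    exact h1 _ (PD_mul (mem_GH.mp hg).1 hw (by omega))
  have hφ0 : ∀ v ∈ VH m l, ∀ v' ∈ VH m l, φ v v' = 0 := by
    intro v hv v' hv'
    have hv'' := hv'
    rw [← VH_eq hm l hR w hw hlw] at hv'
    obtain ⟨u1, hu1, _, ⟨u2, hu2, rfl⟩, rfl⟩ := Submodule.mem_sup.mp hv'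
    have e : φ v (u1 + pm Polynomial.X u2) = φ v u1 + φ v (Polynomial.X * u2) := by
      simp only [hφ, pm_apply, map_add, LinearMap.add_apply, add_mul]; ring
    rw [e, hp0 v hv u1 hu1, hp1 v hv u2 hu2, hDall u1 hu1 _ (PD_mul hv.1 he0 (by omega)),
      hDall u2 hu2 _ (PD_mul hv.1 he1 (by omega)), add_zero]
  have hcomm' : ∀ v ∈ VH m l, ∀ v' ∈ VH m l, ∀ x ∈ PD k m, f v (v' * x) = f v' (v * x) := by
    intro v hv v' hv' x hx
    rw [hcomm v hv v' hv' x hx, hφ0 v hv v' hv', mul_zero, sub_zero]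
  -- construct g
  let E : (Polynomial k × Polynomial k) →ₗ[k] Polynomial k := 
    LinearMap.coprod (pm a) (pm b)
  let F : (Polynomial k × Polynomial k) →ₗ[k] k := LinearMap.coprod (f a) (f b)
  let Q : Submodule k (Polynomial k × Polynomial k) := (PD k (2 * m)).prod (PD k (2 * m))
  have hker : ∀ z ∈ Q, E z = 0 → F z = 0 := by
    rintro ⟨q1, q2⟩ ⟨hq1, hq2⟩ h
    replace hq1 : q1 ∈ PD k (2 * m) := hq1
    replace hq2 : q2 ∈ PD k (2 * m) := hq2
    simp only [E, LinearMap.coprod_apply, pm_apply] at h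
    simp only [F, LinearMap.coprod_apply]
    obtain ⟨x, hx, y, hy, hxy⟩ := hab 1 one_mem_PD
    -- s
    set s := y * q1 - x * q2 with hs
    have hq1' : q1 = b * s := by
      calc q1 = 1 * q1 := by ring
        _ = (a * x + b * y) * q1 := by rw [← hxy]
        _ = b * s + x * (a * q1 + b * q2) := by rw [hs]; ring
        _ = b * s := by rw [h]; ring
    have hq2' : q2 = - (a * s) := by
      calc q2 = 1 * q2 := by ring
        _ = (a * x + b * y) * q2 := by rw [← hxy]
        _ = - (a * s) + y * (a * q1 + b * q2) := by rw [hs]; ring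
        _ = - (a * s) := by rw [h]; ring
    have hsm : s ∈ PD k m := by
      by_cases hs0 : s = 0
      · rw [hs0]; exact Submodule.zero_mem _
      have hdeg : a.natDegree = m ∨ b.natDegree = m := by
        by_contra hcon
        push Not at hcon
        have h1 := mem_PD.mp ha.1
        have h2 := mem_PD.mp hb.1
        obtain ⟨x', hx', y', hy', hxy'⟩ := hab (Polynomial.X ^ (2 * m)) (by rw [mem_PD, Polynomial.natDegree_X_pow])
        have h3 : a ∈ PD k (m - 1) := by rw [mem_PD]; omega
        have h4 : b ∈ PD k (m - 1) := by rw [mem_PD]; omega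
        have h5 : (Polynomial.X ^ (2 * m) : Polynomial k) ∈ PD k (2 * m - 1) := by
          rw [hxy']
          exact Submodule.add_mem _ (PD_mul h3 hx' (by omega)) (PD_mul h4 hy' (by omega))
        rw [mem_PD, Polynomial.natDegree_X_pow] at h5
        omega
      rw [mem_PD]
      rcases hdeg with hd | hd
      · have ha0 : a ≠ 0 := by rintro rfl; simp at hd; omega
        rw [hq2', mem_PD, Polynomial.natDegree_neg, Polynomial.natDegree_mul ha0 hs0] at hq2
        omega
      · have hb0 : b ≠ 0 := by rintro rfl; simp at hd; omega
        rw [hq1', mem_PD, Polynomial.natDegree_mul hb0 hs0] at hq1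
        omega
    rw [hq1', hq2', map_neg, hcomm' a ha b hb s hsm, add_neg_cancel]
  -- factor F through E on Q
  obtain ⟨g, hg⟩ : ∃ g : Polynomial k →ₗ[k] k, ∀ z ∈ Q, g (E z) = F z := by
    have hle : LinearMap.ker (E.domRestrict Q) ≤ LinearMap.ker (F.domRestrict Q) := by
      intro z hz
      exact hker z.1 z.2 hz
    obtain ⟨g, hg⟩ := LinearMap.exists_extend 
      (((LinearMap.ker (E.domRestrict Q)).liftQ (F.domRestrict Q) hle) ∘ₗ
        (LinearMap.quotKerEquivRange (E.domRestrict Q)).symm.toLinearMap)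
    refine ⟨g, fun z hz => ?_⟩
    have h1 := congrArg (fun h => h ⟨E.domRestrict Q ⟨z, hz⟩, LinearMap.mem_range_self _ _⟩) hg
    simp only [LinearMap.comp_apply] at h1
    have h2 : (LinearMap.quotKerEquivRange (E.domRestrict Q)).symm.toLinearMap 
      ⟨E.domRestrict Q ⟨z, hz⟩, LinearMap.mem_range_self _ _⟩ = Submodule.Quotient.mk ⟨z, hz⟩ := by
      simp only [LinearEquiv.coe_coe, LinearEquiv.symm_apply_eq]
      rfl
    rw [h2, Submodule.liftQ_apply] at h1
    exact h1
  refine ⟨g, fun v hv q hq => ?_⟩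
  obtain ⟨x, hx, y, hy, rfl⟩ := hab q hq
  have := hg (v * x, v * y) ⟨PD_mul hv.1 hx (by omega), PD_mul hv.1 hy (by omega)⟩
  simp only [E, F, LinearMap.coprod_apply, pm_apply] at this
  rw [map_add, hcomm' v hv a ha x hx, hcomm' v hv b hb y hy, ← this]
  congr 1; ring

end Cubic
end QC

namespace QC

section Curve
variable {k : Type*} [Field k]

/-- multiplication by `a` on power series as a linear map -/
def lm (a : PowerSeries k) : PowerSeries k →ₗ[k] PowerSeries k := LinearMap.mulLeft k a

@[simp] lemma lm_apply (a f : PowerSeries k) : lm a f = a * f := rfl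

lemma lm_inj {a : PowerSeries k} (ha : a ≠ 0) : Function.Injective (lm a) :=
  fun _ _ h => mul_left_cancel₀ ha h

/-- first coefficients -/
def rho (k : Type*) [Field k] (j : ℕ) : PowerSeries k →ₗ[k] (Fin j → k) :=
  LinearMap.pi fun i => PowerSeries.coeff (R := k) i.1

lemma rho_eq_zero_iff (j : ℕ) (f : PowerSeries k) : 
    rho k j f = 0 ↔ (PowerSeries.X : PowerSeries k) ^ j ∣ f := by
  rw [PowerSeries.X_pow_dvd_iff]
  constructor
  · intro h i hi
    exact congrFun h ⟨i, hi⟩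
  · intro h
    ext i
    exact h i.1 i.2

lemma X_ne : (PowerSeries.X : PowerSeries k) ≠ 0 := PowerSeries.X_ne_zero

variable (V : Submodule k (PowerSeries k))

/-- the "saturation" of the graded algebra of powers of `V` -/
def At (n : ℕ) : Submodule k (PowerSeries k) where
  carrier := {θ | ∃ N, ∀ v ∈ V ^ N, θ * v ∈ V ^ (N + n)}
  zero_mem' := ⟨0, fun v _ => by simp⟩
  add_mem' := by
    rintro a b ⟨N, hN⟩ ⟨M, hM⟩
    refine ⟨N + M, fun v hv => ?_⟩
    rw [add_mul]
    refine Submodule.add_mem _ ?_ ?_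
    · rw [pow_add] at hv
      refine Submodule.mul_induction_on hv ?_ ?_
      · intro x hx y hy
        rw [← mul_assoc, show N + M + n = N + n + M by ring, pow_add]
        exact Submodule.mul_mem_mul (hN x hx) hy
      · intro x y hx hy; rw [mul_add]; exact Submodule.add_mem _ hx hy
    · rw [add_comm, pow_add] at hv
      refine Submodule.mul_induction_on hv ?_ ?_
      · intro x hx y hy
        rw [← mul_assoc, show N + M + n = M + n + N by ring, pow_add]
        exact Submodule.mul_mem_mul (hM x hx) hy
      · intro x y hx hy; rw [mul_add]; exact Submodule.add_mem _ hx hy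
  smul_mem' := by
    rintro c a ⟨N, hN⟩
    exact ⟨N, fun v hv => by rw [smul_mul_assoc]; exact Submodule.smul_mem _ _ (hN v hv)⟩

variable {V}

lemma mem_At {n : ℕ} {θ : PowerSeries k} : θ ∈ At V n ↔ ∃ N, ∀ v ∈ V ^ N, θ * v ∈ V ^ (N + n) := Iff.rfl

lemma At_ge {n : ℕ} {θ : PowerSeries k} {N : ℕ} (h : ∀ v ∈ V ^ N, θ * v ∈ V ^ (N + n)) (M : ℕ) (hM : N ≤ M) :
    ∀ v ∈ V ^ M, θ * v ∈ V ^ (M + n) := by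
  obtain ⟨j, rfl⟩ := Nat.exists_eq_add_of_le hM
  intro v hv
  rw [pow_add] at hv
  refine Submodule.mul_induction_on hv ?_ ?_
  · intro x hx y hy
    rw [← mul_assoc, show N + j + n = N + n + j by ring, pow_add]
    exact Submodule.mul_mem_mul (h x hx) hy
  · intro x y hx hy; rw [mul_add]; exact Submodule.add_mem _ hx hy

lemma pow_le_At (n : ℕ) : V ^ n ≤ At V n := by
  intro θ hθ
  refine ⟨0, fun v hv => ?_⟩
  rw [pow_add, mul_comm θ v]
  exact Submodule.mul_mem_mul hv hθ

lemma At_mul {i j : ℕ} {a b : PowerSeries k} (ha : a ∈ At V i) (hb : b ∈ At V j) : a * b ∈ At V (i + j) := by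
  obtain ⟨N, hN⟩ := ha
  obtain ⟨M, hM⟩ := hb
  refine ⟨N + M, fun v hv => ?_⟩
  have h1 := At_ge hM (N + M) (by omega) v hv
  have h2 := At_ge hN (N + M + j) (by omega) _ h1
  rw [mul_assoc, show N + M + (i + j) = N + M + j + i by ring]
  exact h2

section
variable (h1 : (1 : PowerSeries k) ∈ V)
include h1

lemma pow_le_succ (n : ℕ) : V ^ n ≤ V ^ (n + 1) := by
  intro x hx
  rw [pow_succ, ← mul_one x]
  exact Submodule.mul_mem_mul hx h1

lemma pow_mono' {i j : ℕ} (h : i ≤ j) : V ^ i ≤ V ^ j :=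
  monotone_nat_of_le_succ (pow_le_succ h1) h

lemma At_le_succ (n : ℕ) : At V n ≤ At V (n + 1) := by
  rintro θ ⟨N, hN⟩
  exact ⟨N, fun v hv => pow_le_succ h1 _ (hN v hv)⟩

variable (hX : PowerSeries.X ∈ V)
include hX

omit h1 in
lemma X_mul_pow {n : ℕ} {x : PowerSeries k} (hx : x ∈ V ^ n) : PowerSeries.X * x ∈ V ^ (n + 1) := by
  rw [pow_succ']
  exact Submodule.mul_mem_mul hX hx

omit h1 in
lemma X_mul_At {n : ℕ} {x : PowerSeries k} (hx : x ∈ At V n) : PowerSeries.X * x ∈ At V (n + 1) := by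
  have : PowerSeries.X ∈ At V 1 := pow_le_At 1 (by simpa using hX)
  rw [add_comm]
  exact At_mul this hx

lemma X_pow_mem {i n : ℕ} (h : i ≤ n) : (PowerSeries.X : PowerSeries k) ^ i ∈ V ^ n :=
  pow_mono' h1 h (Submodule.pow_mem_pow V hX i)

variable (hgen : ∃ n0, ∀ n, n0 ≤ n → V ^ (n + 1) ≤ V ^ n ⊔ (V ^ n).map (lm PowerSeries.X))

omit h1 hX in
include hgen in
lemma At_of_X {n : ℕ} {η : PowerSeries k} (ha : η ∈ At V (n + 1)) (hb : PowerSeries.X * η ∈ At V (n + 1)) :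
    η ∈ At V n := by
  obtain ⟨n0, hn0⟩ := hgen
  obtain ⟨N, hN⟩ := ha
  obtain ⟨M, hM⟩ := hb
  refine ⟨n0 + N + M + 1, fun v hv => ?_⟩
  obtain ⟨a, ha, _, ⟨b, hb, rfl⟩, rfl⟩ := Submodule.mem_sup.mp (hn0 (n0 + N + M) (by omega) hv)
  rw [mul_add, lm_apply, ← mul_assoc, mul_comm η PowerSeries.X]
  refine Submodule.add_mem _ ?_ ?_
  · have := At_ge hN (n0 + N + M) (by omega) a ha
    rwa [show n0 + N + M + 1 + n = n0 + N + M + (n + 1) by ring]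
  · have := At_ge hM (n0 + N + M) (by omega) b hb
    rwa [show n0 + N + M + 1 + n = n0 + N + M + (n + 1) by ring]

variable [FiniteDimensional k V] {m : ℕ}
  (hdim : ∃ n0, ∀ n, n0 ≤ n → Module.finrank k (V ^ (n + 1) : Submodule k (PowerSeries k)) = 
    Module.finrank k (V ^ n : Submodule k (PowerSeries k)) + m)

omit h1 hX in
lemma finpow (n : ℕ) : FiniteDimensional k (V ^ n : Submodule k (PowerSeries k)) := by
  have : V.FG := Module.Finite.iff_fg.mp inferInstance
  exact Module.Finite.iff_fg.mpr (this.pow n)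

include hdim in
lemma At_ord {n : ℕ} {f : PowerSeries k} (hf : f ∈ At V n) (hdvd : PowerSeries.X ^ (m * n + 1) ∣ f) : f = 0 := by
  by_contra hf0
  obtain ⟨n0, hn0⟩ := hdim
  obtain ⟨N, hN⟩ := hf
  set M := n0 + N + m * n with hM
  have h2 : ∀ j, Module.finrank k (V ^ (M + j) : Submodule k (PowerSeries k)) = 
    Module.finrank k (V ^ M : Submodule k (PowerSeries k)) + m * j := by
    intro j
    induction j with
    | zero => simp
    | succ j ih => rw [← add_assoc, hn0 (M + j) (by omega), ih]; ring
  have := finpow (V := V) (M + n)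
  have := finpow (V := V) M
  have hle : (V ^ M).map (lm f) ≤ V ^ (M + n) ⊓ LinearMap.ker (rho k (m * n + 1)) := by
    rintro _ ⟨v, hv, rfl⟩
    refine ⟨At_ge hN M (by omega) v hv, ?_⟩
    show rho k _ (lm f v) = 0
    rw [rho_eq_zero_iff]
    exact hdvd.mul_right v
  have : FiniteDimensional k (V ^ (M + n) ⊓ LinearMap.ker (rho k (m * n + 1)) : Submodule k (PowerSeries k)) :=
    Submodule.finiteDimensional_inf_left _ _
  have h3 := Submodule.finrank_mono hle
  rw [finrank_map_inj _ (lm_inj hf0)] at h3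
  have h4 := LinearMap.finrank_range_add_finrank_ker ((rho k (m * n + 1)).domRestrict (V ^ (M + n)))
  have h5 : Module.finrank k (LinearMap.ker ((rho k (m * n + 1)).domRestrict (V ^ (M + n)))) =
      Module.finrank k (V ^ (M + n) ⊓ LinearMap.ker (rho k (m * n + 1)) : Submodule k (PowerSeries k)) := by
    rw [← finrank_map_inj (V ^ (M + n)).subtype (Submodule.injective_subtype _)]
    have : Submodule.map (V ^ (M + n)).subtype (LinearMap.ker ((rho k (m * n + 1)).domRestrict (V ^ (M + n)))) =
        V ^ (M + n) ⊓ LinearMap.ker (rho k (m * n + 1)) := by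
      ext x; simp [LinearMap.mem_ker, and_comm]
    rw [this]
  have h6 : LinearMap.range ((rho k (m * n + 1)).domRestrict (V ^ (M + n))) = ⊤ := by
    rw [eq_top_iff, ← (Pi.basisFun k (Fin (m * n + 1))).span_eq, Submodule.span_le]
    rintro _ ⟨i, rfl⟩
    refine ⟨⟨PowerSeries.X ^ i.1, X_pow_mem h1 hX (by omega)⟩, ?_⟩
    ext j
    simp [rho, PowerSeries.coeff_X_pow, Pi.single_apply, Fin.ext_iff]
  rw [h6, finrank_top, Module.finrank_fin_fun] at h4
  have := h2 n
  omega

include hdim in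
lemma rho_inj (n : ℕ) : Function.Injective ((rho k (m * n + 1)).domRestrict (At V n)) := by
  rw [← LinearMap.ker_eq_bot, LinearMap.ker_eq_bot']
  intro f hf
  have := (rho_eq_zero_iff _ _).mp hf
  exact Subtype.ext (At_ord h1 hX hdim f.2 this)

include hdim in
lemma At_fin (n : ℕ) : FiniteDimensional k (At V n) := by
  exact Module.Finite.of_injective _ (rho_inj h1 hX hdim n)

include hdim in
lemma At_finrank_le (n : ℕ) : Module.finrank k (At V n) ≤ m * n + 1 := by
  have := At_fin h1 hX hdim n
  have := LinearMap.finrank_le_finrank_of_injective (rho_inj h1 hX hdim n)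
  simpa using this

include hdim hgen in
/-- convexity -/
lemma At_convex (n : ℕ) : 2 * Module.finrank k (At V (n + 1)) = 
    Module.finrank k (At V (n + 1) ⊔ (At V (n + 1)).map (lm PowerSeries.X) : Submodule k (PowerSeries k)) + 
      Module.finrank k (At V n) := by
  have := At_fin h1 hX hdim n
  have := At_fin h1 hX hdim (n + 1)
  have h2 := Submodule.finrank_sup_add_finrank_inf_eq (At V (n + 1)) ((At V (n + 1)).map (lm PowerSeries.X))
  have h3 : At V (n + 1) ⊓ (At V (n + 1)).map (lm PowerSeries.X) = (At V n).map (lm PowerSeries.X) := by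
    apply le_antisymm
    · rintro _ ⟨ha, ⟨η, hη, rfl⟩⟩
      exact ⟨η, At_of_X hgen hη ha, rfl⟩
    · rintro _ ⟨η, hη, rfl⟩
      exact ⟨X_mul_At hX hη, ⟨η, At_le_succ h1 n hη, rfl⟩⟩
  rw [h3, finrank_map_inj _ (lm_inj X_ne), finrank_map_inj _ (lm_inj X_ne)] at h2
  omega

omit h1 hX [FiniteDimensional k V] in
lemma pow_zero_finrank : Module.finrank k (V ^ 0 : Submodule k (PowerSeries k)) = 1 := by
  rw [pow_zero, Submodule.one_eq_span]
  exact finrank_span_singleton one_ne_zero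

include hdim in
lemma At_zero : At V 0 = V ^ 0 := by
  have := At_fin h1 hX hdim 0
  refine (Submodule.eq_of_le_of_finrank_le (pow_le_At 0) ?_).symm
  rw [pow_zero_finrank]
  simpa using At_finrank_le h1 hX hdim 0

include h1 hX in
lemma sup_le_pow (n : ℕ) : V ^ n ⊔ (V ^ n).map (lm PowerSeries.X) ≤ V ^ (n + 1) := by
  refine sup_le (pow_le_succ h1 n) ?_
  rintro _ ⟨η, hη, rfl⟩
  exact X_mul_pow hX hη

include h1 hX in
lemma sup_le_At (n : ℕ) : At V n ⊔ (At V n).map (lm PowerSeries.X) ≤ At V (n + 1) := by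
  refine sup_le (At_le_succ h1 n) ?_
  rintro _ ⟨η, hη, rfl⟩
  exact X_mul_At hX hη

include h1 hX in
/-- if generated in degree one step from `n0`, increments decrease -/
lemma pow_concave (n : ℕ) (hg : V ^ (n + 2) ≤ V ^ (n + 1) ⊔ (V ^ (n + 1)).map (lm PowerSeries.X)) : 
    Module.finrank k (V ^ (n + 2) : Submodule k (PowerSeries k)) + Module.finrank k (V ^ n : Submodule k (PowerSeries k)) 
     ≤ 2 * Module.finrank k (V ^ (n + 1) : Submodule k (PowerSeries k)) := by
  have := finpow (V := V) (n + 1)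
  have := finpow (V := V) n
  have h2 := Submodule.finrank_sup_add_finrank_inf_eq (V ^ (n + 1)) ((V ^ (n + 1)).map (lm PowerSeries.X))
  have h3 : (V ^ n).map (lm PowerSeries.X) ≤ V ^ (n + 1) ⊓ (V ^ (n + 1)).map (lm PowerSeries.X) := by
    rintro _ ⟨η, hη, rfl⟩
    exact ⟨X_mul_pow hX hη, ⟨η, pow_le_succ h1 n hη, rfl⟩⟩
  have : FiniteDimensional k (V ^ (n + 1) ⊓ (V ^ (n + 1)).map (lm PowerSeries.X) : Submodule k (PowerSeries k)) :=
    Submodule.finiteDimensional_inf_left _ _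
  have h4 := Submodule.finrank_mono h3
  have h5 := Submodule.finrank_mono hg
  rw [finrank_map_inj _ (lm_inj X_ne)] at h4 h2
  omega

include h1 hX in
lemma gen_succ (n : ℕ) (hg : V ^ (n + 1) ≤ V ^ n ⊔ (V ^ n).map (lm PowerSeries.X)) :
    V ^ (n + 2) ≤ V ^ (n + 1) ⊔ (V ^ (n + 1)).map (lm PowerSeries.X) := by
  rw [show n + 2 = 1 + (n + 1) by ring, pow_add, pow_one, Submodule.mul_le]
  intro v hv x hx
  obtain ⟨a, ha, _, ⟨b, hb, rfl⟩, rfl⟩ := Submodule.mem_sup.mp (hg hx)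
  rw [mul_add, lm_apply, mul_left_comm]
  refine Submodule.add_mem_sup ?_ ⟨v * b, ?_, rfl⟩ <;> rw [pow_succ'] 
  · exact Submodule.mul_mem_mul hv ha
  · exact Submodule.mul_mem_mul hv hb

end
end Curve
end QC

namespace QC

lemma seq_incr_le (a : ℕ → ℕ) (m : ℕ) (hb : ∀ n, a n ≤ m * n + 1)
    (hc : ∀ n, 2 * a (n + 1) ≤ a (n + 2) + a n) (n : ℕ) : a (n + 1) ≤ a n + m := by
  by_contra! h
  have h2 : ∀ j, a (n + j) + (m + 1) ≤ a (n + j + 1) := by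
    intro j
    induction j with
    | zero => rw [add_zero]; omega
    | succ j ih => 
      have h9 : 2 * a (n + j + 1) ≤ a (n + j + 1 + 1) + a (n + j) := hc (n + j)
      rw [show n + (j + 1) = n + j + 1 from rfl]; omega
  have h3 : ∀ j, a n + j * (m + 1) ≤ a (n + j) := by
    intro j
    induction j with
    | zero => simp
    | succ j ih => have := h2 j; rw [← add_assoc]; nlinarith
  have h4 := h3 (m * n + 2)
  have h5 := hb (n + (m * n + 2))
  nlinarith

lemma seq_incr_ge (a : ℕ → ℕ) (m n0 : ℕ) (h0 : a n0 + m ≤ a (n0 + 1))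
    (hc : ∀ n, 2 * a (n + 1) ≤ a (n + 2) + a n) (n : ℕ) (hn : n0 ≤ n) : a n + m ≤ a (n + 1) := by
  induction n, hn using Nat.le_induction with
  | base => exact h0
  | succ n hn ih => have h9 : 2 * a (n + 1) ≤ a (n + 1 + 1) + a n := hc n; omega

lemma seq_incr_conc (a : ℕ → ℕ) (m n0 : ℕ) (h0 : a (n0 + 1) ≤ a n0 + m)
    (hc : ∀ n, n0 ≤ n → a (n + 2) + a n ≤ 2 * a (n + 1)) (n : ℕ) (hn : n0 ≤ n) : a (n + 1) ≤ a n + m := by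
  induction n, hn using Nat.le_induction with
  | base => exact h0
  | succ n hn ih => have h9 : a (n + 1 + 1) + a n ≤ 2 * a (n + 1) := hc n hn; omega

section Curve
variable {k : Type*} [Field k]

/-- the hypotheses on `V` -/
structure CH (V : Submodule k (PowerSeries k)) (m : ℕ) : Prop where
  h1 : (1 : PowerSeries k) ∈ V
  hX : PowerSeries.X ∈ V
  fd : FiniteDimensional k V
  hgen : ∃ n0, ∀ n, n0 ≤ n → V ^ (n + 1) ≤ V ^ n ⊔ (V ^ n).map (lm PowerSeries.X)
  hdim : ∃ n0, ∀ n, n0 ≤ n → Module.finrank k (V ^ (n + 1) : Submodule k (PowerSeries k)) = 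
    Module.finrank k (V ^ n : Submodule k (PowerSeries k)) + m
  hm : 6 ≤ m
  hV : Module.finrank k V = m
  hθ : ∃ n θ, θ ∉ V ^ n ∧ θ ∈ V ^ (n + 1) ∧ PowerSeries.X * θ ∈ V ^ (n + 1)

variable {V : Submodule k (PowerSeries k)} {m : ℕ}

lemma CH.convex (H : CH V m) (n : ℕ) : 2 * Module.finrank k (At V (n + 1)) ≤ 
    Module.finrank k (At V (n + 2)) + Module.finrank k (At V n) := by
  have := H.fd
  have := At_fin H.h1 H.hX H.hdim (n + 2)
  have h2 := At_convex H.h1 H.hX H.hgen H.hdim n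
  have h3 := Submodule.finrank_mono (sup_le_At H.h1 H.hX (n + 1))
  rw [show n + 1 + 1 = n + 2 from rfl] at h3
  omega

lemma CH.incr_le (H : CH V m) (n : ℕ) : Module.finrank k (At V (n + 1)) ≤ Module.finrank k (At V n) + m := by
  have := H.fd
  exact seq_incr_le (fun n => Module.finrank k (At V n)) m (At_finrank_le H.h1 H.hX H.hdim) H.convex n

lemma CH.At0 (H : CH V m) : Module.finrank k (At V 0) = 1 := by
  have := H.fd
  rw [At_zero H.h1 H.hX H.hdim, pow_zero_finrank]

/-- if increments are `m` from `n0` on then `At` is generated by `1,X` from `n0+1` on. -/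
lemma CH.gen_of (H : CH V m) (n0 : ℕ) 
    (h0 : Module.finrank k (At V n0) + m ≤ Module.finrank k (At V (n0 + 1))) (n : ℕ) (hn : n0 ≤ n) :
    At V (n + 2) = At V (n + 1) ⊔ (At V (n + 1)).map (lm PowerSeries.X) := by
  have := H.fd
  have := At_fin H.h1 H.hX H.hdim (n + 2)
  have h2 := At_convex H.h1 H.hX H.hgen H.hdim n
  have h4 := seq_incr_ge (fun n => Module.finrank k (At V n)) m n0 h0 H.convex 
  have h5 := h4 n hn
  have h6 := h4 (n + 1) (by omega)
  have h7 := H.incr_le n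
  have h8 := H.incr_le (n + 1)
  refine (Submodule.eq_of_le_of_finrank_le (sup_le_At H.h1 H.hX (n + 1)) ?_).symm
  show Module.finrank k (At V (n + 1 + 1)) ≤ _
  omega

lemma CH.eq_of (H : CH V m) (n0 : ℕ) (h2 : V ^ (n0 + 1) = At V (n0 + 1))
    (h0 : Module.finrank k (At V n0) + m ≤ Module.finrank k (At V (n0 + 1))) (n : ℕ) (hn : n0 ≤ n) :
    V ^ (n + 1) = At V (n + 1) := by
  have := H.fd
  induction n, hn using Nat.le_induction with
  | base => exact h2
  | succ n hn ih => 
    refine le_antisymm (pow_le_At _) ?_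
    show At V (n + 2) ≤ _
    rw [H.gen_of n0 h0 n hn, ← ih]
    exact sup_le_pow H.h1 H.hX (n + 1)

lemma CH.sup1 (H : CH V m) : 
    Module.finrank k (V ⊔ V.map (lm PowerSeries.X) : Submodule k (PowerSeries k)) + 1 = 2 * m := by
  have := H.fd
  have := At_fin H.h1 H.hX H.hdim 0
  have hVA : V ≤ At V 1 := by simpa using pow_le_At (V := V) 1
  have h2 := Submodule.finrank_sup_add_finrank_inf_eq V (V.map (lm PowerSeries.X))
  rw [finrank_map_inj _ (lm_inj X_ne), H.hV] at h2
  have h3 : V ⊓ V.map (lm PowerSeries.X) = (At V 0).map (lm PowerSeries.X) := by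
    apply le_antisymm
    · rintro _ ⟨ha, ⟨η, hη, rfl⟩⟩
      exact ⟨η, At_of_X H.hgen (hVA hη) (hVA ha), rfl⟩
    · rw [At_zero H.h1 H.hX H.hdim, pow_zero, Submodule.one_eq_span, Submodule.map_span_le]
      rintro _ rfl
      exact ⟨by simpa using H.hX, ⟨1, H.h1, rfl⟩⟩
  rw [h3, finrank_map_inj _ (lm_inj X_ne), H.At0] at h2
  omega

lemma CH.gen_from (H : CH V m) (n0 : ℕ) (hg : V ^ (n0 + 1) ≤ V ^ n0 ⊔ (V ^ n0).map (lm PowerSeries.X)) 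
    (n : ℕ) (hn : n0 ≤ n) : V ^ (n + 1) ≤ V ^ n ⊔ (V ^ n).map (lm PowerSeries.X) := by
  have := H.fd
  induction n, hn using Nat.le_induction with
  | base => exact hg
  | succ n hn ih => exact gen_succ H.h1 H.hX n ih

lemma CH.sq_ge (H : CH V m) : 2 * m ≤ Module.finrank k (V ^ 2 : Submodule k (PowerSeries k)) := by
  have := H.fd
  by_contra! h
  have hs := H.sup1
  have := finpow (V := V) 2
  have hle := sup_le_pow H.h1 H.hX 1
  rw [pow_one] at hle
  have he := Submodule.eq_of_le_of_finrank_le hle (by show Module.finrank k (V ^ 2 : Submodule k (PowerSeries k)) ≤ _; omega)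
  have hg : ∀ n, 1 ≤ n → V ^ (n + 1) ≤ V ^ n ⊔ (V ^ n).map (lm PowerSeries.X) := 
    H.gen_from 1 (by rw [pow_one]; exact he.ge)
  obtain ⟨n0, hn0⟩ := H.hdim
  have h1 := seq_incr_conc (fun n => Module.finrank k (V ^ n : Submodule k (PowerSeries k))) (m - 1) 0
    (by rw [zero_add, pow_one, H.hV, pow_zero_finrank]; omega) 
    (fun n _ => pow_concave H.h1 H.hX n (hg (n + 1) (by omega))) n0 (by omega)
  have h2 := hn0 n0 le_rfl
  have := H.hm
  omega

lemma CH.At1 (H : CH V m) : Module.finrank k (At V 1) = m + 1 := by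
  have := H.fd
  have := At_fin H.h1 H.hX H.hdim 1
  have := At_fin H.h1 H.hX H.hdim 2
  have hVA : V ≤ At V 1 := by simpa using pow_le_At (V := V) 1
  have h1 := At_finrank_le H.h1 H.hX H.hdim 1
  have h2 := Submodule.finrank_mono hVA
  rw [H.hV] at h2
  by_contra hne
  have h3 : Module.finrank k (At V 1) = m := by omega
  have e1 : V = At V 1 := Submodule.eq_of_le_of_finrank_le hVA (by rw [H.hV, h3])
  have h4 := H.incr_le 1
  have h5 := H.sq_ge
  have e2 : V ^ 2 = At V 2 := Submodule.eq_of_le_of_finrank_le (pow_le_At 2) (by 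
    show Module.finrank k (At V (1 + 1)) ≤ _; omega)
  have h6 := H.eq_of 1 e2 (by show _ ≤ Module.finrank k (At V 2); rw [← e2]; omega)
  obtain ⟨n, θ, ha, hb, hc⟩ := H.hθ
  apply ha
  have hθ : θ ∈ At V n := At_of_X H.hgen (pow_le_At _ hb) (pow_le_At _ hc)
  rcases n with _ | _ | n
  · rwa [At_zero H.h1 H.hX H.hdim] at hθ
  · rw [zero_add, pow_one, e1]; exact hθ
  · rw [h6 (n + 1) (by omega)]; exact hθ

lemma CH.At_rank (H : CH V m) (n : ℕ) : Module.finrank k (At V n) = m * n + 1 := by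
  have h0 : Module.finrank k (At V 0) + m ≤ Module.finrank k (At V (0 + 1)) := by
    rw [H.At0, zero_add, H.At1]; omega
  have h4 := seq_incr_ge (fun n => Module.finrank k (At V n)) m 0 h0 H.convex 
  induction n with
  | zero => simpa using H.At0
  | succ n ih => 
    have := h4 n (by omega)
    have := H.incr_le n
    rw [mul_add]; omega

lemma CH.At_gen (H : CH V m) (n : ℕ) :
    At V (n + 2) = At V (n + 1) ⊔ (At V (n + 1)).map (lm PowerSeries.X) := 
  H.gen_of 0 (by rw [H.At0, zero_add, H.At1]; omega) n (by omega)

lemma CH.exists_w (H : CH V m) : ∃ w ∈ At V 1, w ∉ V ∧ At V 1 = V ⊔ Submodule.span k {w} := by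
  have := H.fd
  have := At_fin H.h1 H.hX H.hdim 1
  have hVA : V ≤ At V 1 := by simpa using pow_le_At (V := V) 1
  obtain ⟨w, hw, he⟩ := exists_sup_span_singleton V (At V 1) hVA (by rw [H.At1, H.hV])
  refine ⟨w, hw, fun hwV => ?_, he⟩
  have : At V 1 = V := by rw [he, sup_eq_left, Submodule.span_singleton_le_iff_mem]; exact hwV
  have h2 := H.At1
  rw [this, H.hV] at h2
  omega

lemma CH.sq_rank (H : CH V m) : Module.finrank k (V ^ 2 : Submodule k (PowerSeries k)) = 2 * m + 1 := by
  have := H.fd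
  have := finpow (V := V) 2
  have := At_fin H.h1 H.hX H.hdim 2
  have h1 := Submodule.finrank_mono (pow_le_At (V := V) 2)
  rw [H.At_rank] at h1
  have h2 := H.sq_ge
  by_contra hne
  have h3 : Module.finrank k (V ^ 2 : Submodule k (PowerSeries k)) = 2 * m := by omega
  obtain ⟨w, hw, hwV, hAt1⟩ := H.exists_w
  have hle := sup_le_pow H.h1 H.hX 1
  rw [pow_one] at hle
  have hs := H.sup1
  obtain ⟨q0, hq0, hq0e⟩ := exists_sup_span_singleton _ (V ^ 2) hle (by omega)
  -- decomposition of At 2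
  have hdec : ∀ x ∈ At V 2, ∃ u ∈ V ⊔ V.map (lm PowerSeries.X), ∃ α β : k, 
      x = u + (PowerSeries.C α + PowerSeries.C β * PowerSeries.X) * w := by
    intro x hx
    have hx' : x ∈ At V (0 + 2) := hx
    rw [H.At_gen 0] at hx'
    obtain ⟨a, ha, _, ⟨b, hb, rfl⟩, rfl⟩ := Submodule.mem_sup.mp hx'
    rw [zero_add, hAt1] at ha 
    have hb : b ∈ At V 1 := hb
    rw [hAt1] at hb
    obtain ⟨a, ha1, _, hc, rfl⟩ := Submodule.mem_sup.mp ha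
    obtain ⟨α, rfl⟩ := Submodule.mem_span_singleton.mp hc
    obtain ⟨b, hb1, _, hc, rfl⟩ := Submodule.mem_sup.mp hb
    obtain ⟨β, rfl⟩ := Submodule.mem_span_singleton.mp hc
    refine ⟨a + PowerSeries.X * b, Submodule.add_mem_sup ha1 ⟨b, hb1, rfl⟩, α, β, ?_⟩
    simp only [lm_apply, PowerSeries.smul_eq_C_mul]
    ring
  obtain ⟨u, hu, α, β, hq⟩ := hdec q0 (pow_le_At 2 hq0)
  set ℓ := PowerSeries.C α + PowerSeries.C β * PowerSeries.X with hℓ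
  have hq2 : ℓ * w ∈ V ^ 2 := by
    have : ℓ * w = q0 - u := by rw [hq]; ring
    rw [this]; exact Submodule.sub_mem _ hq0 (hle hu)
  have hg2 : V ^ (2 + 1) ≤ V ^ 2 ⊔ (V ^ 2).map (lm PowerSeries.X) := by
    have hCl : ∀ α β : k, ∀ x ∈ V ^ 2, (PowerSeries.C α + PowerSeries.C β * PowerSeries.X) * x ∈ V ^ 2 ⊔ (V ^ 2).map (lm PowerSeries.X) := by
      intro α β x hx
      rw [add_mul, mul_assoc, ← PowerSeries.smul_eq_C_mul, ← PowerSeries.smul_eq_C_mul]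
      exact Submodule.add_mem_sup (Submodule.smul_mem _ _ hx) (Submodule.smul_mem _ _ ⟨x, hx, rfl⟩)
    rw [pow_succ', Submodule.mul_le]
    intro v hv x hx
    rw [hq0e] at hx
    obtain ⟨u', hu', _, hc, rfl⟩ := Submodule.mem_sup.mp hx
    obtain ⟨γ, rfl⟩ := Submodule.mem_span_singleton.mp hc
    have hvu : ∀ u' ∈ V ⊔ V.map (lm PowerSeries.X), v * u' ∈ V ^ 2 ⊔ (V ^ 2).map (lm PowerSeries.X) := by
      intro u' hu'
      obtain ⟨a, ha, _, ⟨b, hb, rfl⟩, rfl⟩ := Submodule.mem_sup.mp hu'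
      rw [mul_add, lm_apply, mul_left_comm]
      refine Submodule.add_mem_sup ?_ ⟨v * b, ?_, rfl⟩ <;> rw [pow_two]
      · exact Submodule.mul_mem_mul hv ha
      · exact Submodule.mul_mem_mul hv hb
    rw [mul_add, mul_smul_comm]
    refine Submodule.add_mem _ (hvu u' hu') (Submodule.smul_mem _ _ ?_)
    rw [hq, mul_add]
    refine Submodule.add_mem _ (hvu u hu) ?_
    have hvw : v * w ∈ At V 2 := At_mul (i := 1) (j := 1) (pow_le_At 1 (by simpa using hv)) hw
    obtain ⟨u2, hu2, γ', δ, h7⟩ := hdec _ hvw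
    rw [mul_left_comm, h7, mul_add, mul_left_comm]
    exact Submodule.add_mem _ (hCl _ _ _ (hle hu2)) (hCl _ _ _ hq2)
  have hg := H.gen_from 2 hg2
  have h4 := seq_incr_conc (fun n => Module.finrank k (V ^ n : Submodule k (PowerSeries k))) m 1
    (by rw [pow_one, H.hV]; show Module.finrank k (V ^ 2 : Submodule k (PowerSeries k)) ≤ _; omega) 
    (fun n hn => pow_concave H.h1 H.hX n (hg (n + 1) (by omega)))
  have h5 : ∀ n, Module.finrank k (V ^ (n + 1) : Submodule k (PowerSeries k)) ≤ m * (n + 1) := by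
    intro n
    induction n with
    | zero => rw [zero_add, pow_one, H.hV, mul_one]
    | succ n ih => have := h4 (n + 1) (by omega); linarith
  obtain ⟨N, hN⟩ := hw
  have h6 : ∀ j, ∀ x ∈ At V (j + 1), ∀ i, i + j ≤ N → PowerSeries.X ^ i * x ∈ V ^ (N + 1) := by
    intro j
    induction j with
    | zero => 
      intro x hx i hi
      rw [zero_add, hAt1] at hx
      obtain ⟨a, ha, _, hc, rfl⟩ := Submodule.mem_sup.mp hx
      obtain ⟨α, rfl⟩ := Submodule.mem_span_singleton.mp hc
      rw [mul_add, mul_smul_comm]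
      refine Submodule.add_mem _ ?_ (Submodule.smul_mem _ _ ?_)
      · rw [pow_succ]
        exact Submodule.mul_mem_mul (X_pow_mem H.h1 H.hX (by omega)) ha
      · rw [mul_comm]
        exact hN _ (X_pow_mem H.h1 H.hX (by omega))
    | succ j ih =>
      intro x hx i hi
      rw [show j + 1 + 1 = j + 2 by ring, H.At_gen j] at hx
      obtain ⟨a, ha, _, ⟨b, hb, rfl⟩, rfl⟩ := Submodule.mem_sup.mp hx
      rw [mul_add, lm_apply, ← mul_assoc, ← pow_succ]
      exact Submodule.add_mem _ (ih a ha i (by omega)) (ih b hb (i + 1) (by omega))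
  have h7 : At V (N + 1) ≤ V ^ (N + 1) := fun x hx => by simpa using h6 N x hx 0 (by omega)
  have := finpow (V := V) (N + 1)
  have h8 := Submodule.finrank_mono h7
  rw [H.At_rank] at h8
  have := h5 N
  omega

lemma CH.pow_eq (H : CH V m) (n : ℕ) (hn : 2 ≤ n) : V ^ n = At V n := by
  have := H.fd
  have := At_fin H.h1 H.hX H.hdim 2
  obtain ⟨n, rfl⟩ : ∃ n', n = n' + 1 := ⟨n - 1, by omega⟩
  refine H.eq_of 1 ?_ ?_ n (by omega)
  · refine Submodule.eq_of_le_of_finrank_le (pow_le_At 2) ?_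
    rw [H.At_rank, H.sq_rank]; omega
  · rw [H.At_rank, H.At_rank]; omega

lemma CH.pow_rank (H : CH V m) (n : ℕ) (hn : 2 ≤ n) : 
    Module.finrank k (V ^ n : Submodule k (PowerSeries k)) = m * n + 1 := by
  rw [H.pow_eq n hn, H.At_rank]

lemma CH.pow_gen (H : CH V m) (n : ℕ) (hn : 2 ≤ n) : 
    V ^ (n + 1) = V ^ n ⊔ (V ^ n).map (lm PowerSeries.X) := by
  obtain ⟨n, rfl⟩ : ∃ n', n = n' + 1 := ⟨n - 1, by omega⟩
  rw [H.pow_eq _ (by omega), H.pow_eq _ hn]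
  exact H.At_gen n

end Curve
end QC

namespace QC

section Curve
variable {k : Type*} [Field k]

lemma aeval_inj_of_order (σ : PowerSeries k) (hσ : IsUnit σ) : 
    Function.Injective (Polynomial.aeval (R := k) (PowerSeries.X * σ)) := by
  rw [injective_iff_map_eq_zero]
  have key : ∀ n : ℕ, ∀ p : Polynomial k, p.natDegree ≤ n → Polynomial.aeval (PowerSeries.X * σ) p = 0 → p = 0 := by
    intro n
    induction n with
    | zero => 
      intro p hp h
      rw [Polynomial.eq_C_of_natDegree_le_zero hp, Polynomial.aeval_C] at h
      rw [Polynomial.eq_C_of_natDegree_le_zero hp]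
      have := congrArg (PowerSeries.constantCoeff (R := k)) h
      have h2 : p.coeff 0 = 0 := by simpa [PowerSeries.algebraMap_apply] using this
      rw [h2, Polynomial.C_0]
    | succ n ih =>
      intro p hp h
      have h1 := Polynomial.divX_mul_X_add p
      rw [← h1] at h
      have h2 := congrArg (PowerSeries.constantCoeff (R := k)) h
      have h3 : p.coeff 0 = 0 := by simpa [PowerSeries.algebraMap_apply] using h2
      rw [h3, Polynomial.C_0, add_zero, map_mul, Polynomial.aeval_X] at h
      have h4 : PowerSeries.X * σ ≠ 0 := mul_ne_zero X_ne hσ.ne_zero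
      have h5 := ih p.divX (by rw [Polynomial.natDegree_divX_eq_natDegree_tsub_one]; omega) 
        ((mul_eq_zero.mp h).resolve_right h4)
      rw [← h1, h5, h3]; simp
  exact fun p => key p.natDegree p le_rfl

/-- The parametrisation maps -/
def Emap (u s : PowerSeries k) (n : ℕ) : Polynomial k →ₗ[k] PowerSeries k :=
  (lm (u ^ n)).comp (Polynomial.aeval s).toLinearMap

lemma Emap_apply (u s : PowerSeries k) (n : ℕ) (p : Polynomial k) : 
  Emap u s n p = u ^ n * Polynomial.aeval s p := rfl

lemma Emap_mul (u s : PowerSeries k) (i j : ℕ) (p q : Polynomial k) : 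
    Emap u s (i + j) (p * q) = Emap u s i p * Emap u s j q := by
  simp only [Emap_apply, map_mul, pow_add]; ring

lemma PD_mem_of_X {A : Submodule k (PowerSeries k)} (E : Polynomial k →ₗ[k] PowerSeries k) (m : ℕ)
    (h : ∀ i ≤ m, E (Polynomial.X ^ i) ∈ A) (p : Polynomial k) (hp : p ∈ PD k m) : E p ∈ A := by
  rw [mem_PD] at hp
  rw [Polynomial.as_sum_range' p (m + 1) (by omega), map_sum]
  refine Submodule.sum_mem _ fun i hi => ?_
  rw [← mul_one (p.coeff i), ← smul_eq_mul, ← Polynomial.smul_monomial, map_smul, Polynomial.monomial_one_right_eq_X_pow]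
  exact Submodule.smul_mem _ _ (h i (by simpa [Nat.lt_succ_iff] using hi))

lemma map_PD_eq {A : Submodule k (PowerSeries k)} [FiniteDimensional k A] (E : Polynomial k →ₗ[k] PowerSeries k) 
    (hE : Function.Injective E) (m : ℕ)
    (h : ∀ p ∈ PD k m, E p ∈ A) (hr : Module.finrank k A = m + 1) : ∀ x ∈ A, ∃ p ∈ PD k m, E p = x := by
  have : (PD k m).map E = A := by
    refine Submodule.eq_of_le_of_finrank_le ?_ ?_
    · rintro _ ⟨p, hp, rfl⟩; exact h p hp
    · rw [finrank_map_inj E hE, finrank_PD, hr]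
  intro x hx
  rw [← this] at hx
  exact hx

/-- structure of `At 1`, `At 2`. -/
lemma rnc (A1 A2 : Submodule k (PowerSeries k)) [FiniteDimensional k A1] [FiniteDimensional k A2] (m : ℕ) (hm : 1 ≤ m)
    (r1 : Module.finrank k A1 = m + 1) (r2 : Module.finrank k A2 = 2 * m + 1)
    (hmul : ∀ a ∈ A1, ∀ b ∈ A1, a * b ∈ A2) 
    (o1 : ∀ f ∈ A1, PowerSeries.X ^ (m + 1) ∣ f → f = 0)
    (o2 : ∀ f ∈ A2, PowerSeries.X ^ (2 * m + 1) ∣ f → f = 0) :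
    ∃ u s : PowerSeries k, (∀ n, Function.Injective (Emap u s n)) ∧ 
      (∀ p ∈ PD k m, Emap u s 1 p ∈ A1) ∧ (∀ x ∈ A1, ∃ p ∈ PD k m, Emap u s 1 p = x) ∧
      (∀ p ∈ PD k (2 * m), Emap u s 2 p ∈ A2) ∧ (∀ x ∈ A2, ∃ p ∈ PD k (2 * m), Emap u s 2 p = x) := by
  have hinj : Function.Injective ((rho k (m + 1)).domRestrict A1) := by
    rw [← LinearMap.ker_eq_bot, LinearMap.ker_eq_bot']
    intro f hf
    exact Subtype.ext (o1 f f.2 ((rho_eq_zero_iff _ _).mp hf))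
  have hsurj : Function.Surjective ((rho k (m + 1)).domRestrict A1) :=
    (LinearMap.injective_iff_surjective_of_finrank_eq_finrank (by simp [r1])).mp hinj
  have hlift : ∀ h : PowerSeries k, ∃ f ∈ A1, PowerSeries.X ^ (m + 1) ∣ h - f := by
    intro h
    obtain ⟨f, hf⟩ := hsurj (rho k (m + 1) h)
    refine ⟨f, f.2, (rho_eq_zero_iff _ _).mp ?_⟩
    rw [map_sub, ← hf]; exact sub_self _
  have hord : ∀ j ≤ m, ∃ ε : PowerSeries k, IsUnit ε ∧ PowerSeries.X ^ j * ε ∈ A1 := by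
    intro j hj
    obtain ⟨f, hf, hd⟩ := hlift (PowerSeries.X ^ j)
    obtain ⟨g, hg⟩ := hd
    refine ⟨1 - PowerSeries.X ^ (m + 1 - j) * g, ?_, ?_⟩
    · rw [PowerSeries.isUnit_iff_constantCoeff]
      have : m + 1 - j ≠ 0 := by omega
      simp [this]
    · have h2 : f = PowerSeries.X ^ j * (1 - PowerSeries.X ^ (m + 1 - j) * g) := by
        rw [mul_sub, ← mul_assoc, ← pow_add, show j + (m + 1 - j) = m + 1 by omega, ← hg]; ring
      rw [← h2]; exact hf
  obtain ⟨ε, hε, he⟩ := hord m le_rfl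
  obtain ⟨ε', hε', he'⟩ := hord (m - 1) (by omega)
  obtain ⟨δ, hδ⟩ := hε.exists_right_inv
  obtain ⟨δ', hδ'⟩ := hε'.exists_right_inv
  have hdiv : ∀ g', PowerSeries.X ^ m * g' ∈ A2 → g' * δ ∈ A1 := by
    intro g' hg
    obtain ⟨f, hf, c, hc⟩ := hlift (g' * δ)
    have h1 : PowerSeries.X ^ m * g' - PowerSeries.X ^ m * ε * f = 0 := by
      refine o2 _ (A2.sub_mem hg (hmul _ he _ hf)) ⟨ε * c, ?_⟩
      have : PowerSeries.X ^ m * g' - PowerSeries.X ^ m * ε * f = PowerSeries.X ^ m * ε * (g' * δ - f) := by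
        linear_combination (PowerSeries.X ^ m * g') * (-hδ)
      rw [this, hc]; ring
    have h2 : PowerSeries.X ^ m * g' = PowerSeries.X ^ m * (ε * f) := by linear_combination h1
    have h3 := mul_left_cancel₀ (pow_ne_zero m X_ne) h2
    have : g' * δ = f := by rw [h3]; linear_combination f * hδ
    rw [this]; exact hf
  set τ := ε' * δ with hτ
  set σ := ε * δ' with hσ
  have hστ : σ * τ = 1 := by rw [hσ, hτ]; linear_combination ε' * δ' * hδ + hδ'
  have hF : ∀ j ≤ m, PowerSeries.X ^ (m - j) * ε * τ ^ j ∈ A1 := by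
    intro j
    induction j with
    | zero => intro _; simpa using he
    | succ j ih =>
      intro hj
      have h1 := hdiv (PowerSeries.X ^ (m - (j + 1)) * ε' * ε * τ ^ j) (by
        have := hmul _ he' _ (ih (by omega))
        convert this using 1
        have e1 : PowerSeries.X (R := k) ^ m = PowerSeries.X * PowerSeries.X ^ (m - 1) := by
          rw [← pow_succ']; congr 1; omega
        have e2 : PowerSeries.X (R := k) ^ (m - j) = PowerSeries.X * PowerSeries.X ^ (m - (j + 1)) := by
          rw [← pow_succ']; congr 1; omega
        rw [e1, e2]; ring)
      convert h1 using 1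
      rw [pow_succ τ, hτ]; ring
  set u := ε * τ ^ m with hu
  set s := PowerSeries.X * σ with hs
  have hτu : IsUnit τ := IsUnit.of_mul_eq_one σ (by rw [mul_comm]; exact hστ)
  have hσu : IsUnit σ := IsUnit.of_mul_eq_one τ hστ
  have hu0 : u ≠ 0 := (hε.mul (hτu.pow m)).ne_zero
  have hEinj : ∀ n, Function.Injective (Emap u s n) := fun n =>
    (lm_inj (pow_ne_zero n hu0)).comp (aeval_inj_of_order σ hσu)
  have hE1X : ∀ i ≤ m, Emap u s 1 (Polynomial.X ^ i) ∈ A1 := by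
    intro i hi
    have := hF (m - i) (by omega)
    rw [show m - (m - i) = i by omega] at this
    convert this using 1
    have e3 : τ ^ m = τ ^ (m - i) * τ ^ i := by rw [← pow_add]; congr 1; omega
    have e4 : σ ^ i * τ ^ i = 1 := by rw [← mul_pow, hστ, one_pow]
    rw [Emap_apply, hu, hs, map_pow, Polynomial.aeval_X, mul_pow, pow_one, e3]
    linear_combination (ε * τ ^ (m - i) * PowerSeries.X ^ i) * e4
  have hE1 := PD_mem_of_X _ m hE1X
  have hE2 : ∀ p ∈ PD k (2 * m), Emap u s 2 p ∈ A2 := by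
    refine PD_mem_of_X _ (2 * m) ?_
    intro i hi
    have : Polynomial.X (R := k) ^ i = Polynomial.X ^ (min i m) * Polynomial.X ^ (i - min i m) := by
      rw [← pow_add]; congr 1; omega
    rw [this, show (2 : ℕ) = 1 + 1 from rfl, Emap_mul]
    exact hmul _ (hE1X _ (by omega)) _ (hE1X _ (by omega))
  exact ⟨u, s, hEinj, hE1, map_PD_eq _ (hEinj 1) m hE1 r1, hE2, map_PD_eq _ (hEinj 2) (2 * m) hE2 r2⟩

theorem CH.cubic {V : Submodule k (PowerSeries k)} {m : ℕ} (H : CH V m) :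
    ∃ p1 ∈ V, ∃ q1 ∈ V ^ 2, ∃ p2 ∈ V, ∃ q2 ∈ V ^ 2,
      ∀ f : PowerSeries k →ₗ[k] PowerSeries k →ₗ[k] k,
        (∀ v ∈ V, ∀ v' ∈ V, ∀ x ∈ V, f v (v' * x) = f v' (v * x)) →
        f p1 q1 = f p2 q2 → ∃ g : PowerSeries k →ₗ[k] k,
          ∀ v ∈ V, ∀ q ∈ V ^ 2, f v q = g (v * q) := by
  have := H.fd
  have := At_fin H.h1 H.hX H.hdim 1
  have := At_fin H.h1 H.hX H.hdim 2
  have hVA : V ≤ At V 1 := by simpa using pow_le_At (V := V) 1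
  have e2 := H.pow_eq 2 le_rfl
  obtain ⟨u, s, hinj, hE1, hE1', hE2, hE2'⟩ := rnc (At V 1) (At V 2) m (by have := H.hm; omega) H.At1 
    (by rw [H.At_rank]; ring) (fun a ha b hb => At_mul ha hb) 
    (fun f hf hd => At_ord H.h1 H.hX H.hdim hf (by simpa using hd))
    (fun f hf hd => At_ord H.h1 H.hX H.hdim hf (by rwa [mul_comm m 2]))
  obtain ⟨w, hw, hwV, hAt1⟩ := H.exists_w
  obtain ⟨l0, hl0, hl0V⟩ : ∃ l0 : PowerSeries k →ₗ[k] k, l0 w = 1 ∧ ∀ v ∈ V, l0 v = 0 := by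
    obtain ⟨f, hf, hfV⟩ := Submodule.exists_le_ker_of_notMem hwV
    refine ⟨(f w)⁻¹ • f, by simp [hf], fun v hv => ?_⟩
    have : f v = 0 := hfV hv
    simp [this]
  set l := l0.comp (Emap u s 1) with hl
  obtain ⟨w', hw', hw'e⟩ := hE1' w hw
  have hVl : ∀ p ∈ VH m l, Emap u s 1 p ∈ V := by
    rintro p ⟨hp, hlp⟩
    have h1 := hE1 p hp
    rw [hAt1] at h1
    obtain ⟨a, ha, _, hc, h2⟩ := Submodule.mem_sup.mp h1
    obtain ⟨α, rfl⟩ := Submodule.mem_span_singleton.mp hc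
    have hlp : l0 (Emap u s 1 p) = 0 := hlp
    rw [← h2, map_add, hl0V a ha, map_smul, hl0, zero_add, smul_eq_mul, mul_one] at hlp
    rw [← h2, hlp, zero_smul, add_zero]; exact ha
  have hVl' : ∀ v ∈ V, ∃ p ∈ VH m l, Emap u s 1 p = v := by
    intro v hv
    obtain ⟨p, hp, rfl⟩ := hE1' v (hVA hv)
    exact ⟨p, ⟨hp, hl0V _ hv⟩, rfl⟩
  obtain ⟨a, ha, hae⟩ := hVl' 1 H.h1
  obtain ⟨b, hb, hbe⟩ := hVl' _ H.hX
  have hVV : PD k (2 * m) ≤ VH m l * VH m l := by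
    intro q hq
    have h1 : V * V ≤ (VH m l * VH m l).map (Emap u s 2) := by
      rw [Submodule.mul_le]
      intro x hx y hy
      obtain ⟨p, hp, rfl⟩ := hVl' x hx
      obtain ⟨p', hp', rfl⟩ := hVl' y hy
      exact ⟨p * p', Submodule.mul_mem_mul hp hp', Emap_mul u s 1 1 p p'⟩
    have h2 := hE2 q hq
    rw [← e2, pow_two] at h2
    obtain ⟨q', hq', he⟩ := h1 h2
    rwa [← hinj 2 he]
  have hab : ∀ q ∈ PD k (2 * m), ∃ x ∈ PD k m, ∃ y ∈ PD k m, q = a * x + b * y := by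
    intro q hq
    have h2 : Emap u s 2 q ∈ At V (0 + 2) := hE2 q hq
    rw [H.At_gen 0] at h2
    obtain ⟨x', hx', _, ⟨y', hy', rfl⟩, h3⟩ := Submodule.mem_sup.mp h2
    obtain ⟨x, hx, rfl⟩ := hE1' x' hx'
    obtain ⟨y, hy, rfl⟩ := hE1' y' hy'
    refine ⟨x, hx, y, hy, hinj 2 ?_⟩
    rw [← h3, map_add, show (2 : ℕ) = 1 + 1 from rfl, Emap_mul, Emap_mul, hae, hbe, one_mul, lm_apply]
  obtain ⟨p1, hp1, q1, hq1, p2, hp2, q2, hq2, hmain⟩ := 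
    cubic_poly H.hm l w' hw' (by rw [hl, LinearMap.comp_apply, hw'e, hl0]) hVV a b ha hb hab
  refine ⟨_, hVl p1 hp1, _, e2 ▸ hE2 q1 hq1, _, hVl p2 hp2, _, e2 ▸ hE2 q2 hq2, ?_⟩
  intro f hf hff
  obtain ⟨g', hg'⟩ := hmain (f.compl₁₂ (Emap u s 1) (Emap u s 2)) (by
    intro v hv v' hv' x hx
    have := hf _ (hVl v hv) _ (hVl v' hv') _ (hVl x hx)
    rw [← Emap_mul, ← Emap_mul] at this
    exact this) hff
  obtain ⟨L, hL⟩ := LinearMap.exists_leftInverse_of_injective (Emap u s 3) (LinearMap.ker_eq_bot.mpr (hinj 3))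
  refine ⟨g'.comp L, fun v hv q hq => ?_⟩
  rw [e2] at hq
  obtain ⟨p, hp, rfl⟩ := hVl' v hv
  obtain ⟨p', hp', rfl⟩ := hE2' q hq
  rw [← Emap_mul]
  have h4 : L (Emap u s (1 + 2) (p * p')) = p * p' := LinearMap.congr_fun hL (p * p')
  rw [LinearMap.comp_apply, h4]
  exact hg' p hp p' hp'

end Curve
end QC

namespace QC

section Res
variable {K : Type} [Field K] {r : ℕ}

/-- graded structure on a module over the polynomial ring -/
structure Gr (K : Type) [Field K] (r : ℕ) (N : Type) [AddCommGroup N] [Module (PS K r) N] [Module K N] where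
  comp : ℕ → N →ₗ[K] N
  comp_comp : ∀ m n x, comp m (comp n x) = if m = n then comp n x else 0
  sum_comp : ∀ x, ∃ n, x = ∑ i ∈ Finset.range n, comp i x
  smul_comp : ∀ (p : PS K r) (i j : ℕ) (x : N), p.IsHomogeneous i → comp j x = x → comp (i + j) (p • x) = p • x
  fd : ∀ n, FiniteDimensional K (LinearMap.range (comp n))

variable {N : Type} [AddCommGroup N] [Module (PS K r) N] [Module K N] [IsScalarTower K (PS K r) N]

/-- degree `n` part -/
def Gr.H (G : Gr K r N) (n : ℕ) : Submodule K N := LinearMap.range (G.comp n)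

omit [IsScalarTower K (PS K r) N] in
lemma Gr.mem_H (G : Gr K r N) {n : ℕ} {x : N} : x ∈ G.H n ↔ G.comp n x = x := by
  constructor
  · rintro ⟨y, rfl⟩; rw [G.comp_comp, if_pos rfl]
  · intro h; exact ⟨x, h⟩

omit [IsScalarTower K (PS K r) N] in
lemma Gr.comp_mem (G : Gr K r N) (n : ℕ) (x : N) : G.comp n x ∈ G.H n := ⟨x, rfl⟩

omit [IsScalarTower K (PS K r) N] in
lemma Gr.comp_of_mem (G : Gr K r N) {m n : ℕ} {x : N} (h : x ∈ G.H n) : G.comp m x = if m = n then x else 0 := by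
  rw [G.mem_H] at h
  conv_lhs => rw [← h]
  rw [G.comp_comp, h]

omit [IsScalarTower K (PS K r) N] in
lemma Gr.smul_mem (G : Gr K r N) {p : PS K r} {i j : ℕ} {x : N} (hp : p.IsHomogeneous i) (hx : x ∈ G.H j) :
    p • x ∈ G.H (i + j) := G.mem_H.mpr (G.smul_comp p i j x hp (G.mem_H.mp hx))

/-- `M_n` -/
def Gr.part (G : Gr K r N) (M : Submodule (PS K r) N) (n : ℕ) : Submodule K N :=
  M.restrictScalars K ⊓ G.H n

/-- `S_1 M_n` -/
def Gr.S1 (G : Gr K r N) (M : Submodule (PS K r) N) (n : ℕ) : Submodule K N :=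
  Submodule.span K {y | ∃ i : Fin (r + 1), ∃ x ∈ G.part M n, y = (X i : PS K r) • x}

lemma Gr.S1_le (G : Gr K r N) (M : Submodule (PS K r) N) (n : ℕ) : G.S1 M n ≤ G.part M (n + 1) := by
  rw [Gr.S1, Submodule.span_le]
  rintro _ ⟨i, x, ⟨h1, h2⟩, rfl⟩
  refine ⟨M.smul_mem _ h1, ?_⟩
  rw [add_comm]
  exact G.smul_mem (isHomogeneous_X _ _) h2

lemma Gr.part_fd (G : Gr K r N) (M : Submodule (PS K r) N) (n : ℕ) : FiniteDimensional K (G.part M n) := by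
  have : FiniteDimensional K (G.H n) := G.fd n
  exact Submodule.finiteDimensional_inf_right _ _

lemma homog_succ_mem (n : ℕ) (p : PS K r) (hp : p.IsHomogeneous (n + 1)) : 
    p ∈ Submodule.span K {y | ∃ i : Fin (r + 1), ∃ q : PS K r, q.IsHomogeneous n ∧ y = X i * q} := by
  have h1 : p ∈ homogeneousSubmodule (Fin (r + 1)) K (n + 1) := hp
  rw [← homogeneousSubmodule_one_pow, pow_succ', homogeneousSubmodule_one_pow, homogeneousSubmodule_one_eq_span_X] at h1
  refine Submodule.mul_induction_on h1 ?_ ?_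
  · intro a ha b hb
    refine Submodule.span_induction ?_ ?_ ?_ ?_ ha
    · rintro _ ⟨i, rfl⟩
      exact Submodule.subset_span ⟨i, b, hb, rfl⟩
    · rw [zero_mul]; exact Submodule.zero_mem _
    · intro x y _ _ hx hy; rw [add_mul]; exact Submodule.add_mem _ hx hy
    · intro c x _ hx; rw [smul_mul_assoc]; exact Submodule.smul_mem _ _ hx
  · intro x y hx hy; exact Submodule.add_mem _ hx hy

lemma Gr.smul_mem_S1 (G : Gr K r N) (M : Submodule (PS K r) N) {p : PS K r} {i j n : ℕ} {x : N} 
    (hp : p.IsHomogeneous i) (hi : 1 ≤ i) (hx : x ∈ G.part M j) (hn : i + j = n + 1) : p • x ∈ G.S1 M n := by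
  obtain ⟨i, rfl⟩ : ∃ i', i = i' + 1 := ⟨i - 1, by omega⟩
  have h1 := homog_succ_mem i p hp
  refine Submodule.span_induction ?_ ?_ ?_ ?_ h1
  · rintro _ ⟨t, q, hq, rfl⟩
    refine Submodule.subset_span ⟨t, q • x, ⟨M.smul_mem _ hx.1, ?_⟩, by rw [mul_smul]⟩
    have := G.smul_mem hq hx.2
    rwa [show i + j = n by omega] at this
  · rw [zero_smul]; exact Submodule.zero_mem _
  · intro x y _ _ hx hy; rw [add_smul]; exact Submodule.add_mem _ hx hy
  · intro c x _ hx; rw [smul_assoc]; exact Submodule.smul_mem _ _ hx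

/-- grading of the polynomial ring -/
def GrS (K : Type) [Field K] (r : ℕ) : Gr K r (PS K r) where
  comp n := homogeneousComponent n
  comp_comp m n x := by
    rw [homogeneousComponent_of_mem (homogeneousComponent_mem n x)]
  sum_comp x := ⟨x.totalDegree + 1, (sum_homogeneousComponent x).symm⟩
  smul_comp p i j x hp hx := by
    have hx' : x.IsHomogeneous j := by rw [← hx]; exact homogeneousComponent_isHomogeneous j x
    exact homogeneousComponent_eq_self (hp.mul hx')
  fd n := by
    have h1 := homogeneousSubmodule_fg (R := K) (σ := Fin (r + 1)) n
    have : FiniteDimensional K (homogeneousSubmodule (Fin (r + 1)) K n) := Module.Finite.iff_fg.mpr h1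
    refine Submodule.finiteDimensional_of_le (S₂ := homogeneousSubmodule (Fin (r + 1)) K n) ?_
    rintro _ ⟨x, rfl⟩
    exact homogeneousComponent_mem n x

lemma GrS_mem {n : ℕ} {p : PS K r} : p ∈ (GrS K r).H n ↔ p.IsHomogeneous n := by
  rw [Gr.mem_H]
  constructor
  · intro h; rw [← h]; exact homogeneousComponent_isHomogeneous n p
  · exact fun h => homogeneousComponent_eq_self h

/-- the component map of a graded free module -/
def freeComp (K : Type) [Field K] (r : ℕ) (β : ℕ → ℕ) (n : ℕ) : AMD.FreeGr K r β →ₗ[K] AMD.FreeGr K r β where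
  toFun x := Finsupp.onFinset x.support 
    (fun g => if g.1 ≤ n then homogeneousComponent (n - g.1) (x g) else 0) (by
      intro g hg
      rw [Finsupp.mem_support_iff]
      rintro h0
      apply hg
      simp [h0])
  map_add' x y := by
    ext1 g
    simp only [Finsupp.onFinset_apply, Finsupp.add_apply, map_add]
    split_ifs <;> simp
  map_smul' c x := by
    ext1 g
    simp only [Finsupp.onFinset_apply, Finsupp.smul_apply, map_smul, RingHom.id_apply]
    split_ifs <;> simp

lemma freeComp_apply (β : ℕ → ℕ) (n : ℕ) (x : AMD.FreeGr K r β) (g) : 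
    freeComp K r β n x g = if g.1 ≤ n then homogeneousComponent (n - g.1) (x g) else 0 := rfl

lemma freeComp_eq_iff (β : ℕ → ℕ) (n : ℕ) (x : AMD.FreeGr K r β) : freeComp K r β n x = x ↔ 
    ∀ g, x g = 0 ∨ (g.1 ≤ n ∧ (x g).IsHomogeneous (n - g.1)) := by
  constructor
  · intro h g
    rw [← h, freeComp_apply]
    split_ifs with h1
    · exact Or.inr ⟨h1, homogeneousComponent_isHomogeneous _ _⟩
    · exact Or.inl rfl
  · intro h
    ext1 g
    rw [freeComp_apply]
    rcases h g with h | ⟨h1, h2⟩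
    · simp [h]
    · rw [if_pos h1, homogeneousComponent_eq_self h2]

/-- grading of the free module -/
def GrF (K : Type) [Field K] (r : ℕ) (β : ℕ → ℕ) : Gr K r (AMD.FreeGr K r β) where
  comp n := freeComp K r β n
  comp_comp m n x := by
    ext1 g
    by_cases hmn : m = n
    · subst hmn
      rw [if_pos rfl, freeComp_apply, freeComp_apply]
      split_ifs with h1
      · rw [homogeneousComponent_eq_self (homogeneousComponent_isHomogeneous _ _)]
      · rfl
    · rw [if_neg hmn, freeComp_apply, freeComp_apply]
      split_ifs with h1 h2
      · rw [homogeneousComponent_of_mem (homogeneousComponent_mem _ _), if_neg (by omega)]; rfl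
      · simp
      · rfl
  sum_comp x := by
    refine ⟨(x.support.sup fun g => g.1 + (x g).totalDegree) + 1, ?_⟩
    set n := (x.support.sup fun g => g.1 + (x g).totalDegree) + 1 with hn
    ext1 g
    rw [Finsupp.finsetSum_apply]
    simp only [freeComp_apply]
    by_cases hg : x g = 0
    · simp [hg]
    have h1 : g.1 + (x g).totalDegree < n := by
      have := Finset.le_sup (f := fun g => g.1 + (x g).totalDegree) (Finsupp.mem_support_iff.mpr hg)
      rw [hn]; omega
    have h2 : ∀ i ∈ Finset.range (n - g.1), homogeneousComponent i (x g) = 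
        (if g.1 ≤ g.1 + i then homogeneousComponent (g.1 + i - g.1) (x g) else 0) := by
      intro i _; rw [if_pos (by omega), Nat.add_sub_cancel_left]
    rw [show n = g.1 + (n - g.1) by omega, Finset.sum_range_add]
    rw [← Finset.sum_congr rfl h2]
    have h3 : ∑ i ∈ Finset.range g.1, (if g.1 ≤ i then homogeneousComponent (i - g.1) (x g) else 0) = 0 := by
      refine Finset.sum_eq_zero fun i hi => if_neg (by simpa using hi)
    rw [h3, zero_add]
    conv_lhs => rw [← sum_homogeneousComponent (x g)]
    refine Finset.sum_subset (by intro i; simp; omega) ?_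
    intro i _ hi
    exact homogeneousComponent_eq_zero _ _ (by simpa using hi)
  smul_comp p i j x hp hx := by
    rw [freeComp_eq_iff] at hx ⊢
    intro g
    rw [Finsupp.smul_apply]
    rcases hx g with h | ⟨h1, h2⟩
    · left; rw [h, smul_zero]
    · right
      refine ⟨by omega, ?_⟩
      rw [show i + j - g.1 = i + (j - g.1) by omega]
      exact hp.mul h2
  fd n := by
    have : ∀ i, FiniteDimensional K (homogeneousSubmodule (Fin (r + 1)) K i) := fun i => 
      Module.Finite.iff_fg.mpr (homogeneousSubmodule_fg (R := K) (σ := Fin (r + 1)) i)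
    let T : LinearMap.range (freeComp K r β n) →ₗ[K] 
      ((g : (j : Fin (n + 1)) × Fin (β j)) → homogeneousSubmodule (Fin (r + 1)) K (n - g.1)) :=
      LinearMap.pi fun g => LinearMap.codRestrict _ 
        ((homogeneousComponent (n - g.1)).comp ((Finsupp.lapply (R := K) (⟨g.1.1, g.2⟩ : (j : ℕ) × Fin (β j))).comp (Submodule.subtype _))) 
        (fun x => homogeneousComponent_mem _ _)
    refine Module.Finite.of_injective T ?_
    have key : ∀ x : LinearMap.range (freeComp K r β n), ∀ j, ∀ t : Fin (β j), x.1 ⟨j, t⟩ = 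
        if h : j ≤ n then (T x ⟨⟨j, by omega⟩, t⟩ : PS K r) else 0 := by
      rintro ⟨_, y, rfl⟩ j t
      split_ifs with h1
      · show freeComp K r β n y ⟨j, t⟩ = homogeneousComponent (n - j) (freeComp K r β n y ⟨j, t⟩)
        rw [freeComp_apply, if_pos h1, homogeneousComponent_eq_self (homogeneousComponent_isHomogeneous _ _)]
      · show freeComp K r β n y ⟨j, t⟩ = 0
        rw [freeComp_apply, if_neg h1]
    intro x y hxy
    ext1
    ext1 ⟨j, t⟩
    rw [key x, key y, hxy]

/-- one step of the resolution -/
theorem res_step (G : Gr K r N) (M : Submodule (PS K r) N) (hgr : ∀ x ∈ M, ∀ n, G.comp n x ∈ M)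
    (h0 : ∀ x ∈ M, G.comp 0 x = 0) :
    ∃ (β : ℕ → ℕ) (φ : AMD.FreeGr K r β →ₗ[PS K r] N), 
      (∀ n, β n + Module.finrank K (G.S1 M n) = Module.finrank K (G.part M (n + 1))) ∧ 
      LinearMap.range φ = M ∧ (∀ j t, φ (Finsupp.single ⟨j, t⟩ 1) ∈ G.part M (j + 1)) ∧
      (∀ x ∈ LinearMap.ker φ, ∀ n, freeComp K r β n x ∈ LinearMap.ker φ) ∧ 
      (∀ x ∈ LinearMap.ker φ, ∀ g, coeff 0 (x g) = 0) := by
  have hfd := G.part_fd M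
  choose C hC1 hC2 hC3 hC4 using fun n => exists_compl_fin _ _ (G.S1_le M n)
  have hCfd : ∀ n, FiniteDimensional K (C n) := fun n => Submodule.finiteDimensional_of_le (hC1 n)
  let β : ℕ → ℕ := fun n => Module.finrank K (C n)
  let c : ∀ n, Module.Basis (Fin (β n)) K (C n) := fun n => Module.finBasis K (C n)
  let φ : AMD.FreeGr K r β →ₗ[PS K r] N := Finsupp.linearCombination (PS K r) (fun g => (c g.1 g.2 : N))
  have hφ : ∀ j t (p : PS K r), φ (Finsupp.single ⟨j, t⟩ p) = p • (c j t : N) := by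
    intro j t p
    simp [φ, Finsupp.linearCombination_single]
  have hcM : ∀ j t, (c j t : N) ∈ G.part M (j + 1) := fun j t => hC1 j (c j t).2
  have hle : LinearMap.range φ ≤ M := by
    rintro _ ⟨x, rfl⟩
    refine Submodule.sum_mem _ fun g _ => M.smul_mem _ (hcM g.1 g.2).1
  have hge : ∀ n, ∀ x ∈ G.part M n, x ∈ LinearMap.range φ := by
    intro n
    induction n with
    | zero => 
      rintro x ⟨h1, h2⟩
      rw [← G.mem_H.mp h2, h0 x h1]; exact Submodule.zero_mem _
    | succ n ih =>
      intro x hx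
      rw [← hC2 n] at hx
      obtain ⟨y, hy, z, hz, rfl⟩ := Submodule.mem_sup.mp hx
      refine Submodule.add_mem _ ?_ ?_
      · refine Submodule.span_induction ?_ ?_ ?_ ?_ hy
        · rintro _ ⟨i, x, hx, rfl⟩
          exact Submodule.smul_mem _ _ (ih x hx)
        · exact Submodule.zero_mem _
        · intro x y _ _ hx hy; exact Submodule.add_mem _ hx hy
        · intro a x _ hx
          rw [← algebraMap_smul (PS K r) a x]
          exact Submodule.smul_mem _ _ hx
      · have := congrArg Subtype.val ((c n).sum_repr ⟨z, hz⟩)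
        rw [← show _ = z from this, AddSubmonoidClass.coe_finsetSum]
        refine Submodule.sum_mem _ fun t _ => ?_
        refine ⟨Finsupp.single ⟨n, t⟩ (algebraMap K _ ((c n).repr ⟨z, hz⟩ t)), ?_⟩
        rw [hφ, algebraMap_smul]; rfl
  have hrange : LinearMap.range φ = M := by
    refine le_antisymm hle fun x hx => ?_
    obtain ⟨n, hn⟩ := G.sum_comp x
    rw [hn]
    exact Submodule.sum_mem _ fun i _ => hge i _ ⟨hgr x hx i, G.comp_mem i x⟩
  -- φ is graded
  have hφgr : ∀ n, ∀ x ∈ (GrF K r β).H n, φ x ∈ G.H (n + 1) := by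
    intro n x hx
    have hx' := (freeComp_eq_iff _ _ _).mp ((Gr.mem_H _).mp hx)
    refine Submodule.sum_mem _ fun g _ => ?_
    rcases hx' g with h | ⟨h1, h2⟩
    · simp [h]
    · have := G.smul_mem h2 (hcM g.1 g.2).2
      rwa [show n - g.1 + (g.1 + 1) = n + 1 by omega] at this
  have hcomm : ∀ n x, φ (freeComp K r β n x) = G.comp (n + 1) (φ x) := by
    intro n x
    obtain ⟨k, hk⟩ := (GrF K r β).sum_comp x
    have h5 : ∀ i, G.comp (n + 1) (φ ((GrF K r β).comp i x)) = if n = i then φ ((GrF K r β).comp i x) else 0 := by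
      intro i
      rw [G.comp_of_mem (hφgr i _ (Gr.comp_mem _ i x))]
      simp
    by_cases hnk : n < k
    · conv_rhs => rw [hk]
      rw [map_sum, map_sum, Finset.sum_congr rfl fun i _ => h5 i, Finset.sum_ite_eq, if_pos (by simpa using hnk)]
      rfl
    · have h6 : freeComp K r β n x = 0 := by
        conv_lhs => rw [hk]
        rw [map_sum]
        refine Finset.sum_eq_zero fun i hi => ?_
        have h7 := (GrF K r β).comp_comp n i x
        rw [if_neg (by simp at hi; omega)] at h7
        exact h7
      rw [h6, map_zero]
      conv_rhs => rw [hk]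
      rw [map_sum, map_sum]
      symm
      refine Finset.sum_eq_zero fun i hi => ?_
      rw [h5, if_neg (by simp at hi; omega)]
  have hker : ∀ x ∈ LinearMap.ker φ, ∀ n, freeComp K r β n x ∈ LinearMap.ker φ := by
    intro x hx n
    rw [LinearMap.mem_ker] at hx ⊢
    rw [hcomm, hx, map_zero]
  refine ⟨β, φ, fun n => hC4 n, hrange, fun j t => by rw [hφ, one_smul]; exact hcM j t, hker, ?_⟩
  rintro x hx ⟨n, t⟩
  have h1 := hker x hx n
  set y := freeComp K r β n x with hy
  have hyt : ∀ t, y ⟨n, t⟩ = MvPolynomial.C (coeff 0 (x ⟨n, t⟩)) := by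
    intro t
    rw [hy, freeComp_apply, if_pos le_rfl]
    simp
  have hyg := (freeComp_eq_iff _ _ _).mp ((GrF K r β).mem_H.mp ((GrF K r β).comp_mem n x))
  -- split
  have hsplit : φ y = (∑ t : Fin (β n), coeff 0 (x ⟨n, t⟩) • (c n t : N)) + 
      ∑ g ∈ y.support.filter (fun g => g.1 ≠ n), y g • (c g.1 g.2 : N) := by
    show Finsupp.sum _ _ = _
    rw [Finsupp.sum, ← Finset.sum_filter_add_sum_filter_not _ (fun g => g.1 = n)]
    congr 1
    have : ∑ t : Fin (β n), coeff 0 (x ⟨n, t⟩) • (c n t : N) = 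
        ∑ g ∈ (Finset.univ : Finset (Fin (β n))).map ⟨fun t => (⟨n, t⟩ : (j : ℕ) × Fin (β j)), fun a b h => by simpa using h⟩, 
          y g • (c g.1 g.2 : N) := by
      rw [Finset.sum_map]
      refine Finset.sum_congr rfl fun t _ => ?_
      change _ = y ⟨n, t⟩ • (c n t : N)
      rw [hyt, ← MvPolynomial.algebraMap_eq, algebraMap_smul]
    rw [this]
    refine Finset.sum_subset ?_ ?_
    · rintro ⟨j, s⟩ hg
      have hj : j = n := (Finset.mem_filter.mp hg).2
      subst hj
      exact Finset.mem_map.mpr ⟨s, Finset.mem_univ _, rfl⟩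
    · intro g hg hg2
      obtain ⟨t', _, rfl⟩ := Finset.mem_map.mp hg
      change y ⟨n, t'⟩ • (c n t' : N) = 0
      have : y ⟨n, t'⟩ = 0 := by
        by_contra h
        exact hg2 (Finset.mem_filter.mpr ⟨Finsupp.mem_support_iff.mpr h, rfl⟩)
      rw [this, zero_smul]
  have h2 : ∑ g ∈ y.support.filter (fun g => g.1 ≠ n), y g • (c g.1 g.2 : N) ∈ G.S1 M n := by
    refine Submodule.sum_mem _ fun g hg => ?_
    rw [Finset.mem_filter] at hg
    rcases hyg g with h | ⟨h3, h4⟩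
    · have h : y g = 0 := h
      rw [h, zero_smul]; exact Submodule.zero_mem _
    · refine G.smul_mem_S1 M (i := n - g.1) h4 (by omega) (hcM g.1 g.2) (by omega)
  have h3 : ∑ t : Fin (β n), coeff 0 (x ⟨n, t⟩) • (c n t : N) ∈ G.S1 M n ⊓ C n := by
    refine ⟨?_, Submodule.sum_mem _ fun t _ => Submodule.smul_mem _ _ (c n t).2⟩
    rw [LinearMap.mem_ker, hsplit] at h1
    rw [eq_neg_of_add_eq_zero_left h1]
    exact Submodule.neg_mem _ h2
  rw [hC3, Submodule.mem_bot] at h3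
  have h4 : ∑ t : Fin (β n), coeff 0 (x ⟨n, t⟩) • c n t = 0 := by
    ext1
    rw [AddSubmonoidClass.coe_finsetSum]
    exact h3
  exact Fintype.linearIndependent_iff.mp (c n).linearIndependent _ h4 t

/-- a state of the resolution process: a graded submodule of a graded free module inside the maximal ideal -/
structure RSt (K : Type) [Field K] (r : ℕ) where
  β : ℕ → ℕ
  M : Submodule (PS K r) (AMD.FreeGr K r β)
  hgr : ∀ x ∈ M, ∀ n, freeComp K r β n x ∈ M
  h0 : ∀ x ∈ M, ∀ g, coeff 0 (x g) = 0

lemma RSt.exists_next (s : RSt K r) : ∃ (s' : RSt K r) (φ : AMD.FreeGr K r s'.β →ₗ[PS K r] AMD.FreeGr K r s.β),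
    LinearMap.range φ = s.M ∧ LinearMap.ker φ = s'.M ∧ 
    ∀ m, AMD.IsMinGrMap K r s'.β s.β (m + 1) m φ := by
  have h0 : ∀ x ∈ s.M, (GrF K r s.β).comp 0 x = 0 := by
    intro x hx
    ext1 g
    change freeComp K r s.β 0 x g = 0
    rw [freeComp_apply]
    split_ifs with h
    · rw [show 0 - g.1 = 0 by omega, homogeneousComponent_zero, s.h0 x hx, map_zero]
    · rfl
  obtain ⟨β, φ, _, h2, h3, h4, h5⟩ := res_step (GrF K r s.β) s.M s.hgr h0
  refine ⟨⟨β, LinearMap.ker φ, h4, h5⟩, φ, h2, rfl, ?_⟩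
  intro m j t j' t'
  have h6 := h3 j t
  have h7 := s.h0 _ h6.1 ⟨j', t'⟩
  rcases (freeComp_eq_iff _ _ _).mp ((GrF K r s.β).mem_H.mp h6.2) ⟨j', t'⟩ with h | ⟨h8, h9⟩
  · exact Or.inl h
  · dsimp only at h8 h9
    by_cases hj : j' = j + 1
    · left
      rw [show j + 1 - j' = 0 by omega] at h9
      have h10 := homogeneousComponent_eq_self h9
      rw [homogeneousComponent_zero, h7, map_zero] at h10
      exact h10.symm
    · exact Or.inr ⟨j + 1 - j', by omega, by omega, h9⟩

/-- existence of minimal graded free resolutions -/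
theorem exists_betti (I : Ideal (PS K r)) (hgr : ∀ x ∈ I, ∀ n, homogeneousComponent n x ∈ I) 
    (h0 : ∀ x ∈ I, homogeneousComponent 0 x = 0) : ∃ b, AMD.HasBettiDiagram K r I b ∧ 
      ∀ j, b 1 j + Module.finrank K ((GrS K r).S1 I j) = Module.finrank K ((GrS K r).part I (j + 1)) := by
  obtain ⟨β, ε, h1, h2, h3, h4, h5⟩ := res_step (GrS K r) I hgr h0
  choose nx φ hφ using fun s : RSt K r => s.exists_next
  let st : ℕ → RSt K r := fun n => Nat.rec ⟨β, LinearMap.ker ε, h4, h5⟩ (fun _ s => nx s) n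
  refine ⟨fun n => match n with | 0 => fun _ => 0 | n + 1 => (st n).β, ⟨fun i => φ (st i), ε, ?_, ?_, h2, ?_, ?_⟩, h1⟩
  · intro j t
    rw [add_comm 1 j]
    exact GrS_mem.mp (h3 j t).2
  · intro i
    exact (hφ (st i)).2.2 (i + 1)
  · exact (hφ (st 0)).1.symm
  · intro i
    exact (hφ (st i)).2.1.trans (hφ (st (i + 1))).1.symm

end Res
end QC

namespace QC

section Quasi
variable {S : Type} [CommRing S]

/-- `I + (y_0,…,y_{n-1})` -/
def Jy (I : Ideal S) (y : ℕ → S) (n : ℕ) : Ideal S := I ⊔ Ideal.span (y '' Set.Iio n)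

/-- the ideal `(y_0,…,y_{n-1})` -/
def Yy (y : ℕ → S) (n : ℕ) : Ideal S := Ideal.span (y '' Set.Iio n)

/-- `y_0,…,y_{d-1}` is a regular sequence modulo `I` -/
def RegY (I : Ideal S) (y : ℕ → S) (d : ℕ) : Prop := ∀ i < d, ∀ f, y i * f ∈ Jy I y i → f ∈ Jy I y i

lemma Jy_eq (I : Ideal S) (y : ℕ → S) (n : ℕ) : Jy I y n = I ⊔ Yy y n := rfl

lemma Jy_zero (I : Ideal S) (y : ℕ → S) : Jy I y 0 = I := by
  simp [Jy]

lemma Yy_succ (y : ℕ → S) (n : ℕ) : Yy y (n + 1) = Yy y n ⊔ Ideal.span {y n} := by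
  rw [Yy, Yy, ← Ideal.span_union, ← Set.image_singleton, ← Set.image_union]
  congr 2
  ext i
  simp only [Set.mem_Iio, Set.mem_union, Set.mem_singleton_iff]
  omega

lemma Jy_succ (I : Ideal S) (y : ℕ → S) (n : ℕ) : Jy I y (n + 1) = Jy I y n ⊔ Ideal.span {y n} := by
  rw [Jy_eq, Jy_eq, Yy_succ, sup_assoc]

lemma Yy_mono (y : ℕ → S) {m n : ℕ} (h : m ≤ n) : Yy y m ≤ Yy y n := 
  Ideal.span_mono (Set.image_mono (Set.Iio_subset_Iio h))

lemma Jy_mono (I : Ideal S) (y : ℕ → S) {m n : ℕ} (h : m ≤ n) : Jy I y m ≤ Jy I y n := 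
  sup_le_sup_left (Yy_mono y h) _

lemma mem_Yy (y : ℕ → S) {i n : ℕ} (h : i < n) : y i ∈ Yy y n := Ideal.subset_span ⟨i, h, rfl⟩

/-- homogeneous forms of degree `N` in the variables `< n` -/
def HF (n N : ℕ) (F : MvPolynomial ℕ S) : Prop := ∀ m, coeff m F ≠ 0 → m.degree = N ∧ ∀ i, n ≤ i → m i = 0

lemma HF.add {n N : ℕ} {F G : MvPolynomial ℕ S} (hF : HF n N F) (hG : HF n N G) : HF n N (F + G) := by
  intro m hm
  by_cases h : coeff m F = 0
  · apply hG; intro h'; apply hm; rw [coeff_add, h, h', add_zero]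
  · exact hF m h

lemma HF.zero (n N : ℕ) : HF n N (0 : MvPolynomial ℕ S) := fun m hm => absurd (coeff_zero m) hm

lemma HF.C_mul {n N : ℕ} {F : MvPolynomial ℕ S} (a : S) (hF : HF n N F) : HF n N (MvPolynomial.C a * F) := by
  intro m hm
  apply hF; intro h'; apply hm; rw [coeff_C_mul, h', mul_zero]

lemma HF.mono {n n' N : ℕ} {F : MvPolynomial ℕ S} (hF : HF n N F) (h : n ≤ n') : HF n' N F := 
  fun m hm => ⟨(hF m hm).1, fun i hi => (hF m hm).2 i (h.trans hi)⟩

lemma HF.X_mul {n N : ℕ} {F : MvPolynomial ℕ S} (hF : HF n N F) {j : ℕ} (hj : j < n) : HF n (N + 1) (X j * F) := by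
  classical
  intro m hm
  rw [coeff_X_mul'] at hm
  split_ifs at hm with h
  · obtain ⟨h1, h2⟩ := hF _ hm
    have h3 : m = (m - Finsupp.single j 1) + Finsupp.single j 1 := by
      rw [tsub_add_cancel_of_le]
      rw [Finsupp.single_le_iff]
      exact Nat.one_le_iff_ne_zero.mpr (Finsupp.mem_support_iff.mp h)
    constructor
    · rw [h3, map_add, h1, Finsupp.degree_single]
    · intro i hi
      rw [h3, Finsupp.add_apply, h2 i hi, Finsupp.single_apply, if_neg (by omega), add_zero]
  · exact absurd rfl hm

/-- elements which are values of forms with coefficients in `J` -/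
lemma HF_exists (y : ℕ → S) (n N : ℕ) : ∀ p ∈ (Yy y n) ^ N, ∃ F : MvPolynomial ℕ S, HF n N F ∧ eval y F = p := by
  induction N with
  | zero => 
    intro p _
    refine ⟨MvPolynomial.C p, ?_, by simp⟩
    intro m hm
    rw [coeff_C] at hm
    split_ifs at hm with h
    · subst h; simp
    · exact absurd rfl hm
  | succ N ih =>
    intro p hp
    rw [pow_succ'] at hp
    refine Submodule.mul_induction_on hp ?_ ?_
    · intro a ha b hb
      obtain ⟨F, hF, rfl⟩ := ih b hb
      refine Submodule.span_induction ?_ ?_ ?_ ?_ ha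
      · rintro _ ⟨j, hj, rfl⟩
        exact ⟨X j * F, hF.X_mul hj, by simp⟩
      · exact ⟨0, HF.zero _ _, by simp⟩
      · rintro x z _ _ ⟨F1, h1, h2⟩ ⟨F2, h3, h4⟩
        exact ⟨F1 + F2, h1.add h3, by rw [map_add, h2, h4, add_mul]⟩
      · rintro c x _ ⟨F1, h1, h2⟩
        exact ⟨MvPolynomial.C c * F1, h1.C_mul c, by rw [map_mul, h2, eval_C, smul_eq_mul, mul_assoc]⟩
    · rintro _ _ ⟨F1, h1, rfl⟩ ⟨F2, h3, rfl⟩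
      exact ⟨F1 + F2, h1.add h3, by rw [map_add]⟩

lemma HF_exists' (y : ℕ → S) (n N : ℕ) : ∀ p ∈ (Yy y n) ^ (N + 1), ∃ F : MvPolynomial ℕ S, HF n N F ∧ eval y F = p ∧ 
    ∀ m, coeff m F ∈ Yy y n := by
  intro p hp
  rw [pow_succ'] at hp
  refine Submodule.mul_induction_on hp ?_ ?_
  · intro a ha b hb
    obtain ⟨F, hF, rfl⟩ := HF_exists y n N b hb
    refine ⟨MvPolynomial.C a * F, hF.C_mul a, by simp, fun m => ?_⟩
    rw [coeff_C_mul]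
    exact Ideal.mul_mem_right _ _ ha
  · rintro _ _ ⟨F1, h1, rfl, h5⟩ ⟨F2, h3, rfl, h6⟩
    exact ⟨F1 + F2, h1.add h3, by rw [map_add], fun m => by rw [coeff_add]; exact Ideal.add_mem _ (h5 m) (h6 m)⟩

lemma HF.monomial_mem {y : ℕ → S} {n N : ℕ} (m : ℕ →₀ ℕ) (h1 : m.degree = N) (h2 : ∀ i, n ≤ i → m i = 0) : 
    (m.prod fun i e => y i ^ e) ∈ (Yy y n) ^ N := by
  rw [← h1, Finsupp.degree_apply, Finsupp.prod]
  rw [← Finset.prod_pow_eq_pow_sum]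
  refine Ideal.prod_mem_prod fun i hi => Ideal.pow_mem_pow (mem_Yy y ?_) _
  by_contra h
  exact (Finsupp.mem_support_iff.mp hi) (h2 i (not_lt.mp h))

lemma HF.eval_mem {y : ℕ → S} {n N : ℕ} {F : MvPolynomial ℕ S} (hF : HF n N F) (J : Ideal S) (hJ : ∀ m, coeff m F ∈ J) : 
    eval y F ∈ J * (Yy y n) ^ N := by
  rw [eval_eq]
  refine Submodule.sum_mem _ fun m hm => Ideal.mul_mem_mul (hJ m) ?_
  obtain ⟨h1, h2⟩ := hF m (mem_support_iff.mp hm)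
  exact HF.monomial_mem m h1 h2

lemma HF.eval_mem' {y : ℕ → S} {n N : ℕ} {F : MvPolynomial ℕ S} (hF : HF n N F) : eval y F ∈ (Yy y n) ^ N := by
  have := hF.eval_mem (y := y) ⊤ (fun _ => trivial)
  rwa [Ideal.top_mul] at this

lemma HF.eval_mem_J {I : Ideal S} {y : ℕ → S} {n N : ℕ} {F : MvPolynomial ℕ S} (hF : HF n N F) 
    (hJ : ∀ m, coeff m F ∈ Jy I y n) : eval y F ∈ I ⊔ (Yy y n) ^ (N + 1) := by
  have := hF.eval_mem (y := y) _ hJ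
  rw [Jy_eq, Ideal.sup_mul, ← pow_succ'] at this
  have h2 : I * Yy y n ^ N ⊔ Yy y n ^ (N + 1) ≤ I ⊔ Yy y n ^ (N + 1) := sup_le_sup_right Ideal.mul_le_left _
  exact h2 this

/-- first form of quasi-regularity for given number and degree implies the second form -/
lemma quasi_aux (I : Ideal S) (y : ℕ → S) (n N : ℕ) 
    (h : ∀ F : MvPolynomial ℕ S, HF n N F → eval y F ∈ I → ∀ m, coeff m F ∈ Jy I y n) : 
    ∀ F : MvPolynomial ℕ S, HF n N F → eval y F ∈ I ⊔ (Yy y n) ^ (N + 1) → ∀ m, coeff m F ∈ Jy I y n := by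
  intro F hF hev m
  obtain ⟨a, ha, b, hb, hab⟩ := Submodule.mem_sup.mp hev
  obtain ⟨G, hG, rfl, hG2⟩ := HF_exists' y n N b hb
  have h1 := h (F + MvPolynomial.C (-1) * G) (hF.add (hG.C_mul _)) (by
    rw [map_add, map_mul, eval_C, ← hab]
    convert ha using 1
    ring) m
  rw [coeff_add, coeff_C_mul] at h1
  have h2 : coeff m G ∈ Jy I y n := Ideal.mem_sup_right (hG2 m)
  have := Ideal.add_mem _ h1 h2
  convert this using 1
  ring

theorem quasi_reg (I : Ideal S) (y : ℕ → S) (d : ℕ) (hreg : RegY I y d) : ∀ n ≤ d, ∀ N, 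
    ∀ F : MvPolynomial ℕ S, HF n N F → eval y F ∈ I → ∀ m, coeff m F ∈ Jy I y n := by
  have hconst : ∀ n, ∀ F : MvPolynomial ℕ S, HF n 0 F → eval y F ∈ I → ∀ m, coeff m F ∈ Jy I y n := by
    intro n F hF hev m
    by_cases hm : coeff m F = 0
    · rw [hm]; exact Ideal.zero_mem _
    have h0 : F = MvPolynomial.C (coeff 0 F) := by
      ext m'
      rw [coeff_C]
      split_ifs with h
      · rw [h]
      · by_contra h2
        exact h ((Finsupp.degree_eq_zero_iff _).mp (hF m' h2).1).symm
    have hm0 := (Finsupp.degree_eq_zero_iff _).mp (hF m hm).1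
    rw [h0, eval_C] at hev
    rw [hm0]
    exact Ideal.mem_sup_left hev
  intro n
  induction n with
  | zero =>
    intro _ N F hF
    refine hconst 0 F fun m hm => ⟨?_, (hF m hm).2⟩
    rw [Finsupp.degree_eq_zero_iff]
    ext i
    exact (hF m hm).2 i (Nat.zero_le _)
  | succ n ih =>
    intro hn
    have hQ' := fun N => quasi_aux I y n N (ih (by omega) N)
    -- y_n is regular modulo powers
    have hR : ∀ j, ∀ ξ, y n * ξ ∈ I ⊔ (Yy y n) ^ j → ξ ∈ I ⊔ (Yy y n) ^ j := by
      intro j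
      induction j with
      | zero => intro ξ _; rw [pow_zero, Ideal.one_eq_top, sup_top_eq]; trivial
      | succ j ihj =>
        intro ξ hξ
        have h0 : I ⊔ Yy y n ^ (j + 1) ≤ I ⊔ Yy y n ^ j := sup_le_sup_left (Ideal.pow_le_pow_right (Nat.le_succ j)) _
        have h1 := ihj ξ (h0 hξ)
        obtain ⟨a, ha, b, hb, rfl⟩ := Submodule.mem_sup.mp h1
        obtain ⟨G, hG, rfl⟩ := HF_exists y n j b hb
        have h2 := hQ' j (MvPolynomial.C (y n) * G) (hG.C_mul _) (by
          rw [map_mul, eval_C]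
          have := Ideal.sub_mem _ hξ (Ideal.mem_sup_left (Ideal.mul_mem_left _ (y n) ha))
          convert this using 1
          ring)
        refine Ideal.add_mem _ (Ideal.mem_sup_left ha) (hG.eval_mem_J fun m => ?_)
        refine hreg n (by omega) _ ?_
        have := h2 m
        rwa [coeff_C_mul] at this
    intro N
    induction N with
    | zero => exact hconst (n + 1)
    | succ N ihN =>
      intro F hF hev
      set H := F.divMonomial (Finsupp.single n 1) with hH
      set G := F.modMonomial (Finsupp.single n 1) with hG
      have hFGH : X n * H + G = F := divMonomial_add_modMonomial_single F n
      have hHF : HF (n + 1) N H := by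
        intro m hm
        rw [hH, coeff_divMonomial] at hm
        obtain ⟨h1, h2⟩ := hF _ hm
        rw [map_add, Finsupp.degree_single] at h1
        refine ⟨by omega, fun i hi => ?_⟩
        have := h2 i hi
        rw [Finsupp.add_apply] at this
        omega
      have hGF : HF n (N + 1) G := by
        intro m hm
        by_cases hle : Finsupp.single n 1 ≤ m
        · exact absurd (coeff_modMonomial_of_le _ hle) hm
        · rw [hG, coeff_modMonomial_of_not_le _ hle] at hm
          obtain ⟨h1, h2⟩ := hF _ hm
          refine ⟨h1, fun i hi => ?_⟩
          rw [Finsupp.single_le_iff] at hle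
          rcases hi.eq_or_lt with rfl | hi
          · omega
          · exact h2 i hi
      have h1 : y n * eval y H ∈ I ⊔ (Yy y n) ^ (N + 1) := by
        have h2 := hGF.eval_mem' (y := y)
        have h3 : y n * eval y H = eval y F - eval y G := by
          rw [← hFGH, map_add, map_mul, eval_X]; ring
        rw [h3]
        exact Ideal.sub_mem _ (Ideal.mem_sup_left hev) (Ideal.mem_sup_right h2)
      have h2 := hR _ _ h1
      have h2' : I ⊔ Yy y n ^ (N + 1) ≤ I ⊔ Yy y (n + 1) ^ (N + 1) := 
        sup_le_sup_left (Ideal.pow_right_mono (Yy_mono y (Nat.le_succ n)) _) _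
      have h3 := quasi_aux I y (n + 1) N ihN H hHF (h2' h2)
      obtain ⟨a, ha, b, hb, hab⟩ := Submodule.mem_sup.mp h2
      obtain ⟨h, hh, rfl⟩ := HF_exists y n (N + 1) b hb
      have h4 := ih (by omega) (N + 1) (G + MvPolynomial.C (y n) * h) (hGF.add (hh.C_mul _)) (by
        have h5 : eval y (G + MvPolynomial.C (y n) * h) = eval y F - y n * a := by
          rw [← hFGH, map_add, map_mul, map_add, map_mul, eval_X, eval_C, ← hab]; ring
        rw [h5]
        exact Ideal.sub_mem _ hev (Ideal.mul_mem_left _ _ ha))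
      intro m
      classical
      rw [← hFGH, coeff_add]
      refine Ideal.add_mem _ ?_ ?_
      · rw [coeff_X_mul']
        split_ifs
        · exact h3 _
        · exact Ideal.zero_mem _
      · have h5 := h4 m
        rw [coeff_add, coeff_C_mul] at h5
        have h6 : y n * coeff m h ∈ Jy I y (n + 1) := Ideal.mul_mem_right _ _ (Ideal.mem_sup_right (mem_Yy y (Nat.lt_succ_self n)))
        have := Ideal.sub_mem _ (Jy_mono I y (Nat.le_succ n) h5) h6
        convert this using 1
        ring

/-- second form of quasi-regularity -/
theorem quasi_reg' (I : Ideal S) (y : ℕ → S) (d : ℕ) (hreg : RegY I y d) (N : ℕ)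
    (F : MvPolynomial ℕ S) (hF : HF d N F) (hev : eval y F ∈ I ⊔ (Yy y d) ^ (N + 1)) (m) : coeff m F ∈ Jy I y d :=
  quasi_aux I y d N (quasi_reg I y d hreg d le_rfl N) F hF hev m

end Quasi
end QC

namespace QC

/-- the output of the selection process -/
structure Sel {K : Type} [Field K] {r : ℕ} (I : Ideal (PS K r)) (d : ℕ) {k : Type} [Field k] [Algebra K k] 
    (φ : PS K r →ₐ[K] PowerSeries k) (y0 : PS K r) (y : ℕ → PS K r) (u : ℕ → k) : Prop where
  d0 : 0 < d
  y0h : y0.IsHomogeneous 1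
  yh : ∀ i < d, (y i).IsHomogeneous 1
  reg : RegY I y d
  kI : ∀ p ∈ I, φ p = 0
  inj : ∀ n p, p.IsHomogeneous n → φ p = 0 → p ∈ I
  y0φ : φ y0 = 1
  yφ : ∀ i < d, φ (y i) = PowerSeries.C (u i) * PowerSeries.X
  u0 : u 0 = 1
  den : ∀ s : Finset k, ∃ N, ∃ D : k, D ≠ 0 ∧ ∀ a ∈ s, ∃ F : MvPolynomial ℕ K, HF d N F ∧ aeval u F = D * a
  art : ∃ N, ∀ p, p.IsHomogeneous N → p ∈ Jy I y d ⊔ Ideal.span {y0}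

section Star
variable {K : Type} [Field K] {r : ℕ} {I : Ideal (PS K r)} {d : ℕ} {k : Type} [Field k] [Algebra K k] 
    {φ : PS K r →ₐ[K] PowerSeries k} {y0 : PS K r} {y : ℕ → PS K r} {u : ℕ → k}

lemma HF.aeval_homog (yh : ∀ i < d, (y i).IsHomogeneous 1) {N : ℕ} {F : MvPolynomial ℕ K} (hF : HF d N F) : 
    (aeval y F).IsHomogeneous N := by
  rw [aeval_def, eval₂_eq]
  refine IsHomogeneous.sum _ _ _ fun m hm => ?_
  obtain ⟨h1, h2⟩ := hF m (mem_support_iff.mp hm)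
  rw [← zero_add N, ← h1, Finsupp.degree_apply]
  refine (isHomogeneous_C _ _).mul (IsHomogeneous.prod _ _ _ fun i hi => ?_)
  have := (yh i (by
    by_contra h
    exact (Finsupp.mem_support_iff.mp hi) (h2 i (not_lt.mp h)))).pow (m i)
  rwa [one_mul] at this

lemma Sel.φ_aeval (H : Sel I d φ y0 y u) {N : ℕ} {F : MvPolynomial ℕ K} (hF : HF d N F) : 
    φ (aeval y F) = PowerSeries.C (aeval u F) * PowerSeries.X ^ N := by
  rw [aeval_def, eval₂_eq, aeval_def, eval₂_eq, map_sum, map_sum, Finset.sum_mul]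
  refine Finset.sum_congr rfl fun m hm => ?_
  obtain ⟨h1, h2⟩ := hF m (mem_support_iff.mp hm)
  rw [map_mul, map_mul, map_prod, map_prod, AlgHom.commutes, mul_assoc]
  refine congrArg₂ _ (PowerSeries.algebraMap_apply) ?_
  rw [← h1, Finsupp.degree_apply, ← Finset.prod_pow_eq_pow_sum, ← Finset.prod_mul_distrib]
  refine Finset.prod_congr rfl fun i hi => ?_
  have hid : i < d := by
    by_contra h
    exact (Finsupp.mem_support_iff.mp hi) (h2 i (not_lt.mp h))
  rw [map_pow, H.yφ i hid, mul_pow, map_pow]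

/-- the span of the image of the degree `n` part -/
def Wn (φ : PS K r →ₐ[K] PowerSeries k) (n : ℕ) : Submodule k (PowerSeries k) := 
  Submodule.span k (φ '' {p | p.IsHomogeneous n})

theorem Sel.star (H : Sel I d φ y0 y u) {ι : Type} [Fintype ι] (n : ℕ) (f : ι → PS K r) 
    (hf : ∀ i, (f i).IsHomogeneous (n + 1)) 
    (hind : ∀ c : ι → K, ∑ i, MvPolynomial.C (c i) * f i ∈ Jy I y d → ∀ i, c i = 0) (a : ι → k) (w : PowerSeries k) 
    (hw : w ∈ Wn φ n) (haw : ∑ i, a i • φ (f i) = PowerSeries.X * w) : ∀ i, a i = 0 := by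
  classical
  obtain ⟨M, b, g, rfl⟩ := Submodule.mem_span_set'.mp hw
  choose g' hg' hgg using fun j => (g j).2
  obtain ⟨N, D, hD, hden⟩ := H.den (Finset.univ.image a ∪ Finset.univ.image b)
  choose F hF hFu using fun i => hden (a i) (Finset.mem_union_left _ (Finset.mem_image_of_mem a (Finset.mem_univ i)))
  choose G hG hGu using fun j => hden (b j) (Finset.mem_union_right _ (Finset.mem_image_of_mem b (Finset.mem_univ j)))
  let P : MvPolynomial ℕ (PS K r) := ∑ i, MvPolynomial.C (f i) * MvPolynomial.map MvPolynomial.C (F i)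
  have hP : ∀ m, coeff m P = ∑ i, MvPolynomial.C (coeff m (F i)) * f i := by
    intro m
    rw [coeff_sum]
    refine Finset.sum_congr rfl fun i _ => ?_
    rw [coeff_C_mul, coeff_map, mul_comm]
  have hPF : HF d N P := by
    intro m hm
    rw [hP] at hm
    obtain ⟨i, _, hi⟩ := Finset.exists_ne_zero_of_sum_ne_zero hm
    refine hF i m fun h => hi ?_
    rw [h, map_zero, zero_mul]
  have hPe : eval y P = ∑ i, f i * aeval y (F i) := by
    rw [map_sum]
    refine Finset.sum_congr rfl fun i _ => ?_
    rw [map_mul, eval_C, eval_map]; rfl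
  have hmem : eval y P - y 0 * ∑ j, aeval y (G j) * g' j ∈ I := by
    refine H.inj (N + (n + 1)) _ ?_ ?_
    · refine IsHomogeneous.sub ?_ ?_
      · rw [hPe]
        refine IsHomogeneous.sum _ _ _ fun i _ => ?_
        rw [mul_comm]
        exact (HF.aeval_homog H.yh (hF i)).mul (hf i)
      · rw [show N + (n + 1) = 1 + (N + n) by ring]
        refine (H.yh 0 H.d0).mul (IsHomogeneous.sum _ _ _ fun j _ => ?_)
        exact (HF.aeval_homog H.yh (hG j)).mul (hg' j)
    · rw [map_sub, map_mul, H.yφ 0 H.d0, H.u0, map_one, one_mul, hPe, map_sum, map_sum]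
      have h1 : ∑ i, φ (f i * aeval y (F i)) = PowerSeries.C D * PowerSeries.X ^ N * ∑ i, a i • φ (f i) := by
        rw [Finset.mul_sum]
        refine Finset.sum_congr rfl fun i _ => ?_
        rw [map_mul, H.φ_aeval (hF i), hFu, map_mul, PowerSeries.smul_eq_C_mul]; ring
      have h2 : ∑ j, φ (aeval y (G j) * g' j) = PowerSeries.C D * PowerSeries.X ^ N * ∑ i, b i • (g i : PowerSeries k) := by
        rw [Finset.mul_sum]
        refine Finset.sum_congr rfl fun i _ => ?_
        rw [map_mul, H.φ_aeval (hG i), hGu, map_mul, PowerSeries.smul_eq_C_mul, hgg]; ring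
      rw [h1, h2, haw]
      ring
  have hmem2 : eval y P ∈ I ⊔ (Yy y d) ^ (N + 1) := by
    have h1 : y 0 * ∑ j, aeval y (G j) * g' j ∈ (Yy y d) ^ (N + 1) := by
      rw [pow_succ']
      refine Ideal.mul_mem_mul (mem_Yy y H.d0) (Ideal.sum_mem _ fun j _ => Ideal.mul_mem_right _ _ ?_)
      have h2 : HF d N (MvPolynomial.map (MvPolynomial.C : K →+* PS K r) (G j)) := by
        intro m hm
        refine hG j m fun h => hm ?_
        rw [coeff_map, h, map_zero]
      have h3 := h2.eval_mem' (y := y)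
      rw [eval_map] at h3
      exact h3
    have := Ideal.add_mem _ (Ideal.mem_sup_left hmem) (Ideal.mem_sup_right h1)
    rwa [sub_add_cancel] at this
  have hco := quasi_reg' I y d H.reg N P hPF hmem2
  intro i
  have hFi : F i = 0 := by
    ext m
    have := hco m
    rw [hP] at this
    rw [coeff_zero]
    exact hind _ this i
  have := hFu i
  rw [hFi, map_zero] at this
  rcases mul_eq_zero.mp this.symm with h | h
  · exact absurd h hD
  · exact h

end Star
end QC

namespace QC

section Graded
variable {K : Type} [Field K] {r : ℕ} {I : Ideal (PS K r)} {d : ℕ} {y0 : PS K r} {y : ℕ → PS K r}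

lemma hc_mul {p q : PS K r} (hp : p.IsHomogeneous 1) (n : ℕ) : 
    homogeneousComponent (n + 1) (p * q) = p * homogeneousComponent n q := by
  conv_lhs => rw [← sum_homogeneousComponent q]
  rw [Finset.mul_sum, map_sum]
  have h : ∀ i, homogeneousComponent (n + 1) (p * homogeneousComponent i q) = 
      if n = i then p * homogeneousComponent i q else 0 := by
    intro i
    have h1 : (p * homogeneousComponent i q).IsHomogeneous (1 + i) := hp.mul (homogeneousComponent_isHomogeneous i q)
    rw [homogeneousComponent_of_mem (n := 1 + i) h1]
    congr 1
    simp only [eq_iff_iff]; omega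
  rw [Finset.sum_congr rfl fun i _ => h i, Finset.sum_ite_eq]
  split_ifs with h2
  · rfl
  · rw [homogeneousComponent_eq_zero n q (by simpa using h2), mul_zero]

lemma hc_mul_zero {p q : PS K r} (hp : p.IsHomogeneous 1) : homogeneousComponent 0 (p * q) = 0 := by
  have : coeff 0 p = 0 := hp.coeff_eq_zero (by simp)
  rw [homogeneousComponent_zero]
  have h2 : coeff 0 (p * q) = coeff 0 p * coeff 0 q := by
    simp only [← constantCoeff_eq, map_mul]
  rw [h2, this, zero_mul, map_zero]

/-- homogeneous ideals -/
def HI (J : Ideal (PS K r)) : Prop := ∀ p ∈ J, ∀ n, homogeneousComponent n p ∈ J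

lemma HI.sup_span {J : Ideal (PS K r)} (hJ : HI J) {z : PS K r} (hz : z.IsHomogeneous 1) : HI (J ⊔ Ideal.span {z}) := by
  intro p hp n
  obtain ⟨a, ha, b, hb, rfl⟩ := Submodule.mem_sup.mp hp
  obtain ⟨q, rfl⟩ := Ideal.mem_span_singleton'.mp hb
  rw [map_add]
  refine Ideal.add_mem _ (Ideal.mem_sup_left (hJ a ha n)) ?_
  rw [mul_comm]
  cases n with
  | zero => rw [hc_mul_zero hz]; exact Ideal.zero_mem _
  | succ n => rw [hc_mul hz]; exact Ideal.mem_sup_right (Ideal.mul_mem_right _ _ (Ideal.mem_span_singleton_self z))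

lemma HI.decomp {J : Ideal (PS K r)} (hJ : HI J) {z : PS K r} (hz : z.IsHomogeneous 1) {n : ℕ} {p : PS K r} 
    (hp : p.IsHomogeneous (n + 1)) (hpJ : p ∈ J ⊔ Ideal.span {z}) : 
    ∃ a ∈ J, a.IsHomogeneous (n + 1) ∧ ∃ q : PS K r, q.IsHomogeneous n ∧ p = a + z * q := by
  obtain ⟨a, ha, b, hb, rfl⟩ := Submodule.mem_sup.mp hpJ
  obtain ⟨q, rfl⟩ := Ideal.mem_span_singleton'.mp hb
  refine ⟨_, hJ a ha (n + 1), homogeneousComponent_isHomogeneous _ _, _, homogeneousComponent_isHomogeneous n q, ?_⟩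
  conv_lhs => rw [← homogeneousComponent_eq_self hp, map_add, mul_comm, hc_mul hz]

lemma HI.Jy (hI : HI I) (yh : ∀ i < d, (y i).IsHomogeneous 1) : ∀ j ≤ d, HI (Jy I y j) := by
  intro j
  induction j with
  | zero => intro _; rw [Jy_zero]; exact hI
  | succ j ih => intro hj; rw [Jy_succ]; exact (ih (by omega)).sup_span (yh j (by omega))

lemma Jy_hc0 (hI0 : ∀ p ∈ I, homogeneousComponent 0 p = 0) (yh : ∀ i < d, (y i).IsHomogeneous 1) : 
    ∀ j ≤ d, ∀ p ∈ Jy I y j, homogeneousComponent 0 p = 0 := by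
  intro j
  induction j with
  | zero => intro _; rw [Jy_zero]; exact hI0
  | succ j ih => 
    intro hj p hp; rw [Jy_succ] at hp
    obtain ⟨a, ha, b, hb, rfl⟩ := Submodule.mem_sup.mp hp
    obtain ⟨q, rfl⟩ := Ideal.mem_span_singleton'.mp hb
    rw [map_add, ih (by omega) a ha, mul_comm, hc_mul_zero (yh j (by omega)), add_zero]

/-- the Hilbert function of `S/J` -/
def hq (J : Ideal (PS K r)) (n : ℕ) : ℤ := 
  (Module.finrank K ((GrS K r).H n) : ℤ) - Module.finrank K ((GrS K r).part J n)

lemma H_fd (n : ℕ) : FiniteDimensional K ((GrS K r).H n) := (GrS K r).fd n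

lemma mem_part {J : Ideal (PS K r)} {n : ℕ} {p : PS K r} : p ∈ (GrS K r).part J n ↔ p ∈ J ∧ p.IsHomogeneous n := by
  rw [Gr.part, Submodule.mem_inf, GrS_mem]; rfl

lemma hq_succ {J : Ideal (PS K r)} (hJ : HI J) {z : PS K r} (hz : z.IsHomogeneous 1) (hz0 : z ≠ 0) 
    (hreg : ∀ f, z * f ∈ J → f ∈ J) (n : ℕ) : hq (J ⊔ Ideal.span {z}) (n + 1) = hq J (n + 1) - hq J n := by
  have fd1 := (GrS K r).part_fd J (n + 1)
  have fd2 := H_fd (K := K) (r := r) n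
  let L : PS K r →ₗ[K] PS K r := LinearMap.mulLeft K z
  have hL : Function.Injective L := mul_right_injective₀ hz0
  have h1 : (GrS K r).part (J ⊔ Ideal.span {z}) (n + 1) = (GrS K r).part J (n + 1) ⊔ ((GrS K r).H n).map L := by
    apply le_antisymm
    · intro p hp
      rw [mem_part] at hp
      obtain ⟨a, ha, hah, q, hq, rfl⟩ := hJ.decomp hz hp.2 hp.1
      exact Submodule.add_mem_sup (mem_part.mpr ⟨ha, hah⟩) ⟨q, GrS_mem.mpr hq, rfl⟩
    · refine sup_le ?_ ?_
      · intro p hp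
        rw [mem_part] at hp ⊢
        exact ⟨Ideal.mem_sup_left hp.1, hp.2⟩
      · rintro _ ⟨q, hq, rfl⟩
        rw [mem_part]
        refine ⟨Ideal.mem_sup_right (Ideal.mul_mem_right _ _ (Ideal.mem_span_singleton_self z)), ?_⟩
        rw [add_comm n 1]
        exact hz.mul (GrS_mem.mp hq)
  have h2 : (GrS K r).part J (n + 1) ⊓ ((GrS K r).H n).map L = ((GrS K r).part J n).map L := by
    apply le_antisymm
    · rintro _ ⟨hp, q, hq, rfl⟩
      exact ⟨q, mem_part.mpr ⟨hreg q (mem_part.mp hp).1, GrS_mem.mp hq⟩, rfl⟩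
    · rintro _ ⟨q, hq, rfl⟩
      have hq := mem_part.mp hq
      refine ⟨mem_part.mpr ⟨Ideal.mul_mem_left _ _ hq.1, ?_⟩, q, GrS_mem.mpr hq.2, rfl⟩
      rw [add_comm n 1]
      exact hz.mul hq.2
  have h3 := Submodule.finrank_sup_add_finrank_inf_eq ((GrS K r).part J (n + 1)) (((GrS K r).H n).map L)
  rw [← h1, h2, finrank_map_inj L hL, finrank_map_inj L hL] at h3
  rw [hq, hq, hq]
  omega

lemma hq_zero {J : Ideal (PS K r)} (hJ0 : ∀ p ∈ J, homogeneousComponent 0 p = 0) : hq J 0 = 1 := by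
  have h1 : (GrS K r).part J 0 = ⊥ := by
    rw [eq_bot_iff]
    intro p hp
    rw [mem_part] at hp
    rw [Submodule.mem_bot, ← homogeneousComponent_eq_self hp.2]
    exact hJ0 p hp.1
  have h2 : (GrS K r).H 0 = Submodule.span K {1} := by
    ext p
    rw [GrS_mem, Submodule.mem_span_singleton]
    constructor
    · intro h
      refine ⟨coeff 0 p, ?_⟩
      have := homogeneousComponent_eq_self h
      rw [homogeneousComponent_zero] at this
      rw [smul_eq_C_mul, mul_one, this]
    · rintro ⟨a, rfl⟩
      rw [smul_eq_C_mul, mul_one]; exact isHomogeneous_C _ _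
  rw [hq, h1, h2, finrank_span_singleton one_ne_zero]
  simp

lemma regY_ne_zero (hI0 : ∀ p ∈ I, homogeneousComponent 0 p = 0) (yh : ∀ i < d, (y i).IsHomogeneous 1) 
    (hreg : RegY I y d) : ∀ j < d, y j ≠ 0 := by
  intro j hj h0
  have h1 := hreg j hj 1 (by rw [h0, zero_mul]; exact Ideal.zero_mem _)
  have h2 := Jy_hc0 hI0 yh j (by omega) 1 h1
  rw [homogeneousComponent_zero] at h2
  simp at h2

lemma hq_Jy_succ (hI : HI I) (hI0 : ∀ p ∈ I, homogeneousComponent 0 p = 0) (yh : ∀ i < d, (y i).IsHomogeneous 1) 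
    (hreg : RegY I y d) (j : ℕ) (hj : j < d) (n : ℕ) : hq (Jy I y (j + 1)) (n + 1) = hq (Jy I y j) (n + 1) - hq (Jy I y j) n := by
  rw [Jy_succ]
  exact hq_succ (hI.Jy yh j (by omega)) (yh j hj) (regY_ne_zero hI0 yh hreg j hj) (hreg j hj) n

lemma hq_one (hI1 : ∀ p ∈ I, p.IsHomogeneous 1 → p = 0) (hI : HI I) (hI0 : ∀ p ∈ I, homogeneousComponent 0 p = 0) (yh : ∀ i < d, (y i).IsHomogeneous 1) 
    (hreg : RegY I y d) : ∀ j ≤ d, hq (Jy I y j) 1 = r + 1 - j := by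
  intro j
  induction j with
  | zero =>
    intro _
    rw [Jy_zero]
    have h1 : (GrS K r).part I 1 = ⊥ := by
      rw [eq_bot_iff]
      intro p hp
      rw [mem_part] at hp
      exact hI1 p hp.1 hp.2
    have h2 : (GrS K r).H 1 = Submodule.span K (Set.range (X : Fin (r + 1) → PS K r)) := by
      rw [← homogeneousSubmodule_one_eq_span_X]
      ext p; exact GrS_mem
    rw [hq, h1, h2, finrank_span_eq_card (linearIndependent_X (Fin (r + 1)) K)]
    simp
  | succ j ih =>
    intro hj
    rw [hq_Jy_succ hI hI0 yh hreg j (by omega), ih (by omega), hq_zero (Jy_hc0 hI0 yh j (by omega))]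
    push_cast; ring

lemma hq_two (hI1 : ∀ p ∈ I, p.IsHomogeneous 1 → p = 0) (hI : HI I) (hI0 : ∀ p ∈ I, homogeneousComponent 0 p = 0) (yh : ∀ i < d, (y i).IsHomogeneous 1) 
    (hreg : RegY I y d) : ∀ j ≤ d, 2 * hq (Jy I y j) 2 = 2 * hq I 2 - j * (2 * r + 3 - j) := by
  intro j
  induction j with
  | zero =>
    intro _
    rw [Jy_zero]
    simp
  | succ j ih =>
    intro hj
    rw [hq_Jy_succ hI hI0 yh hreg j (by omega), mul_sub, ih (by omega), hq_one hI1 hI hI0 yh hreg j (by omega)]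
    push_cast; ring

/-- dimension of the space of quadrics -/
lemma finrank_H2 : Module.finrank K ((GrS K r).H 2) = (r + 2).choose 2 := by
  have h1 : (GrS K r).H 2 = homogeneousSubmodule (Fin (r + 1)) K 2 := by
    ext p; exact GrS_mem
  have h2 : {m : Fin (r + 1) →₀ ℕ | m.degree = 2} = 
      (((Finset.univ : Finset (Fin (r + 1))).finsuppAntidiag 2 : Finset (Fin (r + 1) →₀ ℕ)) : Set (Fin (r + 1) →₀ ℕ)) := by
    ext m
    rw [Set.mem_ofPred_eq, Finset.mem_coe, Finset.mem_finsuppAntidiag, Finsupp.degree_eq_sum]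
    simp
  rw [h1, homogeneousSubmodule_eq_finsupp_supported, h2, 
    (AddMonoidAlgebra.supportedEquivFinsupp (R := K) (S := K) _).finrank_eq, Module.finrank_finsupp_self]
  simp only [Finset.coe_sort_coe, Fintype.card_coe]
  rw [Finset.card_finsuppAntidiag_nat_eq_choose]
  simp

lemma hilb_coeff (n : ℕ) : (Module.finrank K (AMD.quotComponent K r I n) : ℤ) = hq I n := by
  have fd2 := H_fd (K := K) (r := r) n
  have h1 : AMD.quotComponent K r I n = ((GrS K r).H n).map (Ideal.Quotient.mkₐ K I).toLinearMap := by
    rw [AMD.quotComponent]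
    congr 1
    ext p; exact GrS_mem.symm
  have h2 := LinearMap.finrank_range_add_finrank_ker ((Ideal.Quotient.mkₐ K I).toLinearMap.domRestrict ((GrS K r).H n))
  rw [LinearMap.range_domRestrict, ← h1, LinearMap.ker_domRestrict] at h2
  have h3 : Module.finrank K (Submodule.comap ((GrS K r).H n).subtype (LinearMap.ker (Ideal.Quotient.mkₐ K I).toLinearMap)) = 
      Module.finrank K ((GrS K r).part I n) := by
    have h4 : (GrS K r).part I n = (GrS K r).H n ⊓ LinearMap.ker (Ideal.Quotient.mkₐ K I).toLinearMap := by
      ext p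
      rw [mem_part, Submodule.mem_inf, GrS_mem, LinearMap.mem_ker]
      have : (Ideal.Quotient.mkₐ K I).toLinearMap p = 0 ↔ p ∈ I := Ideal.Quotient.eq_zero_iff_mem
      rw [this, and_comm]
    rw [h4, ← finrank_map_inj _ (Submodule.subtype_injective ((GrS K r).H n)), Submodule.map_comap_subtype]
  rw [hq]; omega

lemma hq_eventually (hI : HI I) (hI0 : ∀ p ∈ I, homogeneousComponent 0 p = 0) (yh : ∀ i < d, (y i).IsHomogeneous 1) 
    (hreg : RegY I y d) (e : ℕ) (hdeg : AMD.DegreeEq K r I d e) : ∃ n0, ∀ n, n0 ≤ n → hq (Jy I y d) n = e := by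
  obtain ⟨h, h1, h2⟩ := hdeg
  have hQ : ∀ j ≤ d, PowerSeries.mk (hq (Jy I y j)) = AMD.hilbSeries K r I * (1 - PowerSeries.X) ^ j := by
    intro j
    induction j with
    | zero =>
      intro _
      rw [pow_zero, mul_one, Jy_zero, AMD.hilbSeries]
      congr 1
      ext n
      exact (hilb_coeff n).symm
    | succ j ih =>
      intro hj
      rw [pow_succ, ← mul_assoc, ← ih (by omega)]
      ext n
      cases n with
      | zero => 
        rw [mul_sub, mul_one, map_sub, PowerSeries.coeff_zero_mul_X, PowerSeries.coeff_mk, PowerSeries.coeff_mk, 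
          hq_zero (Jy_hc0 hI0 yh j (by omega)), hq_zero (Jy_hc0 hI0 yh (j + 1) (by omega)), sub_zero]
      | succ n =>
        rw [mul_sub, mul_one, map_sub, PowerSeries.coeff_succ_mul_X, PowerSeries.coeff_mk, PowerSeries.coeff_mk, 
          PowerSeries.coeff_mk, hq_Jy_succ hI hI0 yh hreg j (by omega)]
  have h3 : PowerSeries.mk (hq (Jy I y d)) * (1 - PowerSeries.X) = PowerSeries.mk fun n => h.coeff n := by
    rw [hQ d le_rfl, mul_assoc, ← pow_succ, h1]
  have h4 : ∀ n, hq (Jy I y d) n = ∑ i ∈ Finset.range (n + 1), h.coeff i := by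
    intro n
    induction n with
    | zero =>
      have := congrArg (PowerSeries.coeff 0) h3
      rw [mul_sub, mul_one, map_sub, PowerSeries.coeff_zero_mul_X, PowerSeries.coeff_mk, PowerSeries.coeff_mk, sub_zero] at this
      simp [this]
    | succ n ih =>
      have := congrArg (PowerSeries.coeff (n + 1)) h3
      rw [mul_sub, mul_one, map_sub, PowerSeries.coeff_succ_mul_X, PowerSeries.coeff_mk, PowerSeries.coeff_mk, 
          PowerSeries.coeff_mk] at this
      rw [Finset.sum_range_succ, ← ih, ← this]; ring
  refine ⟨h.natDegree, fun n hn => ?_⟩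
  rw [h4, ← h2, Polynomial.eval_eq_sum_range' (n := n + 1) (by omega)]
  simp

end Graded
end QC

namespace QC

section Curve
variable {K : Type} [Field K] {r : ℕ} {I : Ideal (PS K r)} {d : ℕ} {k : Type} [Field k] [Algebra K k] 
    {φ : PS K r →ₐ[K] PowerSeries k} {y0 : PS K r} {y : ℕ → PS K r} {u : ℕ → k}

lemma φ_mem_Wn {n : ℕ} {p : PS K r} (hp : p.IsHomogeneous n) : φ p ∈ Wn φ n := Submodule.subset_span ⟨p, hp, rfl⟩

lemma Wn_zero : Wn φ 0 = 1 := by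
  rw [Submodule.one_eq_span]
  apply le_antisymm
  · rw [Wn, Submodule.span_le]
    rintro _ ⟨p, hp, rfl⟩
    have hp : p.IsHomogeneous 0 := hp
    have := homogeneousComponent_eq_self hp
    rw [homogeneousComponent_zero] at this
    rw [← this]
    have h2 : φ (MvPolynomial.C (coeff 0 p)) = (algebraMap K k (coeff 0 p)) • (1 : PowerSeries k) := by
      rw [← MvPolynomial.algebraMap_eq, AlgHom.commutes, Algebra.algebraMap_eq_smul_one, algebraMap_smul]
    rw [h2]
    exact Submodule.smul_mem _ _ (Submodule.mem_span_singleton_self _)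
  · rw [Submodule.span_le, Set.singleton_subset_iff, ← map_one φ]
    exact φ_mem_Wn (isHomogeneous_one _ _)

lemma Wn_succ (n : ℕ) : Wn φ (n + 1) = Wn φ 1 * Wn φ n := by
  apply le_antisymm
  · rw [Wn, Submodule.span_le]
    rintro _ ⟨p, hp, rfl⟩
    have h1 := homog_succ_mem n p hp
    clear hp
    induction h1 using Submodule.span_induction with
    | mem x hx =>
      obtain ⟨i, q, hq, rfl⟩ := hx
      rw [map_mul]
      exact Submodule.mul_mem_mul (φ_mem_Wn (isHomogeneous_X _ _)) (φ_mem_Wn hq)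
    | zero => rw [map_zero]; exact Submodule.zero_mem _
    | add x y _ _ h1 h2 => 
      rw [map_add]; exact Submodule.add_mem _ (h1) (h2)
    | smul a x _ h => 
      rw [map_smul]; exact Submodule.smul_of_tower_mem _ a (h)
  · conv_lhs => rw [Wn, Wn, Submodule.span_mul_span]
    rw [Submodule.span_le]
    rintro _ ⟨_, ⟨p, hp, rfl⟩, _, ⟨q, hq, rfl⟩, rfl⟩
    show φ p * φ q ∈ _
    rw [← map_mul, add_comm n 1]
    exact φ_mem_Wn (hp.mul hq)

lemma Wn_pow (n : ℕ) : Wn φ n = (Wn φ 1) ^ n := by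
  induction n with
  | zero => rw [pow_zero, Wn_zero]
  | succ n ih => rw [Wn_succ, ih, pow_succ']

lemma Wn_fd (n : ℕ) : FiniteDimensional k (Wn φ n) := by
  have h1 := H_fd (K := K) (r := r) n
  obtain ⟨s, hs⟩ := (Submodule.fg_iff_finiteDimensional ((GrS K r).H n)).mpr h1
  have h2 : Wn φ n = Submodule.span k (φ '' (s : Set (PS K r))) := by
    apply le_antisymm
    · rw [Wn, Submodule.span_le]
      rintro _ ⟨p, hp, rfl⟩
      have h3 : p ∈ Submodule.span K (s : Set (PS K r)) := by rw [hs, GrS_mem]; exact hp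
      clear hp
      induction h3 using Submodule.span_induction with
      | mem x hx => exact Submodule.subset_span ⟨x, hx, rfl⟩
      | zero => rw [map_zero]; exact Submodule.zero_mem _
      | add x y _ _ h1 h2 => 
        rw [map_add]; exact Submodule.add_mem _ (h1) (h2)
      | smul a x _ h => 
        rw [map_smul]; exact Submodule.smul_of_tower_mem _ a (h)
    · apply Submodule.span_mono
      rintro _ ⟨p, hp, rfl⟩
      refine ⟨p, ?_, rfl⟩
      exact GrS_mem.mp (hs ▸ Submodule.subset_span hp)
  rw [h2]
  exact FiniteDimensional.span_of_finite k (s.finite_toSet.image _)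

lemma Sel.J_map (H : Sel I d φ y0 y u) (hI : HI I) : ∀ j ≤ d, ∀ n, ∀ p ∈ Jy I y j, p.IsHomogeneous (n + 1) → 
    φ p ∈ (Wn φ n).map (lm PowerSeries.X) := by
  intro j
  induction j with
  | zero => 
    intro _ n p hp _
    rw [Jy_zero] at hp
    rw [H.kI p hp]; exact Submodule.zero_mem _
  | succ j ih =>
    intro hj n p hp hph
    rw [Jy_succ] at hp
    obtain ⟨a, ha, hah, q, hq, rfl⟩ := (hI.Jy H.yh j (by omega)).decomp (H.yh j (by omega)) hph hp
    rw [map_add]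
    refine Submodule.add_mem _ (ih (by omega) n a ha hah) ⟨u j • φ q, Submodule.smul_mem _ _ (φ_mem_Wn hq), ?_⟩
    rw [lm_apply, map_mul, H.yφ j (by omega), PowerSeries.smul_eq_C_mul]; ring

lemma exists_functional {k W ι : Type} [Field k] [AddCommGroup W] [Module k W] [Fintype ι] (M : Submodule k W) 
    {Z : Type} [AddCommGroup Z] [Module k Z] (f : ι → W) (hf : ∀ a : ι → k, ∑ i, a i • f i ∈ M → ∀ i, a i = 0) (F : ι → Z) : 
    ∃ g : W →ₗ[k] Z, (∀ i, g (f i) = F i) ∧ ∀ x ∈ M, g x = 0 := by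
  have h1 : LinearIndependent k (fun i => M.mkQ (f i)) := by
    rw [Fintype.linearIndependent_iff]
    intro a ha
    refine hf a ?_
    rw [← Submodule.ker_mkQ M, LinearMap.mem_ker, map_sum, ← ha]
    simp only [map_smul]
  obtain ⟨g, hg⟩ := LinearMap.exists_extend ((Module.Basis.span h1).constr k F)
  refine ⟨g ∘ₗ M.mkQ, fun i => ?_, fun x hx => ?_⟩
  · have h2 := LinearMap.congr_fun hg (Module.Basis.span h1 i)
    rw [Module.Basis.constr_basis] at h2
    rw [LinearMap.comp_apply, Submodule.subtype_apply, Module.Basis.span_apply] at h2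
    exact h2
  · rw [LinearMap.comp_apply, Submodule.mkQ_apply, (Submodule.Quotient.mk_eq_zero M).mpr hx, map_zero]

/-- a basis of a complement of `J` in degree `n + 1` -/
lemma Sel.basis (H : Sel I d φ y0 y u) (n : ℕ) : ∃ m : ℕ, (m : ℤ) = hq (Jy I y d) (n + 1) ∧ ∃ f : Fin m → PS K r, 
    (∀ i, (f i).IsHomogeneous (n + 1)) ∧ 
    (∀ a : Fin m → k, ∑ i, a i • φ (f i) ∈ (Wn φ n).map (lm PowerSeries.X) → ∀ i, a i = 0) ∧
    (∀ p : PS K r, p.IsHomogeneous (n + 1) → ∃ c : Fin m → K, p - ∑ i, c i • f i ∈ (GrS K r).part (Jy I y d) (n + 1)) := by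
  have fd1 := H_fd (K := K) (r := r) (n + 1)
  obtain ⟨C, hC1, hC2, hC3, hC4⟩ := exists_compl_fin ((GrS K r).part (Jy I y d) (n + 1)) ((GrS K r).H (n + 1)) inf_le_right
  have fd2 : FiniteDimensional K C := Submodule.finiteDimensional_of_le hC1
  let b := Module.finBasis K C
  refine ⟨Module.finrank K C, by rw [hq]; omega, fun i => (b i : PS K r), fun i => GrS_mem.mp (hC1 (b i).2), ?_, ?_⟩
  · rintro a ⟨w, hw, haw⟩
    refine H.star n (fun i => (b i : PS K r)) (fun i => GrS_mem.mp (hC1 (b i).2)) ?_ a w hw haw.symm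
    intro c hc
    have h1 : ∑ i, c i • (b i : PS K r) ∈ C := Submodule.sum_mem _ fun i _ => C.smul_mem _ (b i).2
    have h2 : ∑ i, c i • (b i : PS K r) ∈ (GrS K r).part (Jy I y d) (n + 1) := by
      rw [mem_part]
      refine ⟨?_, GrS_mem.mp (hC1 h1)⟩
      simpa only [smul_eq_C_mul] using hc
    have h3 : ∑ i, c i • (b i : PS K r) = 0 := by
      have : ∑ i, c i • (b i : PS K r) ∈ (⊥ : Submodule K (PS K r)) := by rw [← hC3]; exact ⟨h2, h1⟩
      exact this
    refine Fintype.linearIndependent_iff.mp b.linearIndependent c (Subtype.ext ?_)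
    rw [AddSubmonoidClass.coe_finsetSum]
    exact h3
  · intro p hp
    have h1 : p ∈ (GrS K r).part (Jy I y d) (n + 1) ⊔ C := by rw [hC2]; exact GrS_mem.mpr hp
    obtain ⟨a, ha, q, hq, rfl⟩ := Submodule.mem_sup.mp h1
    refine ⟨fun i => b.repr ⟨q, hq⟩ i, ?_⟩
    have h2 := b.sum_repr ⟨q, hq⟩
    have h3 := congrArg Subtype.val h2
    rw [AddSubmonoidClass.coe_finsetSum] at h3
    have h4 : ∑ i, b.repr ⟨q, hq⟩ i • (b i : PS K r) = q := h3
    rw [h4, add_sub_cancel_right]; exact ha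

lemma Sel.Wn_rank (H : Sel I d φ y0 y u) (hI : HI I) (n : ℕ) : 
    (Module.finrank k (Wn φ (n + 1)) : ℤ) = Module.finrank k (Wn φ n) + hq (Jy I y d) (n + 1) := by
  obtain ⟨m, hm, f, hf, hind, hsp⟩ := H.basis n
  have fd1 := Wn_fd (φ := φ) n
  have h1 : LinearIndependent k fun i => φ (f i) := by
    rw [Fintype.linearIndependent_iff]
    intro a ha
    refine hind a ?_
    rw [ha]; exact Submodule.zero_mem _
  let T := Submodule.span k (Set.range fun i => φ (f i))
  have fd2 : FiniteDimensional k T := FiniteDimensional.span_of_finite k (Set.finite_range _)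
  have hT : Module.finrank k T = m := by
    rw [finrank_span_eq_card h1]; simp
  have h2 : Wn φ (n + 1) = T ⊔ (Wn φ n).map (lm PowerSeries.X) := by
    apply le_antisymm
    · rw [Wn, Submodule.span_le]
      rintro _ ⟨p, hp, rfl⟩
      obtain ⟨c, hc⟩ := hsp p hp
      rw [mem_part] at hc
      have h3 := H.J_map hI d le_rfl n _ hc.1 hc.2
      have h4 : φ p = ∑ i, c i • φ (f i) + φ (p - ∑ i, c i • f i) := by
        rw [map_sub, map_sum]; simp only [map_smul, add_sub_cancel]
      rw [h4]
      exact Submodule.add_mem_sup (Submodule.sum_mem _ fun i _ => Submodule.smul_of_tower_mem _ _ (Submodule.subset_span ⟨i, rfl⟩)) h3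
    · refine sup_le ?_ ?_
      · rw [Submodule.span_le]
        rintro _ ⟨i, rfl⟩
        exact φ_mem_Wn (hf i)
      · rw [Wn_succ]
        rintro _ ⟨w, hw, rfl⟩
        rw [lm_apply]
        refine Submodule.mul_mem_mul ?_ hw
        have := φ_mem_Wn (φ := φ) (H.yh 0 H.d0)
        rwa [H.yφ 0 H.d0, H.u0, map_one, one_mul] at this
  have h3 : T ⊓ (Wn φ n).map (lm PowerSeries.X) = ⊥ := by
    rw [eq_bot_iff]
    rintro x ⟨hx1, hx2⟩
    obtain ⟨a, rfl⟩ := (Submodule.mem_span_range_iff_exists_fun k).mp hx1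
    have := hind a hx2
    simp [this]
  have h4 := Submodule.finrank_sup_add_finrank_inf_eq T ((Wn φ n).map (lm PowerSeries.X))
  rw [← h2, h3, finrank_bot, hT, finrank_map_inj _ (lm_inj X_ne)] at h4
  omega

lemma Sel.art' (H : Sel I d φ y0 y u) : ∃ N, ∀ n, N ≤ n → ∀ p, p.IsHomogeneous n → p ∈ Jy I y d ⊔ Ideal.span {y0} := by
  obtain ⟨N, hN⟩ := H.art
  refine ⟨N, fun n hn => ?_⟩
  induction n, hn using Nat.le_induction with
  | base => exact hN
  | succ n hn ih =>
    intro p hp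
    have h1 := homog_succ_mem n p hp
    clear hp
    induction h1 using Submodule.span_induction with
    | mem x hx =>
      obtain ⟨i, q, hq, rfl⟩ := hx
      exact Ideal.mul_mem_left _ _ (ih q hq)
    | zero => exact Submodule.zero_mem _
    | add x y _ _ h1 h2 => exact Submodule.add_mem _ h1 h2
    | smul a x _ h => rw [smul_eq_C_mul]; exact Ideal.mul_mem_left _ _ h

theorem Sel.toCH (H : Sel I d φ y0 y u) (hI : HI I) (hI0 : ∀ p ∈ I, homogeneousComponent 0 p = 0) 
    (hI1 : ∀ p ∈ I, p.IsHomogeneous 1 → p = 0) (c : ℕ) (hdc : d + c = r) (hc : 4 ≤ c) (hdeg : AMD.DegreeEq K r I d (c + 2)) 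
    (hz : ∃ f, f ∉ Jy I y d ∧ y0 * f ∈ Jy I y d) : CH (Wn φ 1) (c + 2) where
  h1 := by
    rw [← H.y0φ]; exact φ_mem_Wn H.y0h
  hX := by
    have := φ_mem_Wn (φ := φ) (H.yh 0 H.d0)
    rwa [H.yφ 0 H.d0, H.u0, map_one, one_mul] at this
  fd := Wn_fd 1
  hgen := by
    obtain ⟨N, hN⟩ := H.art'
    refine ⟨N, fun n hn => ?_⟩
    rw [← Wn_pow, ← Wn_pow]
    conv_lhs => rw [Wn]
    rw [Submodule.span_le]
    rintro _ ⟨p, hp, rfl⟩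
    obtain ⟨a, ha, hah, q, hq, rfl⟩ := (hI.Jy H.yh d le_rfl).decomp H.y0h hp (hN _ (by omega) p hp)
    rw [map_add, map_mul, H.y0φ, one_mul, add_comm]
    exact Submodule.add_mem_sup (φ_mem_Wn hq) (H.J_map hI d le_rfl n a ha hah)
  hdim := by
    obtain ⟨n0, hn0⟩ := hq_eventually hI hI0 H.yh H.reg _ hdeg
    refine ⟨n0, fun n hn => ?_⟩
    have := H.Wn_rank hI n
    rw [hn0 _ (by omega)] at this
    rw [← Wn_pow, ← Wn_pow]
    omega
  hm := by omega
  hV := by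
    have h1 := H.Wn_rank hI 0
    have h2 := hq_one hI1 hI hI0 H.yh H.reg d le_rfl
    rw [zero_add, h2, Wn_zero, Submodule.one_eq_span, finrank_span_singleton one_ne_zero] at h1
    omega
  hθ := by
    have hJ := hI.Jy H.yh d le_rfl
    obtain ⟨f, hf1, hf2⟩ := hz
    have h1 : ∃ n, homogeneousComponent n f ∉ Jy I y d := by
      by_contra! h
      refine hf1 ?_
      rw [← sum_homogeneousComponent f]
      exact Ideal.sum_mem _ fun i _ => h i
    obtain ⟨n, hn⟩ := h1
    have h2 : y0 * homogeneousComponent n f ∈ Jy I y d := by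
      rw [← hc_mul H.y0h]; exact hJ _ hf2 _
    have h3 := homogeneousComponent_isHomogeneous n f
    generalize homogeneousComponent n f = g at hn h2 h3
    have h4 : (y0 * g).IsHomogeneous (n + 1) := by rw [add_comm n 1]; exact H.y0h.mul h3
    obtain ⟨θ, hθ, hθ2⟩ := H.J_map hI d le_rfl n _ h2 h4
    rw [map_mul, H.y0φ, one_mul, lm_apply] at hθ2
    have hgind : ∀ c : Unit → K, ∑ i : Unit, MvPolynomial.C (c i) * (fun _ => g) i ∈ Jy I y d → ∀ i, c i = 0 := by
      intro c hc i
      rw [Fintype.sum_unique] at hc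
      by_contra h
      refine hn ?_
      have := Ideal.mul_mem_left _ (MvPolynomial.C (c i)⁻¹) hc
      rwa [← mul_assoc, ← MvPolynomial.C_mul, inv_mul_cancel₀ h, MvPolynomial.C_1, one_mul] at this
    cases n with
    | zero =>
      exfalso
      have h5 := homogeneousComponent_eq_self h3
      rw [homogeneousComponent_zero] at h5
      have h6 : coeff 0 g ≠ 0 := by
        intro h
        rw [h, map_zero] at h5
        exact hn (h5 ▸ Ideal.zero_mem _)
      have h7 := congrArg PowerSeries.constantCoeff hθ2
      rw [← h5, ← MvPolynomial.algebraMap_eq, AlgHom.commutes, map_mul, PowerSeries.constantCoeff_X, zero_mul, 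
        PowerSeries.algebraMap_apply, PowerSeries.constantCoeff_C] at h7
      exact h6 ((map_eq_zero _).mp h7.symm)
    | succ n =>
      refine ⟨n, θ, fun h => ?_, ?_, ?_⟩
      · rw [← Wn_pow] at h
        have := H.star n (fun _ : Unit => g) (fun _ => h3) hgind (fun _ => 1) θ h (by simp [hθ2]) ()
        exact one_ne_zero this
      · rw [← Wn_pow]; exact hθ
      · rw [← Wn_pow, hθ2]; exact φ_mem_Wn h3

theorem Sel.quadrics (H : Sel I d φ y0 y u) (hI : HI I) (hI0 : ∀ p ∈ I, homogeneousComponent 0 p = 0) 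
    (hI1 : ∀ p ∈ I, p.IsHomogeneous 1 → p = 0) (c : ℕ) (hdc : d + c = r) 
    (hC : CH (Wn φ 1) (c + 2)) : Module.finrank K ((GrS K r).part I 2) + 2 = (c + 1).choose 2 := by
  have h1 := H.Wn_rank hI 1
  rw [Wn_pow, hC.sq_rank, hC.hV] at h1
  have h2 := hq_two hI1 hI hI0 H.yh H.reg d le_rfl
  have h3 : hq (Jy I y d) 2 = c + 3 := by push_cast at h1; linarith
  rw [h3, hq, finrank_H2] at h2
  have h4 : ∀ n : ℕ, 2 * ((n + 1).choose 2 : ℤ) = (n + 1) * n := by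
    intro n
    have := Nat.triangle_succ n
    have h5 := Nat.choose_two_right (n + 1)
    have h6 : 2 ∣ (n + 1) * n := by rw [mul_comm]; exact (Nat.even_mul_succ_self n).two_dvd
    rw [Nat.add_sub_cancel] at h5
    rw [h5]
    exact_mod_cast Nat.mul_div_cancel' h6
  have h5 := h4 c
  have h6 := h4 (r + 1)
  subst hdc
  zify
  push_cast at h2 h6
  have h7 : (((d + c + 1 + 1).choose 2 : ℕ) : ℤ) = (((d + c + 2).choose 2 : ℕ) : ℤ) := rfl
  rw [h7] at h6
  nlinarith

end Curve
end QC

namespace QC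

section Cubic
variable {K : Type} [Field K] {r : ℕ} {I : Ideal (PS K r)} {d : ℕ} {k : Type} [Field k] [Algebra K k] 
    {φ : PS K r →ₐ[K] PowerSeries k} {y0 : PS K r} {y : ℕ → PS K r} {u : ℕ → k}

lemma Jy_bot (j : ℕ) : Jy (⊥ : Ideal (PS K r)) y j = Yy y j := by rw [Jy_eq, bot_sup_eq]

lemma HI_bot : HI (⊥ : Ideal (PS K r)) := by
  intro p hp n
  rw [Ideal.mem_bot] at hp ⊢
  rw [hp, map_zero]

lemma HI_Yy (yh : ∀ i < d, (y i).IsHomogeneous 1) (j : ℕ) (hj : j ≤ d) : HI (Yy y j) := by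
  rw [← Jy_bot]; exact HI_bot.Jy yh j hj

lemma HI.decompY (hI : HI I) (yh : ∀ i < d, (y i).IsHomogeneous 1) {j : ℕ} (hj : j ≤ d) {n : ℕ} {p : PS K r} 
    (hp : p ∈ (GrS K r).part (QC.Jy I y j) n) : ∃ a ∈ (GrS K r).part I n, ∃ b ∈ (GrS K r).part (Yy y j) n, p = a + b := by
  rw [mem_part, Jy_eq] at hp
  obtain ⟨a, ha, b, hb, hab⟩ := Submodule.mem_sup.mp hp.1
  refine ⟨_, mem_part.mpr ⟨hI a ha n, homogeneousComponent_isHomogeneous n a⟩, _, 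
    mem_part.mpr ⟨HI_Yy yh j hj b hb n, homogeneousComponent_isHomogeneous n b⟩, ?_⟩
  rw [← map_add, hab, homogeneousComponent_eq_self hp.2]

lemma lin_mul_mem_S1 {J : Ideal (PS K r)} {l p : PS K r} {n : ℕ} (hl : l.IsHomogeneous 1) (hp : p ∈ (GrS K r).part J n) : 
    l * p ∈ (GrS K r).S1 J n := by
  have h1 : l ∈ Submodule.span K (Set.range (X : Fin (r + 1) → PS K r)) := by
    rw [← homogeneousSubmodule_one_eq_span_X]; exact hl
  clear hl
  induction h1 using Submodule.span_induction with
  | mem x hx =>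
    obtain ⟨i, rfl⟩ := hx
    exact Submodule.subset_span ⟨i, p, hp, rfl⟩
  | zero => rw [zero_mul]; exact Submodule.zero_mem _
  | add x y _ _ h1 h2 => rw [add_mul]; exact Submodule.add_mem _ h1 h2
  | smul a x _ h => rw [smul_mul_assoc]; exact Submodule.smul_mem _ _ h

lemma I_inf_Y (hI : HI I) (yh : ∀ i < d, (y i).IsHomogeneous 1) (hreg : RegY I y d) (n : ℕ) : ∀ j ≤ d, ∀ p ∈ I, 
    p ∈ (GrS K r).part (Yy y j) (n + 1) → p ∈ (GrS K r).S1 I n := by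
  intro j
  induction j with
  | zero => 
    intro _ p _ hp
    rw [mem_part] at hp
    have : Yy y 0 = ⊥ := by simp [Yy]
    rw [this] at hp
    rw [(Ideal.mem_bot).mp hp.1]; exact Submodule.zero_mem _
  | succ j ih =>
    intro hj p hpI hp
    rw [mem_part, Yy_succ] at hp
    obtain ⟨a, ha, hah, q, hq, rfl⟩ := (HI_Yy yh j (by omega)).decomp (yh j (by omega)) hp.2 hp.1
    have h1 : q ∈ Jy I y j := by
      refine hreg j (by omega) q ?_
      have : y j * q = (a + y j * q) - a := by ring
      rw [this]
      exact Ideal.sub_mem _ (Ideal.mem_sup_left hpI) (Ideal.mem_sup_right ha)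
    obtain ⟨i, hi, b, hb, rfl⟩ := hI.decompY yh (j := j) (by omega) (mem_part.mpr ⟨h1, hq⟩)
    have hi' := mem_part.mp hi
    have hb' := mem_part.mp hb
    have h2 : a + y j * b ∈ (GrS K r).S1 I n := by
      refine ih (by omega) _ ?_ (mem_part.mpr ⟨Ideal.add_mem _ ha (Ideal.mul_mem_left _ _ hb'.1), ?_⟩)
      · have : a + y j * b = (a + y j * (i + b)) - y j * i := by ring
        rw [this]
        exact Ideal.sub_mem _ hpI (Ideal.mul_mem_left _ _ hi'.1)
      · refine hah.add ?_
        rw [add_comm n 1]; exact (yh j (by omega)).mul hb'.2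
    have : a + y j * (i + b) = (a + y j * b) + y j * i := by ring
    rw [this]
    exact Submodule.add_mem _ h2 (lin_mul_mem_S1 (yh j (by omega)) hi)

/-- `I_{n+1}` meets `S_1 I_n + (y)` in `S_1 I_n` -/
lemma I_inf_Q (hI : HI I) (yh : ∀ i < d, (y i).IsHomogeneous 1) (hreg : RegY I y d) (n : ℕ) {p : PS K r} 
    (hp : p ∈ I) (hpQ : p ∈ (GrS K r).S1 I n ⊔ (GrS K r).part (Yy y d) (n + 1)) : p ∈ (GrS K r).S1 I n := by
  obtain ⟨s, hs, b, hb, rfl⟩ := Submodule.mem_sup.mp hpQ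
  refine Submodule.add_mem _ hs (I_inf_Y hI yh hreg n d le_rfl b ?_ hb)
  have h1 := (mem_part.mp ((GrS K r).S1_le I n hs)).1
  exact (Ideal.add_mem_iff_right _ h1).mp hp

lemma Sel.extend (H : Sel I d φ y0 y u) (hI : HI I) (n : ℕ) {Z : Type} [AddCommGroup Z] [Module k Z] [Module K Z] 
    [IsScalarTower K k Z] (F : PS K r →ₗ[K] Z) 
    (hF : ∀ p ∈ (GrS K r).part (Jy I y d) (n + 1), F p = 0) : 
    ∃ g : PowerSeries k →ₗ[k] Z, (∀ p, p.IsHomogeneous (n + 1) → g (φ p) = F p) ∧ ∀ w ∈ Wn φ n, g (PowerSeries.X * w) = 0 := by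
  obtain ⟨m, hm, f, hf, hind, hsp⟩ := H.basis n
  obtain ⟨g, hg1, hg2⟩ := exists_functional ((Wn φ n).map (lm PowerSeries.X)) (fun i => φ (f i)) hind (fun i => F (f i))
  refine ⟨g, fun p hp => ?_, fun w hw => hg2 _ ⟨w, hw, rfl⟩⟩
  obtain ⟨c, hc⟩ := hsp p hp
  have h1 : g (φ (p - ∑ i, c i • f i)) = 0 := hg2 _ (H.J_map hI d le_rfl n _ (mem_part.mp hc).1 (mem_part.mp hc).2)
  have h2 := hF _ hc
  rw [map_sub, map_sum, map_sub, map_sum, sub_eq_zero] at h1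
  rw [map_sub, map_sum, sub_eq_zero] at h2
  rw [h1, h2]
  refine Finset.sum_congr rfl fun i _ => ?_
  rw [map_smul, F.map_smul, ← hg1, ← algebraMap_smul k (c i) (φ (f i)), map_smul, algebraMap_smul]

/-- the bilinear form attached to a functional -/
lemma Sel.bilin (H : Sel I d φ y0 y u) (hI : HI I) (hI1 : ∀ p ∈ I, p.IsHomogeneous 1 → p = 0) (F : PS K r →ₗ[K] k) 
    (hF : ∀ p ∈ (GrS K r).S1 I 2 ⊔ (GrS K r).part (Yy y d) 3, F p = 0) : 
    ∃ f : PowerSeries k →ₗ[k] PowerSeries k →ₗ[k] k, ∀ l q : PS K r, l.IsHomogeneous 1 → q.IsHomogeneous 2 → 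
      f (φ l) (φ q) = F (l * q) := by
  obtain ⟨m, hm, e, he, hind, hsp⟩ := H.basis 0
  have h1 : ∀ i, ∃ g : PowerSeries k →ₗ[k] k, ∀ q : PS K r, q.IsHomogeneous 2 → g (φ q) = F (e i * q) := by
    intro i
    obtain ⟨g, hg, -⟩ := H.extend hI 1 (F ∘ₗ LinearMap.mulLeft K (e i)) (by
      intro p hp
      obtain ⟨a, ha, b, hb, rfl⟩ := hI.decompY H.yh le_rfl hp
      rw [LinearMap.comp_apply, LinearMap.mulLeft_apply, mul_add]
      refine hF _ (Submodule.add_mem_sup (lin_mul_mem_S1 (he i) ha) ?_)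
      have hb := mem_part.mp hb
      exact mem_part.mpr ⟨Ideal.mul_mem_left _ _ hb.1, (he i).mul hb.2⟩)
    exact ⟨g, hg⟩
  choose g hg using h1
  obtain ⟨f, hf1, hf2⟩ := exists_functional ((Wn φ 0).map (lm PowerSeries.X)) (fun i => φ (e i)) hind g
  refine ⟨f, fun l q hl hq => ?_⟩
  obtain ⟨c, hc⟩ := hsp l hl
  have h1 : f (φ (l - ∑ i, c i • e i)) = 0 := hf2 _ (H.J_map hI d le_rfl 0 _ (mem_part.mp hc).1 (mem_part.mp hc).2)
  have h2 : F ((l - ∑ i, c i • e i) * q) = 0 := by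
    obtain ⟨a, ha, b, hb, hab⟩ := hI.decompY H.yh le_rfl hc
    have ha := mem_part.mp ha
    have hb := mem_part.mp hb
    rw [hab, hI1 a ha.1 ha.2, zero_add]
    exact hF _ (Submodule.mem_sup_right (mem_part.mpr ⟨Ideal.mul_mem_right _ _ hb.1, hb.2.mul hq⟩))
  rw [map_sub, map_sum, map_sub, map_sum, sub_eq_zero] at h1
  rw [sub_mul, map_sub, Finset.sum_mul, map_sum, sub_eq_zero] at h2
  rw [h1, h2, LinearMap.sum_apply]
  refine Finset.sum_congr rfl fun i _ => ?_
  rw [map_smul φ, smul_mul_assoc, F.map_smul, ← hg _ _ hq, ← hf1, ← algebraMap_smul k (c i) (φ (e i)), map_smul, 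
    LinearMap.smul_apply, algebraMap_smul]

lemma bilin_symm (F : PS K r →ₗ[K] k) (f : PowerSeries k →ₗ[k] PowerSeries k →ₗ[k] k) 
    (hf : ∀ l q : PS K r, l.IsHomogeneous 1 → q.IsHomogeneous 2 → f (φ l) (φ q) = F (l * q)) : 
    ∀ v ∈ Wn φ 1, ∀ v' ∈ Wn φ 1, ∀ x ∈ Wn φ 1, f v (v' * x) = f v' (v * x) := by
  intro v hv v' hv' x hx
  induction hv using Submodule.span_induction with
  | mem v hv =>
    obtain ⟨l, hl, rfl⟩ := hv
    induction hv' using Submodule.span_induction with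
    | mem v' hv' =>
      obtain ⟨l', hl', rfl⟩ := hv'
      induction hx using Submodule.span_induction with
      | mem x hx =>
        obtain ⟨l'', hl'', rfl⟩ := hx
        rw [← map_mul, ← map_mul, hf _ _ hl (hl'.mul hl''), hf _ _ hl' (hl.mul hl'')]
        congr 1; ring
      | zero => simp
      | add a b _ _ h1 h2 => rw [mul_add, mul_add, map_add, map_add, h1, h2]
      | smul a b _ h => rw [mul_smul_comm, mul_smul_comm, map_smul, map_smul, h]
    | zero => simp
    | add a b _ _ h1 h2 => rw [add_mul, map_add, map_add, h1, h2, LinearMap.add_apply]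
    | smul a b _ h => rw [smul_mul_assoc, map_smul, map_smul, h, LinearMap.smul_apply]
  | zero => simp
  | add a b _ _ h1 h2 => rw [add_mul, map_add, map_add, LinearMap.add_apply, h1, h2]
  | smul a b _ h => rw [smul_mul_assoc, map_smul, map_smul, LinearMap.smul_apply, h]

theorem Sel.cubics (H : Sel I d φ y0 y u) (hI : HI I) 
    (hI1 : ∀ p ∈ I, p.IsHomogeneous 1 → p = 0) {m : ℕ} (hC : CH (Wn φ 1) m) : 
    Module.finrank K ((GrS K r).part I 3) ≤ Module.finrank K ((GrS K r).S1 I 2) + 1 := by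
  by_contra! hlt
  have fd1 := (GrS K r).part_fd I 3
  obtain ⟨C, hC1, hC2, hC3, hC4⟩ := exists_compl_fin ((GrS K r).S1 I 2) ((GrS K r).part I 3) ((GrS K r).S1_le I 2)
  have fd2 : FiniteDimensional K C := Submodule.finiteDimensional_of_le hC1
  obtain ⟨p1, hp1, q1, hq1, p2, hp2, q2, hq2, hcub⟩ := hC.cubic
  let b := Module.finBasis K C
  have hrk : 1 < Module.finrank K C := by omega
  let i0 : Fin (Module.finrank K C) := ⟨0, by omega⟩
  let i1 : Fin (Module.finrank K C) := ⟨1, by omega⟩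
  have hne : i0 ≠ i1 := by simp [i0, i1]
  -- functionals dual to the basis
  have h1 : ∀ j, ∃ F : PS K r →ₗ[K] k, (∀ p ∈ (GrS K r).S1 I 2 ⊔ (GrS K r).part (Yy y d) 3, F p = 0) ∧ 
      ∀ i, F (b i) = if i = j then 1 else 0 := by
    intro j
    obtain ⟨g, hg1, hg2⟩ := exists_functional (k := K) ((GrS K r).S1 I 2 ⊔ (GrS K r).part (Yy y d) 3) (fun i => (b i : PS K r)) (by
      intro a ha
      have h1 : ∑ i, a i • (b i : PS K r) ∈ C := Submodule.sum_mem _ fun i _ => C.smul_mem _ (b i).2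
      have h2 := I_inf_Q hI H.yh H.reg 2 (mem_part.mp (hC1 h1)).1 ha
      have h3 : ∑ i, a i • (b i : PS K r) = 0 := by
        have : ∑ i, a i • (b i : PS K r) ∈ (⊥ : Submodule K (PS K r)) := by rw [← hC3]; exact ⟨h2, h1⟩
        exact this
      refine Fintype.linearIndependent_iff.mp b.linearIndependent a (Subtype.ext ?_)
      rw [AddSubmonoidClass.coe_finsetSum]
      exact h3) (fun i => if i = j then (1 : K) else 0)
    refine ⟨(Algebra.linearMap K k) ∘ₗ g, fun p hp => ?_, fun i => ?_⟩
    · rw [LinearMap.comp_apply, hg2 p hp, map_zero]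
    · rw [LinearMap.comp_apply, hg1]; split_ifs <;> simp
  obtain ⟨F0, hF0, hF0b⟩ := h1 i0
  obtain ⟨F1, hF1, hF1b⟩ := h1 i1
  obtain ⟨f0, hf0⟩ := H.bilin hI hI1 F0 hF0
  obtain ⟨f1, hf1⟩ := H.bilin hI hI1 F1 hF1
  -- vanishing
  have key : ∀ a0 a1 : k, (a0 • f0 + a1 • f1) p1 q1 = (a0 • f0 + a1 • f1) p2 q2 → a0 = 0 ∧ a1 = 0 := by
    intro a0 a1 h
    let F : PS K r →ₗ[K] k := a0 • F0 + a1 • F1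
    have hf : ∀ l q : PS K r, l.IsHomogeneous 1 → q.IsHomogeneous 2 → (a0 • f0 + a1 • f1) (φ l) (φ q) = F (l * q) := by
      intro l q hl hq
      simp only [F, LinearMap.add_apply, LinearMap.smul_apply, hf0 l q hl hq, hf1 l q hl hq]
    obtain ⟨g, hg⟩ := hcub (a0 • f0 + a1 • f1) (bilin_symm F _ hf) h
    have hFg : ∀ p : PS K r, p.IsHomogeneous 3 → F p = g (φ p) := by
      intro p hp
      have h1 := homog_succ_mem 2 p hp
      clear hp
      induction h1 using Submodule.span_induction with
      | mem x hx => 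
        obtain ⟨i, q, hq, rfl⟩ := hx
        rw [← hf _ _ (isHomogeneous_X _ _) hq, hg _ (φ_mem_Wn (isHomogeneous_X _ _)) _ (Wn_pow (φ := φ) 2 ▸ φ_mem_Wn hq), map_mul φ]
      | zero => simp
      | add x y _ _ h1 h2 => simp only [map_add, h1, h2]
      | smul a x _ h => rw [map_smul, map_smul φ, h, ← algebraMap_smul k a (φ x), map_smul, algebraMap_smul]
    have hFb : ∀ i, F (b i) = 0 := by
      intro i
      have h2 := mem_part.mp (hC1 (b i).2)
      rw [hFg _ h2.2, H.kI _ h2.1, map_zero]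
    have h2 := hFb i0
    have h3 := hFb i1
    simp only [F, LinearMap.add_apply, LinearMap.smul_apply, hF0b, hF1b, if_true, if_neg hne, if_neg hne.symm, smul_eq_mul, 
      mul_one, mul_zero, add_zero, zero_add] at h2 h3
    exact ⟨h2, h3⟩
  have h2 := key (f1 p1 q1 - f1 p2 q2) (- (f0 p1 q1 - f0 p2 q2)) (by
    simp only [LinearMap.add_apply, LinearMap.smul_apply, smul_eq_mul]; ring)
  have h3 := key 1 0 (by 
    simp only [LinearMap.add_apply, LinearMap.smul_apply, smul_eq_mul, zero_mul, add_zero, one_mul]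
    linear_combination -h2.2)
  exact one_ne_zero h3.1

lemma Sel.S_le (H : Sel I d φ y0 y u) (hI : HI I) {m : ℕ} (hC : CH (Wn φ 1) m) (n : ℕ) (hn : 2 ≤ n) : 
    (GrS K r).H (n + 1) ≤ ((GrS K r).H n).map (LinearMap.mulLeft K y0) ⊔ (GrS K r).part (Jy I y d) (n + 1) := by
  intro p hp
  by_contra hcon
  obtain ⟨F0, hF0, hF0'⟩ := Submodule.exists_le_ker_of_notMem hcon
  let F : PS K r →ₗ[K] k := (Algebra.linearMap K k) ∘ₗ F0
  have hFk : ∀ x ∈ ((GrS K r).H n).map (LinearMap.mulLeft K y0) ⊔ (GrS K r).part (Jy I y d) (n + 1), F x = 0 := by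
    intro x hx
    have := LinearMap.mem_ker.mp (hF0' hx)
    rw [LinearMap.comp_apply, this, map_zero]
  obtain ⟨g, hg1, hg2⟩ := H.extend hI n F fun p hp => hFk p (Submodule.mem_sup_right hp)
  have h1 : Wn φ (n + 1) ≤ LinearMap.ker g := by
    rw [Wn_pow, hC.pow_gen n hn, ← Wn_pow]
    refine sup_le ?_ ?_
    · rw [Wn, Submodule.span_le]
      rintro _ ⟨q, hq, rfl⟩
      have hq : q.IsHomogeneous n := hq
      have h2 := hg1 (y0 * q) (by rw [add_comm n 1]; exact H.y0h.mul hq)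
      rw [map_mul, H.y0φ, one_mul, hFk (y0 * q) (Submodule.mem_sup_left ⟨q, GrS_mem.mpr hq, rfl⟩)] at h2
      exact h2
    · rintro _ ⟨w, hw, rfl⟩
      exact hg2 w hw
  have h2 := hg1 p (GrS_mem.mp hp)
  rw [LinearMap.mem_ker.mp (h1 (φ_mem_Wn (GrS_mem.mp hp)))] at h2
  exact hF0 ((map_eq_zero (algebraMap K k)).mp h2.symm)

theorem Sel.higher (H : Sel I d φ y0 y u) (hI : HI I) {m : ℕ} (hC : CH (Wn φ 1) m) (n : ℕ) (hn : 3 ≤ n) : 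
    (GrS K r).part I (n + 1) ≤ (GrS K r).S1 I n := by
  have hb : ∀ n, 2 ≤ n → hq (Jy I y d) (n + 1) = m := by
    intro n hn
    have h1 := H.Wn_rank hI n
    rw [Wn_pow, Wn_pow n, hC.pow_rank n hn, hC.pow_rank (n + 1) (by omega)] at h1
    push_cast at h1
    linarith
  have fd1 := H_fd (K := K) (r := r) n
  have fd3 := H_fd (K := K) (r := r) (n + 1)
  have fd5 := (GrS K r).part_fd (Jy I y d) (n + 1)
  obtain ⟨C, hC1, hC2, hC3, hC4⟩ := exists_compl_fin ((GrS K r).part (Jy I y d) n) ((GrS K r).H n) inf_le_right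
  have fd2 : FiniteDimensional K C := Submodule.finiteDimensional_of_le hC1
  have fd4 : FiniteDimensional K ((GrS K r).S1 (Jy I y d) n) := Submodule.finiteDimensional_of_le ((GrS K r).S1_le _ _)
  have h1 : (GrS K r).H (n + 1) ≤ C.map (LinearMap.mulLeft K y0) ⊔ (GrS K r).S1 (Jy I y d) n := by
    intro p hp
    have h2 := homog_succ_mem n p (GrS_mem.mp hp)
    clear hp
    induction h2 using Submodule.span_induction with
    | mem x hx =>
      obtain ⟨i, q, hq, rfl⟩ := hx
      obtain ⟨n', rfl⟩ : ∃ n', n = n' + 1 := ⟨n - 1, by omega⟩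
      obtain ⟨_, ⟨q', hq', rfl⟩, j, hj, rfl⟩ := Submodule.mem_sup.mp (H.S_le hI hC n' (by omega) (GrS_mem.mpr hq))
      rw [mul_add]
      refine Submodule.add_mem _ ?_ (Submodule.mem_sup_right (lin_mul_mem_S1 (isHomogeneous_X _ _) hj))
      have h3 : X i * q' ∈ (GrS K r).part (Jy I y d) (n' + 1) ⊔ C := by
        rw [hC2, GrS_mem, add_comm n' 1]
        exact (isHomogeneous_X _ _).mul (GrS_mem.mp hq')
      obtain ⟨a, ha, c, hc, hac⟩ := Submodule.mem_sup.mp h3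
      have h4 : X i * (LinearMap.mulLeft K y0) q' = y0 * c + y0 * a := by
        rw [LinearMap.mulLeft_apply]
        linear_combination -y0 * hac
      rw [h4]
      exact Submodule.add_mem_sup ⟨c, hc, rfl⟩ (lin_mul_mem_S1 H.y0h ha)
    | zero => exact Submodule.zero_mem _
    | add x y _ _ h1 h2 => exact Submodule.add_mem _ h1 h2
    | smul a x _ h => exact Submodule.smul_mem _ _ h
  have h2 := Submodule.finrank_mono h1
  have h3 := Submodule.finrank_add_le_finrank_add_finrank (C.map (LinearMap.mulLeft K y0)) ((GrS K r).S1 (Jy I y d) n)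
  have h4 := Submodule.finrank_map_le (LinearMap.mulLeft K y0) C
  have h5 : (GrS K r).S1 (Jy I y d) n = (GrS K r).part (Jy I y d) (n + 1) := by
    refine Submodule.eq_of_le_of_finrank_le ((GrS K r).S1_le _ _) ?_
    have h6 := hb n (by omega)
    have h7 := hb (n - 1) (by omega)
    rw [Nat.sub_add_cancel (by omega)] at h7
    rw [hq] at h6 h7
    omega
  intro p hp
  refine I_inf_Q hI H.yh H.reg n (mem_part.mp hp).1 ?_
  have h6 : p ∈ (GrS K r).S1 (Jy I y d) n := by
    rw [h5]
    exact mem_part.mpr ⟨Ideal.mem_sup_left (mem_part.mp hp).1, (mem_part.mp hp).2⟩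
  clear hp
  induction h6 using Submodule.span_induction with
  | mem x hx =>
    obtain ⟨i, q, hq, rfl⟩ := hx
    obtain ⟨a, ha, b, hb, rfl⟩ := hI.decompY H.yh le_rfl hq
    rw [smul_add]
    refine Submodule.add_mem_sup (lin_mul_mem_S1 (isHomogeneous_X _ _) ha) (mem_part.mpr ?_)
    have hb := mem_part.mp hb
    refine ⟨Ideal.mul_mem_left _ _ hb.1, ?_⟩
    rw [add_comm n 1]; exact (isHomogeneous_X _ _).mul hb.2
  | zero => exact Submodule.zero_mem _
  | add x y _ _ h1 h2 => exact Submodule.add_mem _ h1 h2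
  | smul a x _ h => exact Submodule.smul_mem _ _ h

end Cubic
end QC

namespace QC

section Rees
variable {S : Type} [CommRing S]

/-- `J` is saturated with respect to `𝔞` (to first order). -/
def Sat (𝔞 J : Ideal S) : Prop := ∀ f, (∀ a ∈ 𝔞, a * f ∈ J) → f ∈ J

lemma sat_of_reg {𝔞 J : Ideal S} {z : S} (hz : z ∈ 𝔞) (h : ∀ f, z * f ∈ J → f ∈ J) : Sat 𝔞 J := 
  fun f hf => h f (hf z hz)

lemma mem_sup_single {J : Ideal S} {x p : S} : p ∈ J ⊔ Ideal.span {x} ↔ ∃ g, p - x * g ∈ J := by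
  rw [Submodule.mem_sup]
  constructor
  · rintro ⟨a, ha, b, hb, rfl⟩
    obtain ⟨g, rfl⟩ := Ideal.mem_span_singleton'.mp hb
    exact ⟨g, by simpa [mul_comm] using ha⟩
  · rintro ⟨g, hg⟩
    exact ⟨_, hg, x * g, Ideal.mul_mem_right _ _ (Ideal.mem_span_singleton_self x), by ring⟩

lemma ass_fin [IsNoetherianRing S] (J : Ideal S) : ∃ T : Set (Ideal S), T.Finite ∧ 
    (∀ Q ∈ T, Q.IsPrime ∧ ∃ f, f ∉ J ∧ ∀ a ∈ Q, a * f ∈ J) ∧ 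
    ∀ z, (∀ Q ∈ T, z ∉ Q) → ∀ f, z * f ∈ J → f ∈ J := by
  refine ⟨associatedPrimes S (S ⧸ J), associatedPrimes.finite S (S ⧸ J), ?_, ?_⟩
  · intro Q hQ
    obtain ⟨h1, x, hx⟩ := isAssociatedPrime_iff.mp hQ
    obtain ⟨f, rfl⟩ := Ideal.Quotient.mk_surjective x
    have key : ∀ a, a ∈ Q ↔ a * f ∈ J := by
      intro a
      rw [hx, Submodule.mem_colon_singleton, Submodule.mem_bot, ← Ideal.Quotient.eq_zero_iff_mem, map_mul]
      rfl
    refine ⟨h1, f, fun h => h1.ne_top ?_, fun a ha => (key a).mp ha⟩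
    rw [Ideal.eq_top_iff_one, key, one_mul]
    exact h
  · intro z hz f hf
    by_contra h
    have : z ∈ ⋃ p ∈ associatedPrimes S (S ⧸ J), (p : Set S) := by
      rw [biUnion_associatedPrimes_eq_zero_divisors]
      refine ⟨Ideal.Quotient.mk J f, by rwa [Ne, Ideal.Quotient.eq_zero_iff_mem], ?_⟩
      rw [← Ideal.Quotient.eq_zero_iff_mem, map_mul] at hf
      exact hf
    obtain ⟨Q, hQ, hzQ⟩ := Set.mem_iUnion₂.mp this
    exact hz Q hQ hzQ

lemma exists_reg [IsNoetherianRing S] (𝔞 : Ideal S) {ι : Type} [Finite ι] (J : ι → Ideal S) (h : ∀ i, Sat 𝔞 (J i)) : 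
    ∃ z ∈ 𝔞, ∀ i, ∀ f, z * f ∈ J i → f ∈ J i := by
  choose T hT1 hT2 hT3 using fun i => ass_fin (J i)
  have hfin : (⋃ i, T i).Finite := Set.finite_iUnion hT1
  by_contra hcon
  push Not at hcon
  have : (𝔞 : Set S) ⊆ ⋃ Q ∈ (⋃ i, T i), ((fun Q : Ideal S => Q) Q : Set S) := by
    intro z hz
    by_contra hz'
    simp only [Set.mem_iUnion, not_exists] at hz'
    obtain ⟨i, f, h1, h2⟩ := hcon z hz
    exact h2 (hT3 i z (fun Q hQ => hz' Q ⟨i, hQ⟩) f h1)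
  rw [Ideal.subset_union_prime_finite hfin ⊥ ⊥] at this
  · obtain ⟨Q, hQ, hle⟩ := this
    obtain ⟨i, hi⟩ := Set.mem_iUnion.mp hQ
    obtain ⟨f, hf, hf'⟩ := (hT2 i Q hi).2
    exact hf (h i f fun a ha => hf' a (hle ha))
  · intro Q hQ _ _
    obtain ⟨i, hi⟩ := Set.mem_iUnion.mp hQ
    exact (hT2 i Q hi).1

lemma sat_exchange {𝔞 J : Ideal S} {x y : S} (hxa : x ∈ 𝔞) (hx : ∀ f, x * f ∈ J → f ∈ J) 
    (hy : ∀ f, y * f ∈ J → f ∈ J) (h : Sat 𝔞 (J ⊔ Ideal.span {x})) : Sat 𝔞 (J ⊔ Ideal.span {y}) := by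
  intro f hf
  obtain ⟨g, hg⟩ := mem_sup_single.mp (hf x hxa)
  have : g ∈ J ⊔ Ideal.span {x} := by
    apply h
    intro a ha
    obtain ⟨h', hh'⟩ := mem_sup_single.mp (hf a ha)
    rw [mem_sup_single]
    refine ⟨h', hy _ ?_⟩
    have := sub_mem (J.mul_mem_left x hh') (J.mul_mem_left a hg)
    convert this using 1
    ring
  obtain ⟨g', hg'⟩ := mem_sup_single.mp this
  rw [mem_sup_single]
  refine ⟨g', hx _ ?_⟩
  have := add_mem hg (J.mul_mem_left y hg')
  convert this using 1
  ring

lemma reg_move {J : Ideal S} {x z : S} (hx : ∀ f, x * f ∈ J → f ∈ J) 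
    (hzx : ∀ f, z * f ∈ J ⊔ Ideal.span {x} → f ∈ J ⊔ Ideal.span {x}) : 
    ∀ f, x * f ∈ J ⊔ Ideal.span {z} → f ∈ J ⊔ Ideal.span {z} := by
  intro f hf
  obtain ⟨g, hg⟩ := mem_sup_single.mp hf
  have : g ∈ J ⊔ Ideal.span {x} := by
    apply hzx
    rw [mem_sup_single]
    exact ⟨f, by rw [← neg_mem_iff]; convert hg using 1; ring⟩
  obtain ⟨g', hg'⟩ := mem_sup_single.mp this
  rw [mem_sup_single]
  refine ⟨g', hx _ ?_⟩
  have := add_mem hg (J.mul_mem_left z hg')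
  convert this using 1
  ring

lemma Jy_sup (I : Ideal S) (x : ℕ → S) (z : S) (n : ℕ) : Jy (I ⊔ Ideal.span {z}) x n = Jy I x n ⊔ Ideal.span {z} := by
  rw [Jy_eq, Jy_eq, sup_right_comm]

lemma RegY.move {I : Ideal S} {x : ℕ → S} {k : ℕ} (hx : RegY I x k) {z : S} 
    (hz : ∀ i ≤ k, ∀ f, z * f ∈ Jy I x i → f ∈ Jy I x i) : RegY (I ⊔ Ideal.span {z}) x k := by
  intro i hi
  rw [Jy_sup]
  refine reg_move (hx i hi) ?_
  rw [← Jy_succ]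
  exact hz (i+1) hi

lemma RegY.mono {I : Ideal S} {x : ℕ → S} {k n : ℕ} (hx : RegY I x k) (h : n ≤ k) : RegY I x n := 
  fun i hi => hx i (by omega)

theorem rees_sat [IsNoetherianRing S] (𝔞 : Ideal S) (k : ℕ) : ∀ (I : Ideal S) (x y : ℕ → S), (∀ i < k, x i ∈ 𝔞) → 
    (∀ i < k, y i ∈ 𝔞) → RegY I x k → RegY I y k → Sat 𝔞 (Jy I x k) → Sat 𝔞 (Jy I y k) := by
  induction k with
  | zero => intro I x y _ _ _ _ h; rwa [Jy_zero] at h ⊢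
  | succ k ih => 
    intro I x y hxa hya hx hy h
    obtain ⟨z, hza, hz⟩ := exists_reg 𝔞 (fun i : Fin (k+1) ⊕ Fin (k+1) => Sum.elim (fun i : Fin (k+1) => Jy I x i) (fun i : Fin (k+1) => Jy I y i) i)
      (by
        rintro (i | i)
        · exact sat_of_reg (hxa i i.2) (hx i i.2)
        · exact sat_of_reg (hya i i.2) (hy i i.2))
    have hzx : ∀ i ≤ k, ∀ f, z * f ∈ Jy I x i → f ∈ Jy I x i := fun i hi => hz (Sum.inl ⟨i, by omega⟩)
    have hzy : ∀ i ≤ k, ∀ f, z * f ∈ Jy I y i → f ∈ Jy I y i := fun i hi => hz (Sum.inr ⟨i, by omega⟩)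
    have h1 := ih (I ⊔ Ideal.span {z}) x y (fun i hi => hxa i (by omega)) (fun i hi => hya i (by omega)) 
      ((hx.mono (by omega)).move hzx) ((hy.mono (by omega)).move hzy)
    rw [Jy_sup, Jy_sup] at h1
    rw [Jy_succ] at h ⊢
    exact sat_exchange hza (hzy k le_rfl) (hy k (by omega)) 
      (h1 (sat_exchange (hxa k (by omega)) (hx k (by omega)) (hzx k le_rfl) h))

/-- consequence: any shorter regular sequence leaves positive depth. -/
theorem rees_short [IsNoetherianRing S] (𝔞 : Ideal S) {d k : ℕ} {I : Ideal S} {x y : ℕ → S} (hxa : ∀ i < d, x i ∈ 𝔞) 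
    (hya : ∀ i < k, y i ∈ 𝔞) (hx : RegY I x d) (hy : RegY I y k) (hkd : k < d) : Sat 𝔞 (Jy I y k) := 
  rees_sat 𝔞 k I x y (fun i hi => hxa i (by omega)) hya (hx.mono hkd.le) hy (sat_of_reg (hxa k hkd) (hx k hkd))

end Rees
end QC

namespace QC

section WSel

lemma greedy {α : Type} [Nonempty α] (N : ℕ) (P : ℕ → (ℕ → α) → Prop) 
    (hloc : ∀ i w w', (∀ j ≤ i, w j = w' j) → P i w → P i w')
    (step : ∀ n < N, ∀ w, (∀ i < n, P i w) → ∃ a, P n (Function.update w n a)) : ∃ w, ∀ i < N, P i w := by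
  have : ∀ n ≤ N, ∃ w, ∀ i < n, P i w := by
    intro n
    induction n with
    | zero => exact fun _ => ⟨fun _ => Classical.arbitrary α, fun i hi => absurd hi (by omega)⟩
    | succ n ih => 
      intro hn
      obtain ⟨w, hw⟩ := ih (by omega)
      obtain ⟨a, ha⟩ := step n (by omega) w hw
      refine ⟨Function.update w n a, fun i hi => ?_⟩
      rcases Nat.lt_succ_iff_lt_or_eq.mp hi with h | rfl
      · refine hloc i w _ (fun j hj => ?_) (hw i h)
        rw [Function.update_of_ne (by omega)]
      · exact ha
  exact this N le_rfl

lemma avoid {K E : Type} [Field K] [Infinite K] [AddCommGroup E] [Module K E] (L : Submodule K E) {ι : Type} [Finite ι] 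
    (p : ι → Submodule K E) (h : ∀ i, ¬ L ≤ p i) : ∃ v ∈ L, ∀ i, v ∉ p i := by
  by_contra hcon
  push Not at hcon
  have : ⋃ i, (((p i).comap L.subtype : Submodule K L) : Set L) = Set.univ := by
    ext v
    simp only [Set.mem_iUnion, Set.mem_univ, iff_true]
    obtain ⟨i, hi⟩ := hcon v v.2
    exact ⟨i, hi⟩
  obtain ⟨i, hi⟩ := Subspace.exists_eq_top_of_iUnion_eq_univ this
  apply h i
  intro v hv
  have : (⟨v, hv⟩ : L) ∈ (p i).comap L.subtype := by rw [hi]; trivial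
  exact this

lemma Jy_congr {S : Type} [CommRing S] {I : Ideal S} {w w' : ℕ → S} {n : ℕ} (h : ∀ j < n, w j = w' j) : Jy I w n = Jy I w' n := by
  rw [Jy, Jy]
  congr 2
  ext x
  constructor
  · rintro ⟨j, hj, rfl⟩; exact ⟨j, hj, (h j hj).symm⟩
  · rintro ⟨j, hj, rfl⟩; exact ⟨j, hj, (h j hj)⟩

variable {K : Type} [Field K] {r : ℕ} 

/-- the irrelevant ideal -/
def mI (K : Type) [Field K] (r : ℕ) : Ideal (PS K r) := Ideal.span (Set.range (X : Fin (r + 1) → PS K r))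

lemma mem_mI {p : PS K r} : p ∈ mI K r ↔ homogeneousComponent 0 p = 0 := by
  rw [mI, ← Set.image_univ, mem_ideal_span_X_image, homogeneousComponent_zero]
  constructor
  · intro h
    rw [← map_zero MvPolynomial.C]
    congr 1
    by_contra h0
    obtain ⟨i, _, hi⟩ := h 0 (mem_support_iff.mpr h0)
    exact hi rfl
  · intro h m hm
    by_contra hcon
    push Not at hcon
    have : m = 0 := by
      ext i; exact hcon i (Set.mem_univ _)
    subst this
    exact (mem_support_iff.mp hm) (by simpa using h)

lemma lin_mem_mI {p : PS K r} (hp : p.IsHomogeneous 1) : p ∈ mI K r := by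
  rw [mem_mI, homogeneousComponent_of_mem hp, if_neg (by omega)]

lemma mI_prime : (mI K r).IsPrime := by
  have : mI K r = RingHom.ker (constantCoeff : PS K r →+* K) := by
    ext p
    rw [mem_mI, RingHom.mem_ker, homogeneousComponent_zero, constantCoeff_eq]
    simp
  rw [this]
  exact RingHom.ker_isPrime _

lemma mI_le {Q : Ideal (PS K r)} (h : homogeneousSubmodule (Fin (r + 1)) K 1 ≤ Q.restrictScalars K) : mI K r ≤ Q := by
  rw [mI, Ideal.span_le]
  rintro _ ⟨i, rfl⟩
  exact h (isHomogeneous_X K i)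

lemma minPrime_le_mI {J : Ideal (PS K r)} (hJ : HI J) {Q : Ideal (PS K r)} (hQ : Q ∈ J.minimalPrimes) : Q ≤ mI K r := by
  let _gr : GradedAlgebra (homogeneousSubmodule (Fin (r+1)) K) := MvPolynomial.gradedAlgebra
  have hJh : J.IsHomogeneous (homogeneousSubmodule (Fin (r+1)) K) := by
    intro n p hp
    have := hJ p hp n
    rwa [← decomposition.decompose'_apply] at this
  have hQp : Q.IsPrime := hQ.1.1
  have h1 := hQp.homogeneousCore (𝒜 := homogeneousSubmodule (Fin (r+1)) K)
  have h2 : J ≤ (Q.homogeneousCore (homogeneousSubmodule (Fin (r+1)) K)).toIdeal := by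
    have := Ideal.homogeneousCore_mono (homogeneousSubmodule (Fin (r+1)) K) hQ.1.2
    rw [← hJh.toIdeal_homogeneousCore_eq_self]
    exact this
  have h3 := hQ.2 ⟨h1, h2⟩ (Ideal.toIdeal_homogeneousCore_le _ _)
  intro p hp
  have h4 := homogeneousComponent_mem_of_mem (Ideal.homogeneousCore _ Q).isHomogeneous (h3 hp) 0
  have h5 := Ideal.toIdeal_homogeneousCore_le _ _ h4
  rw [mem_mI]
  by_contra hne
  rw [homogeneousComponent_zero] at hne h5
  have : IsUnit (MvPolynomial.C (coeff 0 p) : PS K r) := by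
    apply IsUnit.map
    rw [isUnit_iff_ne_zero]
    rintro h; rw [h] at hne; exact hne (map_zero _)
  exact hQp.ne_top (Ideal.eq_top_of_isUnit_mem _ h5 this)

/-- chain argument -/
lemma chain_height {I : Ideal (PS K r)} {w : ℕ → PS K r} {N : ℕ} 
    (hw : ∀ i < N, ∀ Q ∈ (Jy I w i).minimalPrimes, ¬ mI K r ≤ Q → w i ∉ Q) : 
    ∀ n ≤ N, ∀ Q : PrimeSpectrum.zeroLocus (R := PS K r) I, Jy I w n ≤ Q.1.asIdeal → ¬ mI K r ≤ Q.1.asIdeal → 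
    (n : ℕ∞) ≤ Order.height Q := by
  intro n
  induction n with
  | zero => intro _ Q _ _; simp
  | succ n ih => 
    intro hn Q hQ hm
    obtain ⟨Q', hQ'1, hQ'2⟩ := Ideal.exists_minimalPrimes_le ((Jy_mono I w (Nat.le_succ n)).trans hQ)
    let q : PrimeSpectrum.zeroLocus (R := PS K r) I := ⟨⟨Q', hQ'1.1.1⟩, by
      rw [PrimeSpectrum.mem_zeroLocus]
      exact (le_sup_left (a := I)).trans hQ'1.1.2⟩
    have hm' : ¬ mI K r ≤ Q' := fun h => hm (h.trans hQ'2)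
    have h1 := ih (by omega) q hQ'1.1.2 hm'
    have hlt : q < Q := by
      refine lt_of_le_of_ne hQ'2 ?_
      rintro rfl
      exact hw n (by omega) Q' hQ'1 hm' (hQ (le_sup_right (a := I) (mem_Yy w (Nat.lt_succ_self n))))
    push_cast
    exact (add_le_add_left h1 1).trans (Order.height_add_one_le hlt)

lemma pow_le_of_greedy {I : Ideal (PS K r)} (hI : HI I) {d : ℕ} (hdim : AMD.DimEq K r I d) {w : ℕ → PS K r} 
    (hwh : ∀ i < d + 1, (w i).IsHomogeneous 1)
    (hw : ∀ i < d + 1, ∀ Q ∈ (Jy I w i).minimalPrimes, ¬ mI K r ≤ Q → w i ∉ Q) : ∃ N, mI K r ^ N ≤ Jy I w (d+1) := by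
  apply Ideal.exists_pow_le_of_le_radical_of_fg _ (IsNoetherian.noetherian _)
  rw [← Ideal.sInf_minimalPrimes]
  refine le_sInf fun Q hQ => ?_
  by_contra hm
  have hle := minPrime_le_mI (hI.Jy hwh (d+1) le_rfl) hQ
  have hIQ : I ≤ Q := (le_sup_left (a := I)).trans hQ.1.2
  let q : PrimeSpectrum.zeroLocus (R := PS K r) I := ⟨⟨Q, hQ.1.1⟩, by rw [PrimeSpectrum.mem_zeroLocus]; exact hIQ⟩
  let q' : PrimeSpectrum.zeroLocus (R := PS K r) I := ⟨⟨mI K r, mI_prime⟩, by 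
    rw [PrimeSpectrum.mem_zeroLocus]; exact hIQ.trans hle⟩
  have h1 := chain_height hw (d+1) le_rfl q hQ.1.2 hm
  have hlt : q < q' := by
    refine lt_of_le_of_ne hle ?_
    intro h
    apply hm
    have : q.1.asIdeal = q'.1.asIdeal := by rw [h]
    exact this.ge
  have h2 := (add_le_add_left h1 1).trans (Order.height_add_one_le hlt)
  have h3 := Order.height_le_krullDim q'
  rw [← ringKrullDim_quotient, hdim] at h3
  have h4 := h2.trans (WithBot.coe_le_coe.mp h3)
  have : ((d + 1 + 1 : ℕ) : ℕ∞) ≤ ((d + 1 : ℕ) : ℕ∞) := by exact_mod_cast h4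
  have := Nat.cast_le.mp this
  omega

theorem exists_w [Infinite K] {I : Ideal (PS K r)} (hI : HI I) {d : ℕ} (hdim : AMD.DimEq K r I d) 
    {F Ω : Type} [Field F] [Algebra K F] [AddCommGroup Ω] [Module K Ω] [Module F Ω] [IsScalarTower K F Ω] 
    (δ : PS K r →ₗ[K] Ω) : ∃ w : ℕ → PS K r, (∀ i < d + 1, (w i).IsHomogeneous 1) ∧ (∃ N, mI K r ^ N ≤ Jy I w (d+1)) ∧ 
    (LinearIndependent F (fun i : Fin (d+1) => δ (w i)) ∨ 
      ∀ ℓ : PS K r, ℓ.IsHomogeneous 1 → δ ℓ ∈ Submodule.span F ((fun i => δ (w i)) '' Set.Iio (d+1))) := by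
  obtain ⟨w, hw⟩ := greedy (d+1) (fun i w => (w i).IsHomogeneous 1 ∧ (∀ Q ∈ (Jy I w i).minimalPrimes, ¬ mI K r ≤ Q → w i ∉ Q) ∧ 
    (δ (w i) ∈ Submodule.span F ((fun i => δ (w i)) '' Set.Iio i) → 
      ∀ ℓ : PS K r, ℓ.IsHomogeneous 1 → δ ℓ ∈ Submodule.span F ((fun i => δ (w i)) '' Set.Iio i))) (by
      intro i w w' h ⟨h1, h2, h3⟩
      have e1 : Jy I w i = Jy I w' i := Jy_congr fun j hj => h j hj.le
      have e2 : (fun i => δ (w i)) '' Set.Iio i = (fun i => δ (w' i)) '' Set.Iio i := by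
        apply Set.image_congr
        intro j hj
        rw [h j (le_of_lt hj)]
      rw [h i le_rfl] at h1 h2 h3
      rw [e1] at h2
      rw [e2] at h3
      exact ⟨h1, h2, h3⟩) (by
      intro n hn w hw
      let J := Jy I w n
      let T := {Q ∈ J.minimalPrimes | ¬ mI K r ≤ Q}
      have hT : T.Finite := (Ideal.finite_minimalPrimes_of_isNoetherianRing _ J).subset (Set.sep_subset _ _)
      have : Finite T := hT
      let V : Submodule K (PS K r) := 
        ((Submodule.span F ((fun i => δ (w i)) '' Set.Iio n)).restrictScalars K).comap δ
      have hstep : ∃ a ∈ homogeneousSubmodule (Fin (r+1)) K 1, (∀ Q ∈ T, a ∉ Q) ∧ 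
          (a ∈ V → homogeneousSubmodule (Fin (r+1)) K 1 ≤ V) := by
        by_cases hV : homogeneousSubmodule (Fin (r+1)) K 1 ≤ V
        · obtain ⟨a, ha, hq⟩ := avoid (homogeneousSubmodule (Fin (r+1)) K 1) (fun Q : T => (Q : Ideal (PS K r)).restrictScalars K)
            (fun Q h => Q.2.2 (mI_le h))
          exact ⟨a, ha, fun Q hQ => hq ⟨Q, hQ⟩, fun _ => hV⟩
        · obtain ⟨a, ha, hq⟩ := avoid (homogeneousSubmodule (Fin (r+1)) K 1) 
            (fun Q : Option T => Q.elim V (fun Q => (Q : Ideal (PS K r)).restrictScalars K))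
            (by
              rintro (_ | Q) h
              · exact hV h
              · exact Q.2.2 (mI_le h))
          exact ⟨a, ha, fun Q hQ => hq (some ⟨Q, hQ⟩), fun h => absurd h (hq none)⟩
      obtain ⟨a, ha1, ha2, ha3⟩ := hstep
      have e1 : Jy I (Function.update w n a) n = Jy I w n := Jy_congr fun j hj => by 
        rw [Function.update_of_ne (by omega)]
      have e2 : (fun i => δ (Function.update w n a i)) '' Set.Iio n = (fun i => δ (w i)) '' Set.Iio n := by
        apply Set.image_congr
        intro j hj
        have : j ≠ n := by rw [Set.mem_Iio] at hj; omega
        rw [Function.update_of_ne this]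
      refine ⟨a, ?_⟩
      simp only [e1, e2, Function.update_self]
      exact ⟨ha1, fun Q hQ hm => ha2 Q ⟨hQ, hm⟩, fun h ℓ hℓ => ha3 h hℓ⟩)
  have hwh : ∀ i < d + 1, (w i).IsHomogeneous 1 := fun i hi => (hw i hi).1
  refine ⟨w, hwh, pow_le_of_greedy hI hdim hwh fun i hi => (hw i hi).2.1, ?_⟩
  rw [or_iff_not_imp_right]
  intro hcon
  have hli : ∀ n ≤ d + 1, LinearIndependent F (fun i : Fin n => δ (w i)) := by
    intro n
    induction n with
    | zero => intro _; exact linearIndependent_empty_type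
    | succ n ih => 
      intro hn
      rw [linearIndependent_finSucc']
      refine ⟨ih (by omega), ?_⟩
      have e : Set.range (Fin.init fun i : Fin (n+1) => δ (w i)) = (fun i => δ (w i)) '' Set.Iio n := by
        ext v
        constructor
        · rintro ⟨i, rfl⟩; exact ⟨i, i.2, rfl⟩
        · rintro ⟨i, hi, rfl⟩; exact ⟨⟨i, hi⟩, rfl⟩
      rw [e]
      intro h
      apply hcon
      intro ℓ hℓ
      exact Submodule.span_mono (Set.image_mono (Set.Iio_subset_Iio (by omega))) ((hw n (by omega)).2.2 h ℓ hℓ)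
  exact hli _ le_rfl

end WSel
end QC

namespace QC

section Noeth
variable {K : Type} [Field K] {r : ℕ} {I : Ideal (PS K r)} {d : ℕ} {w : ℕ → PS K r}

lemma Jy_homog_decomp (hI : HI I) (wh : ∀ i < d, (w i).IsHomogeneous 1) (n : ℕ) : ∀ j ≤ d, ∀ p ∈ Jy I w j, p.IsHomogeneous (n+1) → 
    ∃ a ∈ I, ∃ g : ℕ → PS K r, (∀ i, (g i).IsHomogeneous n) ∧ p = a + ∑ i ∈ Finset.range j, w i * g i := by
  intro j
  induction j with
  | zero => intro _ p hp _; rw [Jy_zero] at hp; exact ⟨p, hp, 0, fun i => isHomogeneous_zero _ _ _, by simp⟩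
  | succ j ih => 
    intro hj p hp hpn
    rw [Jy_succ] at hp
    obtain ⟨q, hq, hqh, b, hb, rfl⟩ := (hI.Jy wh j (by omega)).decomp (wh j (by omega)) hpn hp
    obtain ⟨a, ha, g, hg, rfl⟩ := ih (by omega) q hq hqh
    refine ⟨a, ha, Function.update g j b, fun i => ?_, ?_⟩
    · by_cases h : i = j
      · subst h; rwa [Function.update_self]
      · rw [Function.update_of_ne h]; exact hg i
    · rw [Finset.sum_range_succ, Function.update_self, add_assoc]
      congr 2
      refine Finset.sum_congr rfl fun i hi => ?_
      rw [Function.update_of_ne (by have := Finset.mem_range.mp hi; omega)]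

lemma homog_mem_pow {N n : ℕ} (h : N ≤ n) {p : PS K r} (hp : p.IsHomogeneous n) : p ∈ mI K r ^ N := by
  have : mI K r = idealOfVars (Fin (r+1)) K := rfl
  rw [this, mem_pow_idealOfVars_iff]
  intro m hm
  have := hp (mem_support_iff.mp hm)
  rw [Finsupp.degree_eq_weight_one]
  exact h.trans this.ge

/-- the map from the polynomial ring in the `w`'s -/
def θw (w : ℕ → PS K r) (n : ℕ) : MvPolynomial (Fin n) K →ₐ[K] PS K r := aeval (fun i : Fin n => w i)

lemma wfin (hI : HI I) {n : ℕ} {A : Type} [CommRing A] [Algebra K A] [Algebra (MvPolynomial (Fin n) K) A] 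
    {π : PS K r →ₐ[K] A} (hπ : Function.Surjective π) (hk : ∀ p, π p = 0 ↔ p ∈ I) 
    (hP : ∀ q, algebraMap (MvPolynomial (Fin n) K) A q = π (θw w n q))
    (wh : ∀ i < n, (w i).IsHomogeneous 1) {N : ℕ} (hN : mI K r ^ N ≤ Jy I w n) : 
    Module.Finite (MvPolynomial (Fin n) K) A := by
  have hsm : ∀ (q : MvPolynomial (Fin n) K) (s : PS K r), q • (π s) = π (θw w n q * s) := by
    intro q s
    rw [Algebra.smul_def, map_mul, hP]
  let L : Submodule K (PS K r) := ⨆ i : Fin N, homogeneousSubmodule (Fin (r+1)) K i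
  have hL : L.FG := Submodule.fg_iSup _ fun i => by
    have h1 := H_fd (K := K) (r := r) i
    have h2 : homogeneousSubmodule (Fin (r+1)) K i = (GrS K r).H i := by
      ext p; rw [GrS_mem]; rfl
    rw [h2]
    exact (Submodule.fg_iff_finiteDimensional _).mpr h1
  obtain ⟨G, hG⟩ := hL
  let M : Submodule (MvPolynomial (Fin n) K) A := Submodule.span _ (π '' (G : Set (PS K r)))
  have hM1 : ∀ p ∈ L, π p ∈ M := by
    intro p hp
    rw [← hG] at hp
    induction hp using Submodule.span_induction with
    | mem x h => exact Submodule.subset_span ⟨x, h, rfl⟩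
    | zero => rw [map_zero]; exact M.zero_mem
    | add x y _ _ hx hy => rw [map_add]; exact M.add_mem hx hy
    | smul a x _ hx => 
      have : π (a • x) = (MvPolynomial.C a : MvPolynomial (Fin n) K) • π x := by
        rw [hsm]
        simp [θw, algebraMap_eq, smul_eq_C_mul]
      rw [this]
      exact M.smul_mem _ hx
  have hM2 : ∀ m, ∀ p : PS K r, p.IsHomogeneous m → π p ∈ M := by
    intro m
    induction m with
    | zero => 
      intro p hp
      by_cases h : 0 < N
      · exact hM1 p (Submodule.mem_iSup_of_mem (⟨0, h⟩ : Fin N) hp)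
      · have hN0 : N = 0 := by omega
        subst hN0
        have h1 : p ∈ Jy I w n := hN (by simp)
        by_cases hp0 : π p = 0
        · rw [hp0]; exact M.zero_mem
        · exfalso
          rw [pow_zero, Ideal.one_eq_top, top_le_iff] at hN
          apply hp0
          have h2 := (Ideal.eq_top_iff_one _).mp hN
          rw [Jy_eq] at h2
          obtain ⟨a, ha, b, hb, hab⟩ := Submodule.mem_sup.mp h2
          have hb0 : homogeneousComponent 0 b = 0 := by
            have : Yy w n ≤ mI K r := by
              rw [Yy, Ideal.span_le]
              rintro _ ⟨i, hi, rfl⟩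
              exact lin_mem_mI (wh i hi)
            exact mem_mI.mp (this hb)
          have h3 : homogeneousComponent 0 a = 1 := by
            have := congrArg (homogeneousComponent 0) hab
            rw [map_add, hb0, add_zero] at this
            rw [this]
            exact homogeneousComponent_eq_self (isHomogeneous_one _ _)
          have h4 := hI a ha 0
          rw [h3] at h4
          rw [hk, (Ideal.eq_top_iff_one I).mpr h4]
          trivial
    | succ m ih => 
      intro p hp
      by_cases h : m + 1 < N
      · exact hM1 p (Submodule.mem_iSup_of_mem (⟨m+1, h⟩ : Fin N) hp)
      · obtain ⟨a, ha, g, hg, rfl⟩ := Jy_homog_decomp hI wh m n le_rfl p (hN (homog_mem_pow (by omega) hp)) hp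
        rw [map_add, (hk _).mpr ha, zero_add, map_sum]
        refine Submodule.sum_mem _ fun i hi => ?_
        have := M.smul_mem (X ⟨i, Finset.mem_range.mp hi⟩) (ih (g i) (hg i))
        rw [hsm] at this
        simpa [θw] using this
  have hM : M = ⊤ := by
    rw [eq_top_iff]
    intro x _
    obtain ⟨p, rfl⟩ := hπ x
    rw [← sum_homogeneousComponent p, map_sum]
    exact Submodule.sum_mem _ fun i _ => hM2 i _ (homogeneousComponent_isHomogeneous i p)
  constructor
  rw [← hM]
  exact ⟨(G.finite_toSet.image π).toFinset, by simp [M]⟩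

lemma integral_dim_le {R A : Type} [CommRing R] [CommRing A] [Algebra R A] [Algebra.IsIntegral R A] : ringKrullDim A ≤ ringKrullDim R := by
  refine Order.krullDim_le_of_strictMono (fun q : PrimeSpectrum A => PrimeSpectrum.comap (algebraMap R A) q) ?_
  intro q q' h
  have hle : q.asIdeal ≤ q'.asIdeal := h.le
  have hne : ¬ q'.asIdeal ≤ q.asIdeal := fun h' => h.not_ge h'
  obtain ⟨x, hx1, hx2⟩ := Set.not_subset.mp hne
  exact Ideal.comap_lt_comap_of_integral_mem_sdiff hle ⟨hx1, hx2⟩ (Algebra.IsIntegral.isIntegral (R := R) x)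

lemma winj {n : ℕ} {A : Type} [CommRing A] [Algebra (MvPolynomial (Fin n) K) A] [Module.Finite (MvPolynomial (Fin n) K) A] 
    (hdim : ringKrullDim A = ((n : ℕ∞) : WithBot ℕ∞)) : Function.Injective (algebraMap (MvPolynomial (Fin n) K) A) := by
  rw [injective_iff_map_eq_zero]
  intro p hp
  by_contra hne
  let ψ' : (MvPolynomial (Fin n) K ⧸ Ideal.span {p}) →+* A := Ideal.Quotient.lift _ (algebraMap (MvPolynomial (Fin n) K) A) (by
    intro a ha
    obtain ⟨b, rfl⟩ := Ideal.mem_span_singleton'.mp ha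
    rw [map_mul, hp, mul_zero])
  have hfin' : ψ'.Finite := by
    apply RingHom.Finite.of_comp_finite (f := Ideal.Quotient.mk (Ideal.span {p}))
    rw [Ideal.Quotient.lift_comp_mk]
    exact RingHom.finite_algebraMap.mpr inferInstance
  algebraize [ψ']
  have h1 := integral_dim_le (R := MvPolynomial (Fin n) K ⧸ Ideal.span {p}) (A := A)
  have h2 := ringKrullDim_quotient_succ_le_of_nonZeroDivisor (mem_nonZeroDivisors_of_ne_zero hne)
  rw [MvPolynomial.ringKrullDim_of_isNoetherianRing, ringKrullDim_eq_zero_of_field, zero_add, Nat.card_fin] at h2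
  rw [hdim] at h1
  have h3 := (add_le_add_left h1 1).trans h2
  have h4 : (((n + 1 : ℕ) : ℕ∞) : WithBot ℕ∞) ≤ ((n : ℕ∞) : WithBot ℕ∞) := by
    convert h3 using 1 <;> push_cast <;> rfl
  have h4 := Nat.cast_le.mp (WithBot.coe_le_coe.mp h4)
  omega

end Noeth
end QC

namespace QC

section Sepw
variable {K F : Type} [Field K] [Field F] [Algebra K F]

lemma D_mem_of_adjoin (s : Set F) (M : Submodule F (Ω[F⁄K])) (hs : ∀ x ∈ s, KaehlerDifferential.D K F x ∈ M) :
    ∀ x ∈ IntermediateField.adjoin K s, KaehlerDifferential.D K F x ∈ M := by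
  intro x hx
  induction hx using IntermediateField.adjoin_induction with
  | mem x h => exact hs x h
  | algebraMap x => rw [Derivation.map_algebraMap]; exact M.zero_mem
  | add x y _ _ hx hy => rw [map_add]; exact M.add_mem hx hy
  | inv x _ hx => rw [Derivation.leibniz_inv]; exact M.smul_mem _ hx
  | mul x y _ _ hx hy => rw [Derivation.leibniz]; exact M.add_mem (M.smul_mem _ hy) (M.smul_mem _ hx)

lemma map_mem_of {E : Type} [Field E] [Algebra K E] [Algebra E F] [IsScalarTower K E F] (M : Submodule F (Ω[F⁄K]))
    (hM : ∀ e : E, KaehlerDifferential.D K F (algebraMap E F e) ∈ M) (ξ : Ω[E⁄K]) : 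
    KaehlerDifferential.map K K E F ξ ∈ M := by
  have : ξ ∈ Submodule.span E (Set.range (KaehlerDifferential.D K E)) := by
    rw [KaehlerDifferential.span_range_derivation]; trivial
  induction this using Submodule.span_induction with
  | mem x h =>
    obtain ⟨e, rfl⟩ := h
    rw [KaehlerDifferential.map_D]
    exact hM e
  | zero => rw [map_zero]; exact Submodule.zero_mem _
  | add x y _ _ hx hy => rw [map_add]; exact Submodule.add_mem _ hx hy
  | smul a x _ hx => 
    rw [LinearMap.map_smul, ← algebraMap_smul F a]
    exact Submodule.smul_mem _ _ hx

lemma span_of_sep (s : Set F) [Algebra.IsSeparable (IntermediateField.adjoin K s) F] :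
    Submodule.span F (KaehlerDifferential.D K F '' s) = ⊤ := by
  have h0 : Algebra.FormallyUnramified (IntermediateField.adjoin K s) F := Algebra.FormallyUnramified.of_isSeparable _ _
  have h1 : Subsingleton (Ω[F⁄(IntermediateField.adjoin K s)]) := h0.1
  rw [eq_top_iff]
  intro ω _
  have h2 := (KaehlerDifferential.exact_mapBaseChange_map K (IntermediateField.adjoin K s) F ω).mp (Subsingleton.elim _ _)
  obtain ⟨x, rfl⟩ := h2
  induction x with
  | zero => rw [map_zero]; exact Submodule.zero_mem _
  | add x y hx hy => rw [map_add]; exact Submodule.add_mem _ (hx trivial) (hy trivial)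
  | tmul a ξ =>
    rw [KaehlerDifferential.mapBaseChange_tmul]
    apply Submodule.smul_mem
    exact map_mem_of _ (fun e => D_mem_of_adjoin s _ (fun x hx => Submodule.subset_span (Set.mem_image_of_mem _ hx)) _ e.2) ξ

lemma sep_of_span [Algebra.EssFiniteType K F] (s : Set F) (h : Submodule.span F (KaehlerDifferential.D K F '' s) = ⊤) :
    Algebra.IsSeparable (IntermediateField.adjoin K s) F := by
  have h0 : Subsingleton (Ω[F⁄(IntermediateField.adjoin K s)]) := by
    refine subsingleton_of_forall_eq 0 fun ω => ?_
    obtain ⟨ξ, rfl⟩ := KaehlerDifferential.map_surjective K (IntermediateField.adjoin K s) F ω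
    have : ξ ∈ Submodule.span F (KaehlerDifferential.D K F '' s) := by rw [h]; trivial
    induction this using Submodule.span_induction with
    | mem x hx =>
      obtain ⟨e, he, rfl⟩ := hx
      rw [KaehlerDifferential.map_D]
      exact Derivation.map_algebraMap _ (⟨e, IntermediateField.subset_adjoin K s he⟩ : IntermediateField.adjoin K s)
    | zero => rw [map_zero]
    | add x y _ _ hx hy => rw [map_add, hx, hy, add_zero]
    | smul a x _ hx => rw [LinearMap.map_smul, hx, smul_zero]
  have h1 : Algebra.FormallyUnramified (IntermediateField.adjoin K s) F := ⟨h0⟩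
  have h2 : Algebra.EssFiniteType (IntermediateField.adjoin K s) F := Algebra.EssFiniteType.of_comp K _ F
  exact Algebra.FormallyUnramified.isSeparable _ _

lemma sep_of_or [PerfectField K] [Algebra.EssFiniteType K F] {n : ℕ} (v : Fin n → F) (hv : IsTranscendenceBasis K v)
    (G : Set F) (hG : ∀ M : Submodule F (Ω[F⁄K]), (∀ x ∈ G, KaehlerDifferential.D K F x ∈ M) → ∀ x, KaehlerDifferential.D K F x ∈ M)
    (h : LinearIndependent F (fun i => KaehlerDifferential.D K F (v i)) ∨ 
      ∀ g ∈ G, KaehlerDifferential.D K F g ∈ Submodule.span F (KaehlerDifferential.D K F '' Set.range v)) :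
    Algebra.IsSeparable (IntermediateField.adjoin K (Set.range v)) F := by
  apply sep_of_span
  rcases h with h | h
  · obtain ⟨s, hs, hsep⟩ := exists_isTranscendenceBasis_and_isSeparable_of_perfectField K F
    have h1 := span_of_sep (K := K) (s : Set F)
    have h2 : s.card = n := by
      have := hv.cardinalMk_eq hs
      simpa using this.symm
    classical
    have h3 : ((s.image (KaehlerDifferential.D K F) : Finset _) : Set (Ω[F⁄K])) = KaehlerDifferential.D K F '' s := by simp
    have hfd : Module.Finite F (Ω[F⁄K]) := ⟨⟨s.image (KaehlerDifferential.D K F), by rw [h3, h1]⟩⟩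
    have h4 : Module.finrank F (Ω[F⁄K]) ≤ n := by
      have := finrank_span_finset_le_card (R := F) (s.image (KaehlerDifferential.D K F))
      rw [Set.finrank, h3, h1, finrank_top] at this
      exact this.trans (Finset.card_image_le.trans h2.le)
    have h5 := h.span_eq_top_of_card_eq_finrank' (by
      have := h.fintype_card_le_finrank
      simp at this ⊢; omega)
    rw [← h5, ← Set.range_comp]; rfl
  · rw [eq_top_iff, ← KaehlerDifferential.span_range_derivation, Submodule.span_le]
    rintro _ ⟨x, rfl⟩
    exact hG _ h x

end Sepw
end QC

namespace QC

section Prim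
open Polynomial in
/-- clearing denominators -/
lemma clear_den {P L : Type} [CommRing P] [IsDomain P] [Field L] [Algebra P L] [IsFractionRing P L] (q : Polynomial L) :
    ∃ b : P, b ≠ 0 ∧ ∃ q' : Polynomial P, q'.map (algebraMap P L) = Polynomial.C (algebraMap P L b) * q := by
  obtain ⟨b, hbm, hb⟩ := IsLocalization.integerNormalization_spec (nonZeroDivisors P) q
  refine ⟨b, nonZeroDivisors.ne_zero hbm, _, hb.trans ?_⟩
  rw [← Polynomial.smul_eq_C_mul, algebraMap_smul]

lemma exists_mul_mem {P A : Type} [CommRing P] [IsDomain P] [CommRing A] [IsDomain A] [Algebra P A] [Algebra.IsIntegral P A] 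
    (x : A) (hx : x ≠ 0) : ∃ p : P, p ≠ 0 ∧ ∃ c, x * c = algebraMap P A p := by
  have h := Ideal.comap_ne_bot_of_integral_mem hx (Ideal.mem_span_singleton_self x) (Algebra.IsIntegral.isIntegral (R := P) x)
  obtain ⟨p, hp, h0⟩ := Submodule.exists_mem_ne_zero_of_ne_bot h
  obtain ⟨c, hc⟩ := Ideal.mem_span_singleton'.mp (Ideal.mem_comap.mp hp)
  exact ⟨p, h0, c, by rw [← hc, mul_comm]⟩

lemma prim_exists {P A L F : Type} [CommRing P] [IsDomain P] [IsIntegrallyClosed P] [CommRing A] [IsDomain A] [Algebra P A]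
    [Module.Finite P A] [FaithfulSMul P A] [Field L] [Field F] [Algebra P L] [IsFractionRing P L] [Algebra A F] [IsFractionRing A F]
    [Algebra L F] [Algebra P F] [IsScalarTower P L F] [IsScalarTower P A F] [Algebra.IsSeparable L F] [FiniteDimensional L F] :
    ∃ (a : A) (f α β : Polynomial P) (g D : P), f.Monic ∧ Polynomial.aeval a f = 0 ∧ 
      (∀ q : Polynomial P, Polynomial.aeval a q = 0 → f ∣ q) ∧ g ≠ 0 ∧ 
      (∀ x : A, ∃ q : Polynomial P, g • x = Polynomial.aeval a q) ∧ D ≠ 0 ∧ 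
      α * f + β * Polynomial.derivative f = Polynomial.C D := by
  have hInt : Algebra.IsIntegral P A := inferInstance
  have hPL : Function.Injective (algebraMap P L) := IsFractionRing.injective P L
  have hAF : Function.Injective (algebraMap A F) := IsFractionRing.injective A F
  obtain ⟨z, hz⟩ := Field.exists_primitive_element L F
  obtain ⟨a, b, hb, hab⟩ := IsFractionRing.div_surjective (A := A) z
  obtain ⟨p, hp, c, hc⟩ := exists_mul_mem (P := P) b (nonZeroDivisors.ne_zero hb)
  have hb0 : algebraMap A F b ≠ 0 := (map_ne_zero_iff _ hAF).mpr (nonZeroDivisors.ne_zero hb)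
  have hpL : algebraMap P L p ≠ 0 := (map_ne_zero_iff _ hPL).mpr hp
  have hz2 : algebraMap A F (a * c) = algebraMap L F (algebraMap P L p) * z := by
    rw [← IsScalarTower.algebraMap_apply P L F, IsScalarTower.algebraMap_apply P A F, ← hc, ← hab, map_mul, map_mul]
    field_simp
  obtain ⟨e, he⟩ : ∃ e, e = a * c := ⟨_, rfl⟩
  rw [← he] at hz2
  have htop : IntermediateField.adjoin L {algebraMap A F e} = ⊤ := by
    rw [eq_top_iff, ← hz]
    apply IntermediateField.adjoin_le_iff.mpr
    refine Set.singleton_subset_iff.mpr ?_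
    have h1 : z = (algebraMap L F (algebraMap P L p))⁻¹ * algebraMap A F e := by
      rw [hz2, inv_mul_cancel_left₀]; exact (map_ne_zero _).mpr hpL
    have h2 : algebraMap A F e ∈ IntermediateField.adjoin L {algebraMap A F e} := IntermediateField.mem_adjoin_simple_self L _
    rw [SetLike.mem_coe, h1]
    exact mul_mem (inv_mem (IntermediateField.algebraMap_mem _ _)) h2
  have hei : IsIntegral P e := Algebra.IsIntegral.isIntegral e
  have hmin : minpoly L (algebraMap A F e) = (minpoly P e).map (algebraMap P L) := by
    rw [minpoly.isIntegrallyClosed_eq_field_fractions' L (hei.algebraMap), minpoly.algebraMap_eq hAF]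
  have hmem : ∀ x : A, ∃ g : P, g ≠ 0 ∧ ∃ q : Polynomial P, g • x = Polynomial.aeval e q := by
    intro x
    have h1 : algebraMap A F x ∈ IntermediateField.adjoin L {algebraMap A F e} := by rw [htop]; trivial
    have h1 : algebraMap A F x ∈ (IntermediateField.adjoin L {algebraMap A F e}).toSubalgebra := by rw [htop]; trivial
    rw [IntermediateField.adjoin_simple_toSubalgebra_of_isAlgebraic (Algebra.IsAlgebraic.isAlgebraic _), 
      Algebra.adjoin_singleton_eq_range_aeval] at h1
    obtain ⟨q, hq⟩ := h1
    obtain ⟨g, hg, q', hq'⟩ := clear_den (P := P) q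
    refine ⟨g, hg, q', hAF ?_⟩
    have h3 : algebraMap A F (Polynomial.aeval e q') = Polynomial.aeval (algebraMap A F e) (q'.map (algebraMap P L)) := by
      rw [Polynomial.aeval_map_algebraMap, Polynomial.aeval_algebraMap_apply]
    rw [h3, hq', map_mul, Polynomial.aeval_C, ← IsScalarTower.algebraMap_apply P L F, Algebra.smul_def, map_mul, 
      ← IsScalarTower.algebraMap_apply P A F]
    congr 1
    exact hq.symm
  have hg : ∃ g : P, g ≠ 0 ∧ ∀ x : A, ∃ q : Polynomial P, g • x = Polynomial.aeval e q := by
    obtain ⟨G, hG⟩ := ‹Module.Finite P A›.fg_top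
    choose gg hgg qq hqq using hmem
    refine ⟨∏ x ∈ G, gg x, Finset.prod_ne_zero_iff.mpr fun x _ => hgg x, fun x => ?_⟩
    have hx : x ∈ Submodule.span P (G : Set A) := by rw [hG]; trivial
    induction hx using Submodule.span_induction with
    | mem x h =>
      classical
      rw [← Finset.prod_erase_mul _ _ (Finset.mem_coe.mp h), mul_smul, hqq x]
      refine ⟨Polynomial.C (∏ x ∈ G.erase x, gg x) * qq x, ?_⟩
      rw [map_mul, Polynomial.aeval_C, Algebra.smul_def]
    | zero => exact ⟨0, by simp⟩
    | add x y _ _ hx hy => 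
      obtain ⟨p, hp⟩ := hx
      obtain ⟨q, hq⟩ := hy
      exact ⟨p + q, by rw [smul_add, hp, hq, map_add]⟩
    | smul t x _ hx => 
      obtain ⟨p, hp⟩ := hx
      exact ⟨Polynomial.C t * p, by rw [smul_comm, hp, map_mul, Polynomial.aeval_C, Algebra.smul_def]⟩
  obtain ⟨g, hg0, hg⟩ := hg
  have hsep : (minpoly L (algebraMap A F e)).Separable := Algebra.IsSeparable.isSeparable L _
  obtain ⟨α, β, hαβ⟩ := hsep
  obtain ⟨b1, hb1, α', hα'⟩ := clear_den (P := P) α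
  obtain ⟨b2, hb2, β', hβ'⟩ := clear_den (P := P) β
  refine ⟨e, minpoly P e, Polynomial.C b2 * α', Polynomial.C b1 * β', g, b1 * b2, minpoly.monic hei, minpoly.aeval P e, 
    fun q hq => minpoly.isIntegrallyClosed_dvd hei hq, hg0, hg, mul_ne_zero hb1 hb2, ?_⟩
  apply Polynomial.map_injective _ hPL
  rw [Polynomial.map_add, Polynomial.map_mul, Polynomial.map_mul, Polynomial.map_mul, Polynomial.map_mul, hα', hβ', 
    ← Polynomial.derivative_map, ← hmin, Polynomial.map_C, Polynomial.map_C, Polynomial.map_C, map_mul (algebraMap P L), Polynomial.C_mul]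
  linear_combination Polynomial.C (algebraMap P L b1) * Polynomial.C (algebraMap P L b2) * hαβ
end Prim
end QC

namespace QC

section Prm

lemma sep_L {K F L : Type} [Field K] [Field F] [Field L] [Algebra K F] [Algebra K L] [Algebra L F] [IsScalarTower K L F]
    (s : Set F) (hs : ∀ x ∈ s, ∃ l, algebraMap L F l = x) [Algebra.IsSeparable (IntermediateField.adjoin K s) F] : 
    Algebra.IsSeparable L F := by
  let φ : L →ₐ[K] F := IsScalarTower.toAlgHom K L F
  have hle : IntermediateField.adjoin K s ≤ φ.fieldRange := by
    rw [IntermediateField.adjoin_le_iff]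
    intro x hx
    exact hs x hx
  let e : L ≃ₐ[K] φ.fieldRange := AlgEquiv.ofInjectiveField φ
  let ι : IntermediateField.adjoin K s →+* L := (e.symm : φ.fieldRange →+* L).comp (IntermediateField.inclusion hle : IntermediateField.adjoin K s →+* φ.fieldRange)
  algebraize [ι]
  have ht : IsScalarTower (IntermediateField.adjoin K s) L F := by
    refine IsScalarTower.of_algebraMap_eq fun x => ?_
    have h1 : algebraMap L F (e.symm (IntermediateField.inclusion hle x)) = 
      ((e (e.symm (IntermediateField.inclusion hle x)) : φ.fieldRange) : F) := rfl
    change _ = algebraMap L F (e.symm (IntermediateField.inclusion hle x))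
    rw [h1, e.apply_symm_apply]; rfl
  exact Algebra.isSeparable_tower_top_of_isSeparable (IntermediateField.adjoin K s) L F

variable {K : Type} [Field K] {r : ℕ} {I : Ideal (PS K r)} {n : ℕ} {w : ℕ → PS K r}

/-- the primitive element data -/
structure Prm (I : Ideal (PS K r)) (w : ℕ → PS K r) (n : ℕ) (a : PS K r) (f α β : Polynomial (MvPolynomial (Fin n) K))
    (g D : MvPolynomial (Fin n) K) : Prop where
  monic : f.Monic
  fa : Polynomial.eval₂ (θw w n : MvPolynomial (Fin n) K →+* PS K r) a f ∈ I
  dvd : ∀ q, Polynomial.eval₂ (θw w n : MvPolynomial (Fin n) K →+* PS K r) a q ∈ I → f ∣ q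
  g0 : g ≠ 0
  hg : ∀ x, ∃ q, θw w n g * x - Polynomial.eval₂ (θw w n : MvPolynomial (Fin n) K →+* PS K r) a q ∈ I
  D0 : D ≠ 0
  sep : α * f + β * Polynomial.derivative f = Polynomial.C D
  mul : ∀ x, x ∉ I → ∃ p, p ≠ 0 ∧ ∃ c, x * c - θw w n p ∈ I

lemma frac_tower {K P A : Type} [Field K] [CommRing P] [IsDomain P] [Algebra K P] [CommRing A] [IsDomain A] [Algebra K A]
    [Algebra P A] [IsScalarTower K P A] [FaithfulSMul P A] [Module.Finite P A] : 
    ∃ (L : Type) (_ : Field L) (_ : Algebra P L) (_ : IsFractionRing P L) (_ : Algebra L (FractionRing A)) (_ : Algebra K L), 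
      IsScalarTower P L (FractionRing A) ∧ IsScalarTower K L (FractionRing A) ∧ FiniteDimensional L (FractionRing A) := by
  have hinj : Function.Injective (algebraMap P A) := FaithfulSMul.algebraMap_injective _ _
  have hfaith : FaithfulSMul P (FractionRing A) := by
    rw [faithfulSMul_iff_algebraMap_injective, IsScalarTower.algebraMap_eq P A (FractionRing A)]
    exact (IsFractionRing.injective A (FractionRing A)).comp hinj
  let i1 : Algebra (FractionRing P) (FractionRing A) := FractionRing.liftAlgebra P (FractionRing A)
  have ht2 : IsScalarTower P (FractionRing P) (FractionRing A) := FractionRing.isScalarTower_liftAlgebra _ _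
  refine ⟨FractionRing P, inferInstance, inferInstance, inferInstance, i1, inferInstance, ht2, ?_, ?_⟩
  · refine IsScalarTower.of_algebraMap_eq fun x => ?_
    rw [IsScalarTower.algebraMap_apply K P (FractionRing P), ← IsScalarTower.algebraMap_apply P (FractionRing P) (FractionRing A),
      IsScalarTower.algebraMap_apply P A (FractionRing A), ← IsScalarTower.algebraMap_apply K P A]
    exact IsScalarTower.algebraMap_apply K A _ x
  · have htf : Module.IsTorsionFree P A := inferInstance
    infer_instance

lemma prm_alg [PerfectField K] {A L F : Type} [CommRing A] [IsDomain A] [Algebra K A] [Algebra (MvPolynomial (Fin n) K) A]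
    [IsScalarTower K (MvPolynomial (Fin n) K) A] [Module.Finite (MvPolynomial (Fin n) K) A] 
    [FaithfulSMul (MvPolynomial (Fin n) K) A] [Field L] [Field F] [Algebra (MvPolynomial (Fin n) K) L] 
    [IsFractionRing (MvPolynomial (Fin n) K) L] [Algebra A F] [IsFractionRing A F] [Algebra L F] [Algebra (MvPolynomial (Fin n) K) F] 
    [IsScalarTower (MvPolynomial (Fin n) K) L F] [IsScalarTower (MvPolynomial (Fin n) K) A F] 
    [Algebra K F] [Algebra K L] [IsScalarTower K L F] [IsScalarTower K A F] [IsScalarTower K (MvPolynomial (Fin n) K) F] [FiniteDimensional L F]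
    {π : PS K r →ₐ[K] A} (hπ : Function.Surjective π) (hk : ∀ p, π p = 0 ↔ p ∈ I) 
    (hP : ∀ q, algebraMap (MvPolynomial (Fin n) K) A q = π (θw w n q))
    (hor : LinearIndependent F (fun i : Fin n => KaehlerDifferential.D K F (algebraMap A F (π (w i)))) ∨ 
      ∀ ℓ : PS K r, ℓ.IsHomogeneous 1 → KaehlerDifferential.D K F (algebraMap A F (π ℓ)) ∈ 
        Submodule.span F ((fun i => KaehlerDifferential.D K F (algebraMap A F (π (w i)))) '' Set.Iio n)) : 
    ∃ a f α β g D, Prm I w n a f α β g D := by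
  have hInt : Algebra.IsIntegral (MvPolynomial (Fin n) K) A := inferInstance
  have hAF : Function.Injective (algebraMap A F) := IsFractionRing.injective A F
  have hPA : Function.Injective (algebraMap (MvPolynomial (Fin n) K) A) := FaithfulSMul.algebraMap_injective _ _
  have hPF : FaithfulSMul (MvPolynomial (Fin n) K) F := by
    rw [faithfulSMul_iff_algebraMap_injective, IsScalarTower.algebraMap_eq (MvPolynomial (Fin n) K) A F]
    exact hAF.comp hPA
  have halg : Algebra.IsAlgebraic (MvPolynomial (Fin n) K) F := 
    (IsFractionRing.comap_isAlgebraic_iff (A := MvPolynomial (Fin n) K) (K := L) (C := F)).mpr inferInstance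
  have hv : IsTranscendenceBasis K (fun i : Fin n => algebraMap A F (π (w i))) := by
    have := (IsTranscendenceBasis.mvPolynomial (Fin n) K).algebraMap_comp (A := F)
    convert this using 1
    funext i
    rw [Function.comp_apply, IsScalarTower.algebraMap_apply (MvPolynomial (Fin n) K) A F, hP, θw, aeval_X]
  have hft : Algebra.FiniteType K A := Algebra.FiniteType.of_surjective π hπ
  have hess0 : Algebra.EssFiniteType A F := Algebra.EssFiniteType.of_isLocalization _ (nonZeroDivisors A)
  have hess : Algebra.EssFiniteType K F := Algebra.EssFiniteType.comp K A F
  have hsep0 : Algebra.IsSeparable (IntermediateField.adjoin K (Set.range (fun i : Fin n => algebraMap A F (π (w i))))) F := by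
    refine sep_of_or _ hv {x | ∃ ℓ : PS K r, ℓ.IsHomogeneous 1 ∧ algebraMap A F (π ℓ) = x} ?_ ?_
    · intro M hM x
      have h1 : ∀ p : PS K r, KaehlerDifferential.D K F (algebraMap A F (π p)) ∈ M := by
        intro p
        induction p using MvPolynomial.induction_on with
        | C a => 
          have : algebraMap A F (π (MvPolynomial.C a)) = algebraMap K F a := by
            rw [IsScalarTower.algebraMap_apply K A F]
            exact congrArg _ (π.commutes a)
          rw [this, Derivation.map_algebraMap]; exact M.zero_mem
        | add p q hp hq => rw [map_add, map_add, map_add]; exact M.add_mem hp hq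
        | mul_X p i hp => 
          rw [map_mul, map_mul, Derivation.leibniz]
          exact M.add_mem (M.smul_mem _ (hM _ ⟨X i, isHomogeneous_X _ _, rfl⟩)) (M.smul_mem _ hp)
      obtain ⟨a, b, _, rfl⟩ := IsFractionRing.div_surjective (A := A) x
      obtain ⟨a, rfl⟩ := hπ a
      obtain ⟨b, rfl⟩ := hπ b
      rw [div_eq_mul_inv, Derivation.leibniz, Derivation.leibniz_inv]
      exact M.add_mem (M.smul_mem _ (M.smul_mem _ (h1 b))) (M.smul_mem _ (h1 a))
    · refine hor.imp id fun h => ?_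
      rintro _ ⟨ℓ, hℓ, rfl⟩
      refine Submodule.span_mono ?_ (h ℓ hℓ)
      rintro _ ⟨i, hi, rfl⟩
      exact ⟨_, ⟨⟨i, hi⟩, rfl⟩, rfl⟩
  have hsep : Algebra.IsSeparable L F := by
    refine sep_L (K := K) (Set.range (fun i : Fin n => algebraMap A F (π (w i)))) ?_
    rintro _ ⟨i, rfl⟩
    refine ⟨algebraMap (MvPolynomial (Fin n) K) L (X i), ?_⟩
    rw [← IsScalarTower.algebraMap_apply, IsScalarTower.algebraMap_apply (MvPolynomial (Fin n) K) A F, hP, θw, aeval_X]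
  obtain ⟨a, f, α, β, g, D, hf, hfa, hdvd, hg0, hg, hD, hs⟩ := prim_exists (P := MvPolynomial (Fin n) K) (A := A) (L := L) (F := F)
  obtain ⟨a, rfl⟩ := hπ a
  have hev : ∀ q, π (Polynomial.eval₂ (θw w n : MvPolynomial (Fin n) K →+* PS K r) a q) = Polynomial.aeval (π a) q := by
    intro q
    rw [Polynomial.aeval_def, ← AlgHom.coe_toRingHom, Polynomial.hom_eval₂]
    congr 1
    ext x
    · exact (hP _).symm
    · exact (hP _).symm
  refine ⟨a, f, α, β, g, D, hf, (hk _).mp ((hev f).trans hfa), fun q hq => hdvd q ((hev q).symm.trans ((hk _).mpr hq)), hg0, 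
    fun x => ?_, hD, hs, fun x hx => ?_⟩
  · obtain ⟨q, hq⟩ := hg (π x)
    refine ⟨q, (hk _).mp ?_⟩
    rw [map_sub, map_mul, ← hP, ← Algebra.smul_def, hq, hev, sub_self]
  · obtain ⟨p, hp, c, hc⟩ := exists_mul_mem (P := MvPolynomial (Fin n) K) (π x) (fun h => hx ((hk _).mp h))
    obtain ⟨c, rfl⟩ := hπ c
    refine ⟨p, hp, c, (hk _).mp ?_⟩
    rw [map_sub, map_mul, hc, hP, sub_self]

lemma exists_prm_aux [PerfectField K] [Infinite K] {A : Type} [CommRing A] [IsDomain A] [Algebra K A] 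
    {π : PS K r →ₐ[K] A} (hπ : Function.Surjective π) (hk : ∀ p, π p = 0 ↔ p ∈ I) (hI : HI I) {d : ℕ} 
    (hdim : AMD.DimEq K r I d) (hdimA : ringKrullDim A = (((d+1 : ℕ) : ℕ∞) : WithBot ℕ∞)) :
    ∃ w : ℕ → PS K r, (∀ i < d+1, (w i).IsHomogeneous 1) ∧ (∃ N, mI K r ^ N ≤ Jy I w (d+1)) ∧ 
      ∃ a f α β g D, Prm I w (d+1) a f α β g D := by
  let F := FractionRing A
  let ρ : PS K r →ₐ[K] F := (IsScalarTower.toAlgHom K A F).comp π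
  let δ : PS K r →ₗ[K] Ω[F⁄K] := (KaehlerDifferential.D K F : F →ₗ[K] Ω[F⁄K]) ∘ₗ ρ.toLinearMap
  obtain ⟨w, wh, ⟨N, hN⟩, hor⟩ := exists_w (F := F) hI hdim δ
  refine ⟨w, wh, ⟨N, hN⟩, ?_⟩
  let τ : MvPolynomial (Fin (d+1)) K →ₐ[K] A := π.comp (θw w (d+1))
  let : Algebra (MvPolynomial (Fin (d+1)) K) A := τ.toRingHom.toAlgebra
  have ht : IsScalarTower K (MvPolynomial (Fin (d+1)) K) A := IsScalarTower.of_algebraMap_eq fun x => (τ.commutes x).symm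
  have hP : ∀ q, algebraMap (MvPolynomial (Fin (d+1)) K) A q = π (θw w (d+1) q) := fun q => rfl
  have hfin : Module.Finite (MvPolynomial (Fin (d+1)) K) A := wfin hI hπ hk hP wh hN
  have hinj := winj (K := K) (n := d+1) (A := A) hdimA
  have hfaith : FaithfulSMul (MvPolynomial (Fin (d+1)) K) A := (faithfulSMul_iff_algebraMap_injective _ _).mpr hinj
  obtain ⟨L, i1, i2, i3, i4, i5, i6, i7, i8⟩ := frac_tower (K := K) (P := MvPolynomial (Fin (d+1)) K) (A := A)
  have ht3 : IsScalarTower K (MvPolynomial (Fin (d+1)) K) F := by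
    refine IsScalarTower.of_algebraMap_eq fun x => ?_
    have e1 := IsScalarTower.algebraMap_apply (MvPolynomial (Fin (d+1)) K) A F (algebraMap K _ x)
    have e2 : algebraMap (MvPolynomial (Fin (d+1)) K) A (algebraMap K _ x) = algebraMap K A x := τ.commutes x
    rw [e1, e2]
    exact IsScalarTower.algebraMap_apply K A F x
  exact prm_alg (L := L) (F := F) hπ hk hP hor

lemma exists_prm [PerfectField K] [Infinite K] (hI : HI I) (hpr : I.IsPrime) {d : ℕ} (hdim : AMD.DimEq K r I d) :
    ∃ w : ℕ → PS K r, (∀ i < d+1, (w i).IsHomogeneous 1) ∧ (∃ N, mI K r ^ N ≤ Jy I w (d+1)) ∧ 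
      ∃ a f α β g D, Prm I w (d+1) a f α β g D := by
  refine exists_prm_aux (A := PS K r ⧸ I) (π := Ideal.Quotient.mkₐ K I) Ideal.Quotient.mk_surjective 
    (fun p => Ideal.Quotient.eq_zero_iff_mem) hI hdim ?_
  rw [hdim]; norm_cast
end Prm
end QC

namespace QC

section Eta
variable {K : Type} [Field K] {r : ℕ} {I : Ideal (PS K r)} {n : ℕ} {w : ℕ → PS K r}

/-- the linear form with given coefficients -/
def Lf (K : Type) [Field K] (n : ℕ) : (Fin n → K) →ₗ[K] MvPolynomial (Fin n) K := Fintype.linearCombination K (X : Fin n → MvPolynomial (Fin n) K)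

lemma Lf_single (i : Fin n) : Lf K n (Pi.single i 1) = X i := by
  rw [Lf, Fintype.linearCombination_apply_single, one_smul]

lemma Lf_homog (c : Fin n → K) : (Lf K n c).IsHomogeneous 1 := by
  rw [Lf, Fintype.linearCombination_apply, ← mem_homogeneousSubmodule]
  exact Submodule.sum_mem _ fun i _ => Submodule.smul_mem _ _ (isHomogeneous_X _ _)

/-- evaluation of linear forms at `η` -/
def ηf (η : Fin n → K) : (Fin n → K) →ₗ[K] K := Fintype.linearCombination K η

lemma lin_ext {E : Type} [AddCommGroup E] [Module K E] {F G : (Fin n → K) →ₗ[K] E} (h : ∀ i, F (Pi.single i 1) = G (Pi.single i 1)) : F = G := by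
  apply LinearMap.pi_ext'
  intro i
  ext
  exact h i

lemma alg_Lf {B : Type} [CommRing B] [Algebra K B] (ψ : MvPolynomial (Fin n) K →ₐ[K] B) (F : (Fin n → K) →ₗ[K] B) 
    (h : ∀ i, ψ (X i) = F (Pi.single i 1)) (c : Fin n → K) : ψ (Lf K n c) = F c := by
  have : ψ.toLinearMap ∘ₗ Lf K n = F := by
    apply lin_ext
    intro i
    rw [LinearMap.comp_apply, Lf_single]; exact h i
  exact LinearMap.congr_fun this c

lemma Lf_eval (η : Fin n → K) (c : Fin n → K) : aeval η (Lf K n c) = ηf η c := 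
  alg_Lf (aeval η) (ηf η) (fun i => by rw [aeval_X, ηf, Fintype.linearCombination_apply_single, one_smul]) c

lemma Lf_inj {c : Fin n → K} (h : Lf K n c = 0) : c = 0 := by
  have : LinearIndependent K (X : Fin n → MvPolynomial (Fin n) K) := by
    have := (basisMonomials (Fin n) K).linearIndependent.comp (fun i : Fin n => Finsupp.single i 1) 
      (Finsupp.single_left_injective one_ne_zero)
    have e : (X : Fin n → MvPolynomial (Fin n) K) = ⇑(basisMonomials (Fin n) K) ∘ (fun i : Fin n => Finsupp.single i 1) := by
      funext i
      rw [Function.comp_apply, coe_basisMonomials]; rfl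
    rw [e]; exact this
  rw [Fintype.linearIndependent_iff] at this
  funext i
  exact this c h i

/-- the ideal generated by linear forms in `U` -/
def 𝔲 (U : Submodule K (Fin n → K)) : Ideal (MvPolynomial (Fin n) K) := Ideal.span (Lf K n '' U)

lemma proj_exists (U : Submodule K (Fin n → K)) : ∃ ψ : MvPolynomial (Fin n) K →ₐ[K] MvPolynomial (Fin n) K, 
    (∀ p ∈ 𝔲 U, ψ p = 0) ∧ (∀ p, p - ψ p ∈ 𝔲 U) ∧ (∀ p, ψ (ψ p) = ψ p) ∧ ∀ c, c ∉ U → ψ (Lf K n c) ≠ 0 := by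
  obtain ⟨ρ, hρ⟩ := LinearMap.exists_leftInverse_of_injective U.subtype (Submodule.ker_subtype U)
  let e : (Fin n → K) →ₗ[K] (Fin n → K) := LinearMap.id - U.subtype ∘ₗ ρ
  have he : ∀ c, e c = c - ρ c := fun c => rfl
  have heU : ∀ c ∈ U, e c = 0 := fun c hc => by
    have := LinearMap.congr_fun hρ ⟨c, hc⟩
    rw [he, sub_eq_zero]
    exact (congrArg Subtype.val this).symm
  have hee : ∀ c, e (e c) = e c := fun c => by
    have : e (e c) = e c - e (ρ c) := by rw [← map_sub, ← he]
    rw [this, heU _ (ρ c).2, sub_zero]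
  let ψ : MvPolynomial (Fin n) K →ₐ[K] MvPolynomial (Fin n) K := aeval fun i => Lf K n (e (Pi.single i 1))
  have hψ : ∀ c, ψ (Lf K n c) = Lf K n (e c) := alg_Lf ψ (Lf K n ∘ₗ e) fun i => by
    rw [LinearMap.comp_apply, aeval_X]
  have h2 : ∀ p, p - ψ p ∈ 𝔲 U := by
    intro p
    induction p using MvPolynomial.induction_on with
    | C a => 
      have : ψ (MvPolynomial.C a) = MvPolynomial.C a := ψ.commutes a
      rw [this, sub_self]; exact Ideal.zero_mem _
    | add p q hp hq => 
      rw [map_add, add_sub_add_comm]; exact Ideal.add_mem _ hp hq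
    | mul_X p i hp =>
      have h1 : X i - ψ (X i) ∈ 𝔲 U := by
        rw [← Lf_single, hψ, he, map_sub, sub_sub_cancel]
        exact Ideal.subset_span ⟨_, (ρ _).2, rfl⟩
      have : p * X i - ψ (p * X i) = (p - ψ p) * X i + ψ p * (X i - ψ (X i)) := by rw [map_mul]; ring
      rw [this]
      exact Ideal.add_mem _ (Ideal.mul_mem_right _ _ hp) (Ideal.mul_mem_left _ _ h1)
  have h1 : ∀ p ∈ 𝔲 U, ψ p = 0 := by
    have : 𝔲 U ≤ RingHom.ker ψ := by
      refine Ideal.span_le.mpr ?_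
      rintro _ ⟨c, hc, rfl⟩
      rw [SetLike.mem_coe, RingHom.mem_ker, hψ, heU c hc, map_zero]
    exact fun p hp => this hp
  refine ⟨ψ, h1, h2, fun p => ?_, fun c hc h => hc ?_⟩
  · have := h1 _ (h2 p)
    rw [map_sub, sub_eq_zero] at this
    exact this.symm
  · rw [hψ] at h
    have := Lf_inj h
    rw [he, sub_eq_zero] at this
    rw [this]; exact (ρ c).2

variable {a : PS K r} {f α β : Polynomial (MvPolynomial (Fin n) K)} {g D : MvPolynomial (Fin n) K}

lemma Prm.claimA (h : Prm I w n a f α β g D) (U : Submodule K (Fin n → K)) {c : Fin n → K} (hc : c ∉ U) {x : PS K r} 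
    (hx : θw w n (Lf K n c) * x ∈ I ⊔ Ideal.map (θw w n : MvPolynomial (Fin n) K →+* PS K r) (𝔲 U)) : 
    θw w n g * x ∈ I ⊔ Ideal.map (θw w n : MvPolynomial (Fin n) K →+* PS K r) (𝔲 U) := by
  set Θ : MvPolynomial (Fin n) K →+* PS K r := (θw w n : MvPolynomial (Fin n) K →+* PS K r) with hΘ
  have hev : ∀ q, Polynomial.eval₂ Θ a q = Polynomial.eval₂RingHom Θ a q := fun q => rfl
  have hevC : ∀ p, Polynomial.eval₂RingHom Θ a (Polynomial.C p) = Θ p := fun p => Polynomial.eval₂_C _ _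
  change Θ (Lf K n c) * x ∈ _ at hx
  change Θ g * x ∈ _
  have step1 : ∀ j ∈ Ideal.map Θ (𝔲 U), ∀ s, ∃ Q ∈ Ideal.map (Polynomial.C : MvPolynomial (Fin n) K →+* _) (𝔲 U), 
      Θ g * (s * j) - Polynomial.eval₂RingHom Θ a Q ∈ I := by
    intro j hj
    rw [Ideal.map] at hj
    induction hj using Submodule.span_induction with
    | mem x hx => 
      obtain ⟨u, hu, rfl⟩ := hx
      intro s
      obtain ⟨q, hq⟩ := h.hg s
      refine ⟨Polynomial.C u * q, Ideal.mul_mem_right _ _ (Ideal.mem_map_of_mem _ hu), ?_⟩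
      rw [map_mul, hevC]
      have : Θ g * (s * Θ u) - Θ u * Polynomial.eval₂RingHom Θ a q = (Θ g * s - Polynomial.eval₂RingHom Θ a q) * Θ u := by ring
      rw [this]
      exact Ideal.mul_mem_right _ _ hq
    | zero => intro s; exact ⟨0, Ideal.zero_mem _, by simp⟩
    | add x y _ _ hx hy => 
      intro s
      obtain ⟨Q, hQ, h1⟩ := hx s
      obtain ⟨R, hR, h2⟩ := hy s
      refine ⟨Q + R, Ideal.add_mem _ hQ hR, ?_⟩
      convert Ideal.add_mem _ h1 h2 using 1
      rw [map_add]; ring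
    | smul t x _ hx => 
      intro s
      obtain ⟨Q, hQ, h1⟩ := hx (s * t)
      exact ⟨Q, hQ, by rwa [smul_eq_mul, ← mul_assoc s]⟩
  obtain ⟨i, hi, m, hm, him⟩ := Submodule.mem_sup.mp hx
  obtain ⟨Q, hQ, hQ2⟩ := step1 m hm 1
  obtain ⟨q, hq⟩ := h.hg x
  have h1 : f ∣ Polynomial.C (Lf K n c) * q - Q := by
    apply h.dvd
    change Polynomial.eval₂RingHom Θ a _ ∈ I
    rw [map_sub, map_mul, hevC]
    have : Θ (Lf K n c) * Polynomial.eval₂RingHom Θ a q - Polynomial.eval₂RingHom Θ a Q = 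
      - (Θ (Lf K n c) * (Θ g * x - Polynomial.eval₂RingHom Θ a q)) + (Θ g * (1 * m) - Polynomial.eval₂RingHom Θ a Q) + Θ g * i := by
      linear_combination - Θ g * him
    rw [this]
    exact Ideal.add_mem _ (Ideal.add_mem _ (Ideal.neg_mem_iff _ |>.mpr (Ideal.mul_mem_left _ _ hq)) hQ2) (Ideal.mul_mem_left _ _ hi)
  obtain ⟨ψ, hψ1, hψ2, hψ3, hψ4⟩ := proj_exists U
  set Ψ : MvPolynomial (Fin n) K →+* MvPolynomial (Fin n) K := (ψ : MvPolynomial (Fin n) K →+* MvPolynomial (Fin n) K) with hΨ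
  have hQ0 : Q.map Ψ = 0 := by
    ext1 i
    rw [Polynomial.coeff_map, Polynomial.coeff_zero]
    exact hψ1 _ (Ideal.mem_map_C_iff.mp hQ i)
  have h2 : f.map Ψ ∣ Polynomial.C (Ψ (Lf K n c)) * q.map Ψ := by
    have := Polynomial.map_dvd Ψ h1
    rwa [Polynomial.map_sub, Polynomial.map_mul, Polynomial.map_C, hQ0, sub_zero] at this
  have hmon : (f.map Ψ).Monic := h.monic.map Ψ
  have h3 : f.map Ψ ∣ q.map Ψ := by
    rw [← Polynomial.modByMonic_eq_zero_iff_dvd hmon] at h2 ⊢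
    rw [← Polynomial.smul_eq_C_mul, Polynomial.smul_modByMonic] at h2
    exact (smul_eq_zero.mp h2).resolve_left (hψ4 c hc)
  obtain ⟨k, hk⟩ := h3
  have hidem : ∀ p : Polynomial (MvPolynomial (Fin n) K), (p.map Ψ).map Ψ = p.map Ψ := by
    intro p; ext1 i
    rw [Polynomial.coeff_map, Polynomial.coeff_map]
    exact hψ3 _
  have h4 : (q - f * k).map Ψ = 0 := by
    have := congrArg (Polynomial.map Ψ) hk
    rw [hidem, Polynomial.map_mul, hidem] at this
    rw [Polynomial.map_sub, Polynomial.map_mul, this, sub_self]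
  have h5 : q - f * k ∈ Ideal.map (Polynomial.C : MvPolynomial (Fin n) K →+* _) (𝔲 U) := by
    rw [Ideal.mem_map_C_iff]
    intro i
    have h6 : Ψ ((q - f * k).coeff i) = 0 := by rw [← Polynomial.coeff_map, h4, Polynomial.coeff_zero]
    have h7 := hψ2 ((q - f * k).coeff i)
    have h8 : ψ ((q - f * k).coeff i) = 0 := h6
    rwa [h8, sub_zero] at h7
  have h6 := Ideal.mem_map_of_mem (Polynomial.eval₂RingHom Θ a) h5
  rw [Ideal.map_map] at h6
  have h7 : (Polynomial.eval₂RingHom Θ a).comp Polynomial.C = Θ := RingHom.ext hevC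
  rw [h7, map_sub, map_mul] at h6
  have h8 : Θ g * x = (Θ g * x - Polynomial.eval₂RingHom Θ a q) + (Polynomial.eval₂RingHom Θ a q - Polynomial.eval₂RingHom Θ a f * 
    Polynomial.eval₂RingHom Θ a k) + Polynomial.eval₂RingHom Θ a f * Polynomial.eval₂RingHom Θ a k := by ring
  rw [h8]
  exact Ideal.add_mem _ (Ideal.add_mem _ (Ideal.mem_sup_left hq) (Ideal.mem_sup_right h6)) 
    (Ideal.mem_sup_left (Ideal.mul_mem_right _ _ h.fa))

end Eta
end QC

namespace QC

section Eta2
variable {K : Type} [Field K] {r : ℕ} {I : Ideal (PS K r)} {n : ℕ} {w : ℕ → PS K r}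

lemma sat_pow {S : Type} [CommRing S] {𝔞 J : Ideal S} (h : Sat 𝔞 J) (N : ℕ) : ∀ x, (∀ s ∈ 𝔞 ^ N, s * x ∈ J) → x ∈ J := by
  induction N with
  | zero => intro x hx; simpa using hx 1 (by simp)
  | succ N ih => 
    intro x hx
    refine h x fun a ha => ih _ fun s hs => ?_
    rw [← mul_assoc]
    exact hx _ (by rw [pow_succ]; exact Ideal.mul_mem_mul hs ha)

/-- restriction to the line through `η` -/
def τη (η : Fin n → K) : MvPolynomial (Fin n) K →ₐ[K] Polynomial K := aeval fun i => Polynomial.C (η i) * Polynomial.X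

lemma τη_eval (η : Fin n → K) (p : MvPolynomial (Fin n) K) : Polynomial.aeval (1 : K) (τη η p) = aeval η p := by
  have : (Polynomial.aeval (1 : K)).comp (τη η) = aeval η := by
    ext i
    simp [τη]
  exact DFunLike.congr_fun this p

lemma τη_sub (η : Fin n → K) {b : Fin n → K} (hb : ηf η b = 1) (p : MvPolynomial (Fin n) K) : 
    p - Polynomial.aeval (Lf K n b) (τη η p) ∈ 𝔲 (LinearMap.ker (ηf η)) := by
  let ψ : MvPolynomial (Fin n) K →ₐ[K] MvPolynomial (Fin n) K := (Polynomial.aeval (Lf K n b)).comp (τη η)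
  change p - ψ p ∈ _
  induction p using MvPolynomial.induction_on with
  | C a => 
    have : ψ (MvPolynomial.C a) = MvPolynomial.C a := ψ.commutes a
    rw [this, sub_self]; exact Ideal.zero_mem _
  | add p q hp hq => 
    rw [map_add, add_sub_add_comm]; exact Ideal.add_mem _ hp hq
  | mul_X p i hp =>
    have h1 : X i - ψ (X i) ∈ 𝔲 (LinearMap.ker (ηf η)) := by
      have h2 : ψ (X i) = Lf K n (η i • b) := by
        rw [map_smul, AlgHom.comp_apply, τη, aeval_X, map_mul, Polynomial.aeval_C, Polynomial.aeval_X, Algebra.smul_def]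
      rw [h2, ← Lf_single, ← map_sub]
      refine Ideal.subset_span ⟨_, ?_, rfl⟩
      rw [SetLike.mem_coe, LinearMap.mem_ker, map_sub, map_smul, hb, ηf, Fintype.linearCombination_apply_single]
      simp
    have : p * X i - ψ (p * X i) = (p - ψ p) * X i + ψ p * (X i - ψ (X i)) := by rw [map_mul]; ring
    rw [this]
    exact Ideal.add_mem _ (Ideal.mul_mem_right _ _ hp) (Ideal.mul_mem_left _ _ h1)

variable {a : PS K r} {f α β : Polynomial (MvPolynomial (Fin n) K)} {g D : MvPolynomial (Fin n) K}

lemma θLf_homog (wh : ∀ i < n, (w i).IsHomogeneous 1) (c : Fin n → K) : (θw w n (Lf K n c)).IsHomogeneous 1 := by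
  rw [Lf, Fintype.linearCombination_apply, map_sum, ← mem_homogeneousSubmodule]
  refine Submodule.sum_mem _ fun i _ => ?_
  rw [map_smul, θw, aeval_X]
  exact Submodule.smul_mem _ _ (wh i i.2)

lemma eta_desc (wh : ∀ i < n, (w i).IsHomogeneous 1) {N : ℕ} (hN : mI K r ^ N ≤ Jy I w n) {η b : Fin n → K} (hb : ηf η b = 1) 
    {J : Ideal (PS K r)} (hIJ : I ≤ J) (hsat : Sat (mI K r) J) (i : ℕ) : ∀ x, 
    (∀ c ∈ LinearMap.ker (ηf η), θw w n (Lf K n c) * x ∈ J) → θw w n (Lf K n b) ^ i * x ∈ J → x ∈ J := by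
  induction i with
  | zero => intro x _ hx; simpa using hx
  | succ i ih => 
    intro x h1 h2
    have h3 : θw w n (Lf K n b) * x ∈ J := by
      apply ih
      · intro c hc
        rw [mul_left_comm]
        exact Ideal.mul_mem_left _ _ (h1 c hc)
      · rwa [← mul_assoc, ← pow_succ]
    refine sat_pow hsat N x fun s hs => ?_
    have h4 : ∀ c, θw w n (Lf K n c) * x ∈ J := by
      intro c
      have h5 : c = (c - ηf η c • b) + ηf η c • b := by rw [sub_add_cancel]
      rw [h5, map_add, map_add, add_mul, map_smul (Lf K n), map_smul (θw w n), smul_mul_assoc]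
      refine Ideal.add_mem _ (h1 _ ?_) ?_
      · rw [LinearMap.mem_ker, map_sub, map_smul, hb]; simp
      · rw [Algebra.smul_def]; exact Ideal.mul_mem_left _ _ h3
    have h6 : Jy I w n ≤ Submodule.comap (LinearMap.mulRight (PS K r) x) J := by
      rw [Jy, sup_le_iff]
      refine ⟨fun i hi => ?_, Ideal.span_le.mpr ?_⟩
      · exact Ideal.mul_mem_right x _ (hIJ hi)
      · rintro _ ⟨i, hi, rfl⟩
        have := h4 (Pi.single ⟨i, hi⟩ 1)
        rw [Lf_single, θw, aeval_X] at this
        exact this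
    exact h6 (hN hs)

lemma Prm.claimB (h : Prm I w n a f α β g D) (wh : ∀ i < n, (w i).IsHomogeneous 1) {N : ℕ} (hN : mI K r ^ N ≤ Jy I w n) 
    {η b : Fin n → K} (hb : ηf η b = 1) (hgη : aeval η g ≠ 0)
    {U : Submodule K (Fin n → K)} (hU : U < LinearMap.ker (ηf η)) {J : Ideal (PS K r)} 
    (hJ : J = I ⊔ Ideal.map (θw w n : MvPolynomial (Fin n) K →+* PS K r) (𝔲 U)) (hJh : HI J) (hsat : Sat (mI K r) J) (x : PS K r)
    (hx : ∀ c ∈ LinearMap.ker (ηf η), θw w n (Lf K n c) * x ∈ J) : x ∈ J := by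
  have main : ∀ m, ∀ x : PS K r, x.IsHomogeneous m → (∀ c ∈ LinearMap.ker (ηf η), θw w n (Lf K n c) * x ∈ J) → x ∈ J := by
    intro m x hxm hx
    obtain ⟨c, hcW, hcU⟩ := SetLike.exists_of_lt hU
    have h1 : θw w n g * x ∈ J := by
      have := hx c hcW
      rw [hJ] at this ⊢
      exact h.claimA U hcU this
    have h2 : ∀ p ∈ 𝔲 (LinearMap.ker (ηf η)), θw w n p * x ∈ J := by
      intro p hp
      rw [𝔲] at hp
      induction hp using Submodule.span_induction with
      | mem y hy => obtain ⟨c, hc, rfl⟩ := hy; exact hx c hc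
      | zero => rw [map_zero, zero_mul]; exact J.zero_mem
      | add y z _ _ hy hz => rw [map_add, add_mul]; exact J.add_mem hy hz
      | smul t y _ hy => rw [smul_eq_mul, map_mul, mul_assoc]; exact J.mul_mem_left _ hy
    have h3 := J.sub_mem h1 (h2 _ (τη_sub η hb g))
    set hh := τη η g with hhh
    have hh0 : hh ≠ 0 := by
      intro h0
      apply hgη
      rw [← τη_eval, ← hhh, h0, map_zero]
    set y0 := θw w n (Lf K n b) with hy0
    have hy0h : y0.IsHomogeneous 1 := θLf_homog wh b
    have h4 : ∑ i ∈ Finset.range (hh.natDegree + 1), hh.coeff i • (y0 ^ i * x) ∈ J := by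
      convert h3 using 1
      rw [map_sub, sub_mul, sub_sub_cancel, Polynomial.aeval_eq_sum_range, map_sum, Finset.sum_mul]
      refine Finset.sum_congr rfl fun i _ => ?_
      rw [map_smul (θw w n), map_pow, smul_mul_assoc]
    have hhom : ∀ i, (y0 ^ i * x).IsHomogeneous (i + m) := by
      intro i
      have := (hy0h.pow i).mul hxm
      rwa [one_mul] at this
    have h5 := hJh _ h4 (hh.natDegree + m)
    rw [map_sum] at h5
    have h6 : ∀ i ∈ Finset.range (hh.natDegree + 1), i ≠ hh.natDegree → 
        homogeneousComponent (hh.natDegree + m) (hh.coeff i • (y0 ^ i * x)) = 0 := by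
      intro i _ hi
      rw [(homogeneousComponent _).map_smul, homogeneousComponent_of_mem (hhom i), if_neg (by omega), smul_zero]
    rw [Finset.sum_eq_single hh.natDegree h6 (fun hn => absurd (Finset.self_mem_range_succ _) hn), (homogeneousComponent _).map_smul, 
      homogeneousComponent_of_mem (hhom _), if_pos rfl] at h5
    have hlc : hh.coeff hh.natDegree ≠ 0 := by
      rw [Polynomial.coeff_natDegree]; exact Polynomial.leadingCoeff_ne_zero.mpr hh0
    have h7 : y0 ^ hh.natDegree * x ∈ J := by
      have := J.mul_mem_left (MvPolynomial.C (hh.coeff hh.natDegree)⁻¹) h5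
      rwa [← MvPolynomial.smul_eq_C_mul, smul_smul, inv_mul_cancel₀ hlc, one_smul] at this
    exact eta_desc wh hN hb (hJ ▸ le_sup_left) hsat _ x hx h7
  rw [← sum_homogeneousComponent x]
  refine Ideal.sum_mem _ fun m _ => main m _ (homogeneousComponent_isHomogeneous _ _) fun c hc => ?_
  rw [← hc_mul (θLf_homog wh c)]
  exact hJh _ (hx c hc) _

lemma Jy_eq_map (c : ℕ → Fin n → K) (k : ℕ) : Jy I (fun i => θw w n (Lf K n (c i))) k = 
    I ⊔ Ideal.map (θw w n : MvPolynomial (Fin n) K →+* PS K r) (𝔲 (Submodule.span K (c '' Set.Iio k))) := by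
  rw [Jy]
  congr 1
  have : 𝔲 (Submodule.span K (c '' Set.Iio k)) = Ideal.span (Lf K n '' (c '' Set.Iio k)) := by
    apply le_antisymm
    · refine Ideal.span_le.mpr ?_
      rintro _ ⟨x, hx, rfl⟩
      rw [SetLike.mem_coe] at hx ⊢
      induction hx using Submodule.span_induction with
      | mem x hx => exact Ideal.subset_span ⟨x, hx, rfl⟩
      | zero => rw [map_zero]; exact Ideal.zero_mem _
      | add x y _ _ hx hy => rw [map_add]; exact Ideal.add_mem _ hx hy
      | smul t x _ hx => rw [map_smul, Algebra.smul_def]; exact Ideal.mul_mem_left _ _ hx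
    · exact Ideal.span_mono (Set.image_mono Submodule.subset_span)
  rw [this, Ideal.map_span, Set.image_image, Set.image_image]
  rfl

theorem Prm.exists_c [Infinite K] {d : ℕ} {a : PS K r} {f α β : Polynomial (MvPolynomial (Fin (d+1)) K)} {g D : MvPolynomial (Fin (d+1)) K}
    (h : Prm I w (d+1) a f α β g D) (hI : HI I) (wh : ∀ i < d+1, (w i).IsHomogeneous 1) {N : ℕ} (hN : mI K r ^ N ≤ Jy I w (d+1)) 
    {η b : Fin (d+1) → K} (hb : ηf η b = 1) (hgη : aeval η g ≠ 0) {x : ℕ → PS K r} (hxm : ∀ i < d, x i ∈ mI K r) (hxr : RegY I x d) : 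
    ∃ c : ℕ → Fin (d+1) → K, (∀ i < d, c i ∈ LinearMap.ker (ηf η)) ∧ (∀ i < d, c i ∉ Submodule.span K (c '' Set.Iio i)) ∧ 
      RegY I (fun i => θw w (d+1) (Lf K (d+1) (c i))) d := by
  have hfr : Module.finrank K (LinearMap.ker (ηf η)) = d := by
    have h1 := (ηf η).finrank_range_add_finrank_ker
    have h2 : LinearMap.range (ηf η) = ⊤ := by
      rw [LinearMap.range_eq_top]
      intro t
      exact ⟨t • b, by rw [map_smul, hb]; simp⟩
    rw [h2, finrank_top, Module.finrank_self, Module.finrank_fin_fun] at h1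
    omega
  obtain ⟨c, hc⟩ := greedy d (fun i c => c i ∈ LinearMap.ker (ηf η) ∧ c i ∉ Submodule.span K (c '' Set.Iio i) ∧ 
    ∀ f, θw w (d+1) (Lf K (d+1) (c i)) * f ∈ Jy I (fun i => θw w (d+1) (Lf K (d+1) (c i))) i → 
      f ∈ Jy I (fun i => θw w (d+1) (Lf K (d+1) (c i))) i) (by
      intro i c c' he ⟨h1, h2, h3⟩
      have e1 : Jy I (fun i => θw w (d+1) (Lf K (d+1) (c i))) i = Jy I (fun i => θw w (d+1) (Lf K (d+1) (c' i))) i := 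
        Jy_congr fun j hj => by rw [he j hj.le]
      have e2 : c '' Set.Iio i = c' '' Set.Iio i := Set.image_congr fun j hj => he j (le_of_lt hj)
      rw [he i le_rfl] at h1 h2 h3
      rw [e1] at h3
      rw [e2] at h2
      exact ⟨h1, h2, h3⟩) (by
      intro k hk c hc
      set U := Submodule.span K (c '' Set.Iio k) with hU
      set J := Jy I (fun i => θw w (d+1) (Lf K (d+1) (c i))) k with hJ
      have hUle : U ≤ LinearMap.ker (ηf η) := by
        rw [hU, Submodule.span_le]
        rintro _ ⟨j, hj, rfl⟩
        exact (hc j hj).1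
      have hUfr : Module.finrank K U ≤ k := by
        classical
        have e : c '' Set.Iio k = ((Finset.range k).image c : Finset _) := by ext; simp
        have := finrank_span_finset_le_card (R := K) ((Finset.range k).image c)
        rw [Set.finrank, ← e] at this
        exact this.trans (Finset.card_image_le.trans (by simp))
      have hUlt : U < LinearMap.ker (ηf η) := by
        refine lt_of_le_of_ne hUle fun h => ?_
        rw [h, hfr] at hUfr; omega
      have yh : ∀ i < k, (θw w (d+1) (Lf K (d+1) (c i))).IsHomogeneous 1 := fun i _ => θLf_homog wh _
      have hJh : HI J := HI.Jy hI yh k le_rfl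
      have hsat : Sat (mI K r) J := rees_short (mI K r) hxm (fun i hi => lin_mem_mI (yh i hi)) hxr (fun i hi => (hc i hi).2.2) hk
      obtain ⟨T, hT1, hT2, hT3⟩ := ass_fin J
      have : Finite T := hT1
      let V : Ideal (PS K r) → Submodule K (Fin (d+1) → K) := fun Q => 
        (Q.restrictScalars K).comap ((θw w (d+1)).toLinearMap ∘ₗ Lf K (d+1))
      obtain ⟨v, hvW, hv⟩ := avoid (LinearMap.ker (ηf η)) (fun i : Option T => i.elim U (fun Q => V Q)) (by
        intro i hle
        cases i with
        | none => exact absurd (le_antisymm hUle hle) hUlt.ne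
        | some Q => 
          obtain ⟨_, f, hfJ, hf⟩ := hT2 Q Q.2
          exact hfJ (h.claimB wh hN hb hgη hUlt (Jy_eq_map c k) hJh hsat f fun c hc => hf _ (hle hc)))
      refine ⟨v, ?_⟩
      have e1 : Jy I (fun i => θw w (d+1) (Lf K (d+1) (Function.update c k v i))) k = J := 
        Jy_congr fun j hj => by rw [Function.update_of_ne (by omega)]
      have e2 : Function.update c k v '' Set.Iio k = c '' Set.Iio k := Set.image_congr fun j hj => by
        rw [Function.update_of_ne (by rw [Set.mem_Iio] at hj; omega)]
      rw [e1, e2, Function.update_self]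
      refine ⟨hvW, hv none, hT3 _ fun Q hQ => hv (some ⟨Q, hQ⟩)⟩)
  exact ⟨c, fun i hi => (hc i hi).1, fun i hi => (hc i hi).2.1, fun i hi => (hc i hi).2.2⟩
end Eta2
end QC

namespace QC

section Phi
variable {K : Type} [Field K] {r : ℕ} {I : Ideal (PS K r)} {n : ℕ} {w : ℕ → PS K r} {k : Type} [Field k] [Algebra K k]
  {a : PS K r} {f α β : Polynomial (MvPolynomial (Fin n) K)} {g D : MvPolynomial (Fin n) K}

lemma ps_unit {x : PowerSeries k} (h : PowerSeries.constantCoeff x ≠ 0) : IsUnit x := by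
  rw [PowerSeries.isUnit_iff_constantCoeff]; exact h.isUnit

lemma Prm.exists_root [IsAlgClosed K] (h : Prm I w n a f α β g D) (hpr : I.IsPrime) {η : Fin n → K} 
    (ψ : MvPolynomial (Fin n) K →ₐ[K] PowerSeries k) 
    (hψ : ∀ p, PowerSeries.constantCoeff (ψ p) = algebraMap K k (aeval η p)) (hD : aeval η D ≠ 0) : 
    ∃ ζ : PowerSeries k, Polynomial.eval₂ (ψ : MvPolynomial (Fin n) K →+* PowerSeries k) ζ f = 0 := by
  let e : MvPolynomial (Fin n) K →+* K := (aeval η : MvPolynomial (Fin n) K →ₐ[K] K)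
  have hmon : (f.map e).Monic := h.monic.map e
  have hd : f.natDegree ≠ 0 := by
    intro h0
    have := h.fa
    rw [h.monic.natDegree_eq_zero.mp h0, Polynomial.eval₂_one] at this
    exact hpr.one_notMem this
  obtain ⟨ρ, hρ⟩ := IsAlgClosed.exists_root (f.map e) (by
    rw [Polynomial.degree_eq_natDegree hmon.ne_zero, h.monic.natDegree_map]
    exact_mod_cast hd)
  have hρ' : Polynomial.eval₂ e ρ f = 0 := by rwa [← Polynomial.eval_map]
  have hder : Polynomial.eval₂ e ρ (Polynomial.derivative f) ≠ 0 := by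
    intro h0
    have := congrArg (Polynomial.eval₂ e ρ) h.sep
    rw [Polynomial.eval₂_add, Polynomial.eval₂_mul, Polynomial.eval₂_mul, hρ', h0, mul_zero, mul_zero, add_zero, Polynomial.eval₂_C] at this
    exact hD this.symm
  let ψr : MvPolynomial (Fin n) K →+* PowerSeries k := ψ
  let a0 : PowerSeries k := PowerSeries.C (algebraMap K k ρ)
  have hcc : ∀ q : Polynomial (MvPolynomial (Fin n) K), PowerSeries.constantCoeff (Polynomial.eval₂ ψr a0 q) = algebraMap K k (Polynomial.eval₂ e ρ q) := by
    intro q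
    rw [Polynomial.hom_eval₂, Polynomial.hom_eval₂]
    have e1 : PowerSeries.constantCoeff.comp ψr = (algebraMap K k).comp e := RingHom.ext fun p => hψ p
    rw [e1]
    exact congrArg (fun z => Polynomial.eval₂ _ z q) (PowerSeries.constantCoeff_C _)
  have hmem : ∀ x : PowerSeries k, x ∈ Ideal.span {(PowerSeries.X : PowerSeries k)} ↔ PowerSeries.constantCoeff x = 0 := by
    intro x
    rw [Ideal.mem_span_singleton, PowerSeries.X_dvd_iff]
  have hen : HenselianRing (PowerSeries k) (Ideal.span {(PowerSeries.X : PowerSeries k)}) := inferInstance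
  obtain ⟨ζ, hζ, -⟩ := hen.is_henselian (f.map ψr) (h.monic.map ψr) a0 (by
    rw [hmem, Polynomial.eval_map, hcc, hρ', map_zero]) (by
    rw [Polynomial.derivative_map, Polynomial.eval_map]
    refine (ps_unit ?_).map _
    rw [hcc]
    exact (map_ne_zero _).mpr hder)
  exact ⟨ζ, by rwa [Polynomial.IsRoot, Polynomial.eval_map] at hζ⟩

lemma Prm.exists_phi [IsAlgClosed K] (h : Prm I w n a f α β g D) (hpr : I.IsPrime) {η : Fin n → K} 
    (ψ : MvPolynomial (Fin n) K →ₐ[K] PowerSeries k) 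
    (hψ : ∀ p, PowerSeries.constantCoeff (ψ p) = algebraMap K k (aeval η p)) (hD : aeval η D ≠ 0) (hgη : aeval η g ≠ 0) :
    ∃ φ : PS K r →ₐ[K] PowerSeries k, (∀ p, φ (θw w n p) = ψ p) ∧ ∀ p ∈ I, φ p = 0 := by
  obtain ⟨ζ, hζ⟩ := h.exists_root hpr ψ hψ hD
  let E : Polynomial (MvPolynomial (Fin n) K) →+* PS K r := Polynomial.eval₂RingHom (θw w n : MvPolynomial (Fin n) K →+* PS K r) a
  let E' : Polynomial (MvPolynomial (Fin n) K) →+* PowerSeries k := Polynomial.eval₂RingHom (ψ : MvPolynomial (Fin n) K →+* PowerSeries k) ζ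
  have hE : ∀ q, E q ∈ I → E' q = 0 := by
    intro q hq
    obtain ⟨s, rfl⟩ := h.dvd q hq
    rw [map_mul]
    have : E' f = 0 := hζ
    rw [this, zero_mul]
  have hEC : ∀ p, E (Polynomial.C p) = θw w n p := fun p => Polynomial.eval₂_C _ _
  have hEC' : ∀ p, E' (Polynomial.C p) = ψ p := fun p => Polynomial.eval₂_C _ _
  have hgE : ∀ x, ∃ q, θw w n g * x - E q ∈ I := h.hg
  choose q hq using hgE
  have hu : IsUnit (ψ g) := ps_unit (by rw [hψ]; exact (map_ne_zero _).mpr hgη)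
  obtain ⟨U, hU⟩ := hu
  let F : PS K r → PowerSeries k := fun s => ↑U⁻¹ * E' (q s)
  have hF : ∀ s, ψ g * F s = E' (q s) := fun s => by
    rw [← hU]; exact U.mul_inv_cancel_left _
  have key : ∀ i s p, θw w n g ^ i * s - E p ∈ I → ψ g ^ i * F s = E' p := by
    intro i s p hp
    have h1 : E (Polynomial.C g ^ i * q s - Polynomial.C g * p) ∈ I := by
      rw [map_sub, map_mul, map_mul, map_pow, hEC]
      have e : θw w n g ^ i * E (q s) - θw w n g * E p = θw w n g * (θw w n g ^ i * s - E p) - θw w n g ^ i * (θw w n g * s - E (q s)) := by ring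
      rw [e]
      exact I.sub_mem (I.mul_mem_left _ hp) (I.mul_mem_left _ (hq s))
    have h2 := hE _ h1
    rw [map_sub, map_mul, map_mul, map_pow, hEC', ← hF] at h2
    have h3 : ψ g * (ψ g ^ i * F s - E' p) = 0 := by rw [← h2]; ring
    rw [← hU, Units.mul_right_eq_zero, hU] at h3
    exact sub_eq_zero.mp h3
  have key0 : ∀ s p, s - E p ∈ I → F s = E' p := fun s p hp => by
    have := key 0 s p (by rwa [pow_zero, one_mul])
    rwa [pow_zero, one_mul] at this
  have hθ : ∀ p, F (θw w n p) = ψ p := fun p => by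
    rw [← hEC']
    refine key0 _ _ ?_
    rw [hEC, sub_self]; exact I.zero_mem
  have h1 : F 1 = 1 := by have := hθ 1; rwa [map_one, map_one] at this
  have h0 : F 0 = 0 := by have := hθ 0; rwa [map_zero, map_zero] at this
  have hadd : ∀ s t, F (s + t) = F s + F t := by
    intro s t
    have := key 1 (s + t) (q s + q t) (by
      rw [pow_one, map_add]
      have e : θw w n g * (s + t) - (E (q s) + E (q t)) = (θw w n g * s - E (q s)) + (θw w n g * t - E (q t)) := by ring
      rw [e]; exact I.add_mem (hq s) (hq t))
    rw [map_add, ← hF, ← hF, pow_one, ← mul_add, ← hU] at this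
    exact U.isUnit.mul_left_cancel this
  have hmul : ∀ s t, F (s * t) = F s * F t := by
    intro s t
    have := key 2 (s * t) (q s * q t) (by
      rw [map_mul]
      have e : θw w n g ^ 2 * (s * t) - (E (q s) * E (q t)) = (θw w n g * s - E (q s)) * (θw w n g * t) + E (q s) * (θw w n g * t - E (q t)) := by ring
      rw [e]; exact I.add_mem (I.mul_mem_right _ (hq s)) (I.mul_mem_left _ (hq t)))
    rw [map_mul, ← hF, ← hF, ← hU] at this
    refine (U.isUnit.pow 2).mul_left_cancel ?_
    rw [this]; ring
  refine ⟨{ toFun := F, map_one' := h1, map_zero' := h0, map_add' := hadd, map_mul' := hmul, commutes' := fun x => ?_ }, hθ, fun p hp => ?_⟩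
  · have := hθ (algebraMap K _ x)
    rwa [AlgHom.commutes, AlgHom.commutes] at this
  · change F p = 0
    rw [key0 p 0 (by rwa [map_zero, sub_zero]), map_zero]

lemma θw_hc (wh : ∀ i < n, (w i).IsHomogeneous 1) (j : ℕ) (p : MvPolynomial (Fin n) K) : 
    homogeneousComponent j (θw w n p) = θw w n (homogeneousComponent j p) := by
  have hh : ∀ m (q : MvPolynomial (Fin n) K), q.IsHomogeneous m → (θw w n q).IsHomogeneous m := by
    intro m q hq
    have := hq.aeval (fun i : Fin n => w i) (n := 1) (fun i => wh i i.2)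
    rwa [one_mul] at this
  conv_lhs => rw [← sum_homogeneousComponent p, map_sum, map_sum]
  by_cases hj : j ∈ Finset.range (p.totalDegree + 1)
  · rw [Finset.sum_eq_single_of_mem j hj]
    · rw [homogeneousComponent_of_mem ((mem_homogeneousSubmodule _ _).mpr (hh j _ (homogeneousComponent_isHomogeneous j p))), if_pos rfl]
    · intro i _ hij
      rw [homogeneousComponent_of_mem ((mem_homogeneousSubmodule _ _).mpr (hh i _ (homogeneousComponent_isHomogeneous i p))), if_neg (Ne.symm hij)]
  · rw [homogeneousComponent_eq_zero j p (by simpa using hj), map_zero]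
    refine Finset.sum_eq_zero fun i hi => ?_
    rw [homogeneousComponent_of_mem ((mem_homogeneousSubmodule _ _).mpr (hh i _ (homogeneousComponent_isHomogeneous i p))), if_neg]
    rintro rfl; exact hj hi

lemma Prm.phi_inj (h : Prm I w n a f α β g D) (hI : HI I) (wh : ∀ i < n, (w i).IsHomogeneous 1) 
    (ψ : MvPolynomial (Fin n) K →ₐ[K] PowerSeries k) (hψ : ∀ m p, p.IsHomogeneous m → ψ p = 0 → p = 0)
    (φ : PS K r →ₐ[K] PowerSeries k) (hφ : ∀ p, φ (θw w n p) = ψ p) (hφI : ∀ p ∈ I, φ p = 0) (m : ℕ) (x : PS K r) 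
    (hx : x.IsHomogeneous m) (h0 : φ x = 0) : x ∈ I := by
  by_contra hxI
  obtain ⟨p, hp, c, hc⟩ := h.mul x hxI
  apply hp
  rw [← sum_homogeneousComponent p]
  refine Finset.sum_eq_zero fun j _ => ?_
  apply hψ j _ (homogeneousComponent_isHomogeneous j p)
  rw [← hφ, ← θw_hc wh]
  have h1 := hφI _ (hI _ hc j)
  rw [map_sub, map_sub, sub_eq_zero] at h1
  rw [← h1]
  rw [← sum_homogeneousComponent c, Finset.mul_sum, map_sum, map_sum]
  refine Finset.sum_eq_zero fun i _ => ?_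
  rw [homogeneousComponent_of_mem ((mem_homogeneousSubmodule _ _).mpr (hx.mul (homogeneousComponent_isHomogeneous i c)))]
  split_ifs
  · rw [map_mul, h0, zero_mul]
  · exact map_zero _

end Phi
end QC

namespace QC

section Psi
variable {K : Type} [Field K] {n : ℕ} {k : Type} [Field k] [Algebra K k]

lemma li_of_notMem (c : ℕ → Fin n → K) (m : ℕ) (h : ∀ i < m, c i ∉ Submodule.span K (c '' Set.Iio i)) : 
    LinearIndependent K (fun i : Fin m => c i) := by
  induction m with
  | zero => exact linearIndependent_empty_type
  | succ m ih => 
    rw [linearIndependent_finSucc']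
    refine ⟨ih fun i hi => h i (by omega), ?_⟩
    have e : Set.range (Fin.init (fun i : Fin (m + 1) => c i)) = c '' Set.Iio m := by
      ext x
      constructor
      · rintro ⟨i, rfl⟩
        exact ⟨i, i.2, rfl⟩
      · rintro ⟨i, hi, rfl⟩
        exact ⟨⟨i, hi⟩, rfl⟩
    rw [e]
    exact h m (by omega)

lemma exists_basis {d : ℕ} {η b : Fin (d + 1) → K} {c : ℕ → Fin (d + 1) → K} (hb : ηf η b = 1) 
    (hcη : ∀ i < d, c i ∈ LinearMap.ker (ηf η)) (hc : ∀ i < d, c i ∉ Submodule.span K (c '' Set.Iio i)) : 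
    ∃ B : Module.Basis (Fin (d + 1)) K (Fin (d + 1) → K), B 0 = b ∧ ∀ i : Fin d, B i.succ = c i := by
  have hli : LinearIndependent K (Fin.cons b (fun i : Fin d => c i) : Fin (d + 1) → Fin (d + 1) → K) := by
    rw [linearIndependent_finCons]
    refine ⟨li_of_notMem c d hc, fun hmem => ?_⟩
    have hle : Submodule.span K (Set.range fun i : Fin d => c i) ≤ LinearMap.ker (ηf η) := by
      rw [Submodule.span_le]
      rintro _ ⟨i, rfl⟩
      exact hcη i i.2
    have := hle hmem
    rw [LinearMap.mem_ker, hb] at this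
    exact one_ne_zero this
  refine ⟨basisOfLinearIndependentOfCardEqFinrank hli (by simp), ?_, fun i => ?_⟩
  · rw [coe_basisOfLinearIndependentOfCardEqFinrank, Fin.cons_zero]
  · rw [coe_basisOfLinearIndependentOfCardEqFinrank, Fin.cons_succ]

lemma homog_scale {p : MvPolynomial (Fin n) K} {m : ℕ} (hp : p.IsHomogeneous m) (z : K) (ν : Fin n → K) : 
    aeval (fun i => z * ν i) p = z ^ m * aeval ν p := by
  rw [aeval_def, eval₂_eq, aeval_def, eval₂_eq, Finset.mul_sum]
  refine Finset.sum_congr rfl fun e he => ?_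
  have h1 := hp (mem_support_iff.mp he)
  rw [Finsupp.weight_apply, Finsupp.sum] at h1
  simp only [Pi.one_apply, smul_eq_mul, mul_one] at h1
  rw [← h1, ← Finset.prod_pow_eq_pow_sum]
  simp_rw [mul_pow]
  rw [Finset.prod_mul_distrib]; ring

/-- coordinates -/
def Uu (K : Type) [Field K] (d : ℕ) : Fin (d + 1) → MvPolynomial (Fin d) K := Fin.cons 1 X

/-- the parametrization on linear forms -/
def lamB {d : ℕ} (B : Module.Basis (Fin (d + 2)) K (Fin (d + 2) → K)) : (Fin (d + 2) → K) →ₗ[K] Polynomial (MvPolynomial (Fin d) K) := 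
  B.constr K (Fin.cons 1 (fun i : Fin (d + 1) => Polynomial.C (Uu K d i) * Polynomial.X) : Fin (d + 2) → Polynomial (MvPolynomial (Fin d) K))

lemma lamB_zero {d : ℕ} (B : Module.Basis (Fin (d + 2)) K (Fin (d + 2) → K)) : lamB B (B 0) = 1 := by
  rw [lamB, Module.Basis.constr_basis, Fin.cons_zero]

lemma lamB_succ {d : ℕ} (B : Module.Basis (Fin (d + 2)) K (Fin (d + 2) → K)) (i : Fin (d + 1)) : 
    lamB B (B i.succ) = Polynomial.C (Uu K d i) * Polynomial.X := by
  rw [lamB, Module.Basis.constr_basis, Fin.cons_succ]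

/-- the parametrization -/
def psiB {d : ℕ} (B : Module.Basis (Fin (d + 2)) K (Fin (d + 2) → K)) : MvPolynomial (Fin (d + 2)) K →ₐ[K] Polynomial (MvPolynomial (Fin d) K) := 
  aeval fun i => lamB B (Pi.single i 1)

lemma psiB_Lf {d : ℕ} (B : Module.Basis (Fin (d + 2)) K (Fin (d + 2) → K)) (c) : psiB B (Lf K _ c) = lamB B c := 
  alg_Lf _ _ (fun i => by rw [psiB, aeval_X]) c

lemma psiB_inj [Infinite K] {d : ℕ} (B : Module.Basis (Fin (d + 2)) K (Fin (d + 2) → K)) {p : MvPolynomial (Fin (d + 2)) K} {m : ℕ}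
    (hp : p.IsHomogeneous m) (h0 : psiB B p = 0) : p = 0 := by
  have key : p * (Lf K _ (B 0) * Lf K _ (B 1)) = 0 := by
    apply MvPolynomial.funext
    intro ν
    rw [map_mul, map_mul, map_zero (eval ν)]
    have e0 : ∀ c, eval ν (Lf K (d + 2) c) = ηf ν c := fun c => by rw [← Lf_eval, aeval_eq_eval]
    rw [e0, e0]
    by_cases hb : ηf ν (B 0) = 0
    · rw [hb]; ring
    by_cases hc : ηf ν (B 1) = 0
    · rw [hc]; ring
    let t : K := ηf ν (B 1) / ηf ν (B 0)
    let s : Fin d → K := fun j => ηf ν (B j.succ.succ) / ηf ν (B 1)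
    let E : Polynomial (MvPolynomial (Fin d) K) →ₐ[K] K := 
      (Polynomial.aeval t : Polynomial K →ₐ[K] K).comp (Polynomial.mapAlgHom (aeval s : MvPolynomial (Fin d) K →ₐ[K] K))
    have hEC : ∀ q, E (Polynomial.C q) = aeval s q := fun q => by
      simp [E]
    have hEX : E Polynomial.X = t := by simp [E]
    have hlin : E.toLinearMap ∘ₗ lamB B = (ηf ν (B 0))⁻¹ • ηf ν := by
      apply B.ext
      intro i
      rw [LinearMap.comp_apply, LinearMap.smul_apply, smul_eq_mul, AlgHom.toLinearMap_apply]
      refine Fin.cases ?_ (fun j => ?_) i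
      · rw [lamB_zero, map_one, inv_mul_cancel₀ hb]
      · rw [lamB_succ, map_mul, hEC, hEX]
        refine Fin.cases ?_ (fun l => ?_) j
        · rw [Uu, Fin.cons_zero, map_one, one_mul]; exact div_eq_inv_mul _ _
        · rw [Uu, Fin.cons_succ, aeval_X]
          change _ / _ * (_ / _) = _
          field_simp
    have h1 : E.comp (psiB B) = aeval (fun i => (ηf ν (B 0))⁻¹ * ν i) := by
      apply MvPolynomial.algHom_ext
      intro i
      have := LinearMap.congr_fun hlin (Pi.single i 1)
      rw [AlgHom.comp_apply, psiB, aeval_X, aeval_X]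
      refine this.trans ?_
      rw [LinearMap.smul_apply, ηf, Fintype.linearCombination_apply_single, one_smul, smul_eq_mul]
    have h2 := congrArg E h0
    rw [← AlgHom.comp_apply, h1, homog_scale hp, map_zero E, aeval_eq_eval] at h2
    have h3 := (mul_eq_zero.mp h2).resolve_left (pow_ne_zero _ (inv_ne_zero hb))
    have h4 : eval ν p = 0 := h3
    rw [h4, zero_mul]
  rcases mul_eq_zero.mp key with h | h
  · exact h
  · rcases mul_eq_zero.mp h with h | h
    · exact absurd (Lf_inj h) (B.ne_zero _)
    · exact absurd (Lf_inj h) (B.ne_zero _)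

/-- embedding in power series -/
def iotaP (K R k : Type) [Field K] [CommRing R] [Field k] [Algebra K R] [Algebra K k] [Algebra R k] [IsScalarTower K R k] : Polynomial R →ₐ[K] PowerSeries k := 
  { (Polynomial.coeToPowerSeries.ringHom : Polynomial k →+* PowerSeries k).comp (Polynomial.mapRingHom (algebraMap R k)) with
    commutes' := fun x => by
      change ((Polynomial.map (algebraMap R k) (algebraMap K (Polynomial R) x) : Polynomial k) : PowerSeries k) = _
      rw [Polynomial.algebraMap_apply, Polynomial.map_C, Polynomial.coe_C, PowerSeries.algebraMap_apply, ← IsScalarTower.algebraMap_apply] }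

section iota
variable {R : Type} [CommRing R] [Algebra K R] [Algebra R k] [IsScalarTower K R k]

lemma iotaP_apply (p : Polynomial R) : iotaP K R k p = ((Polynomial.map (algebraMap R k) p : Polynomial k) : PowerSeries k) := rfl

lemma iotaP_inj (h : Function.Injective (algebraMap R k)) {p : Polynomial R} (hp : iotaP K R k p = 0) : p = 0 := by
  rw [iotaP_apply, ← Polynomial.coe_zero] at hp
  have := Polynomial.coe_injective k hp
  exact (Polynomial.map_eq_zero_iff h).mp this

lemma iotaP_CX (x : R) : iotaP K R k (Polynomial.C x * Polynomial.X) = PowerSeries.C (algebraMap R k x) * PowerSeries.X := by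
  rw [iotaP_apply, Polynomial.map_mul, Polynomial.map_C, Polynomial.map_X, Polynomial.coe_mul, Polynomial.coe_C, Polynomial.coe_X]

end iota

lemma exists_psi [Infinite K] {d : ℕ} [Algebra (MvPolynomial (Fin d) K) k] [IsScalarTower K (MvPolynomial (Fin d) K) k] 
    (hinj : Function.Injective (algebraMap (MvPolynomial (Fin d) K) k)) {η : Fin (d + 2) → K}
    (B : Module.Basis (Fin (d + 2)) K (Fin (d + 2) → K)) (hB : ηf η (B 0) = 1) (hB' : ∀ i : Fin (d + 1), ηf η (B i.succ) = 0) : 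
    ∃ ψ : MvPolynomial (Fin (d + 2)) K →ₐ[K] PowerSeries k, 
      (∀ p, PowerSeries.constantCoeff (ψ p) = algebraMap K k (aeval η p)) ∧ (∀ m p, p.IsHomogeneous m → ψ p = 0 → p = 0) ∧
      ψ (Lf K _ (B 0)) = 1 ∧ ∀ i : Fin (d + 1), ψ (Lf K _ (B i.succ)) = PowerSeries.C (algebraMap _ k (Uu K d i)) * PowerSeries.X := by
  refine ⟨(iotaP K (MvPolynomial (Fin d) K) k).comp (psiB B), ?_, ?_, ?_, ?_⟩
  · let F1 : (Fin (d + 2) → K) →ₗ[K] k := 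
      { toFun := fun c => PowerSeries.constantCoeff (iotaP K (MvPolynomial (Fin d) K) k (lamB B c))
        map_add' := fun x y => by rw [map_add, map_add, map_add]
        map_smul' := fun x y => by
          rw [map_smul (lamB B), AlgHom.map_smul_of_tower, Algebra.smul_def, map_mul, PowerSeries.algebraMap_apply, PowerSeries.constantCoeff_C, RingHom.id_apply, Algebra.smul_def] }
    have hF : F1 = (Algebra.linearMap K k) ∘ₗ ηf η := by
      apply B.ext
      intro i
      change PowerSeries.constantCoeff (iotaP K (MvPolynomial (Fin d) K) k (lamB B (B i))) = algebraMap K k (ηf η (B i))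
      refine Fin.cases ?_ (fun j => ?_) i
      · rw [lamB_zero, hB, map_one, map_one, map_one]
      · rw [lamB_succ, hB', iotaP_CX, map_mul, PowerSeries.constantCoeff_X, mul_zero, map_zero]
    let ψ := (iotaP K (MvPolynomial (Fin d) K) k).comp (psiB B)
    have : (PowerSeries.constantCoeff : PowerSeries k →+* k).comp (ψ : MvPolynomial (Fin (d + 2)) K →+* PowerSeries k) = 
        (algebraMap K k).comp (aeval η : MvPolynomial (Fin (d + 2)) K →ₐ[K] K) := by
      apply MvPolynomial.ringHom_ext
      · intro x
        change PowerSeries.constantCoeff (ψ (algebraMap K _ x)) = algebraMap K k (aeval η (algebraMap K _ x))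
        rw [AlgHom.commutes, AlgHom.commutes, PowerSeries.algebraMap_apply, PowerSeries.constantCoeff_C]; rfl
      · intro i
        have := LinearMap.congr_fun hF (Pi.single i 1)
        change PowerSeries.constantCoeff (iotaP K (MvPolynomial (Fin d) K) k (psiB B (X i))) = algebraMap K k (aeval η (X i))
        rw [psiB, aeval_X, aeval_X]
        refine this.trans ?_
        rw [LinearMap.comp_apply, ηf, Fintype.linearCombination_apply_single, one_smul]; rfl
    exact fun p => RingHom.congr_fun this p
  · intro m p hp h0
    exact psiB_inj B hp (iotaP_inj (K := K) hinj h0)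
  · rw [AlgHom.comp_apply, psiB_Lf, lamB_zero, map_one]
  · intro i
    rw [AlgHom.comp_apply, psiB_Lf, lamB_succ, iotaP_CX]

/-- the parameters -/
def uU (k : Type) [Field k] (d : ℕ) [Algebra (MvPolynomial (Fin d) K) k] : ℕ → k := 
  fun i => if h : i < d + 1 then algebraMap _ k (Uu K d ⟨i, h⟩) else 0

lemma uU_fin (k : Type) [Field k] {d : ℕ} [Algebra (MvPolynomial (Fin d) K) k] (i : Fin (d + 1)) : 
    uU (K := K) k d i = algebraMap _ k (Uu K d i) := by
  rw [uU, dif_pos i.2]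

lemma uU_zero (k : Type) [Field k] {d : ℕ} [Algebra (MvPolynomial (Fin d) K) k] : uU (K := K) k d 0 = 1 := by
  have := uU_fin (K := K) k (0 : Fin (d + 1))
  rw [Uu, Fin.cons_zero, map_one] at this
  exact this

lemma HF_monomial {d N : ℕ} (F0 : MvPolynomial ℕ K) (h0 : HF d N F0) (hd : 0 < d) (j : ℕ) : HF d (N + j) (X 0 ^ j * F0) := by
  induction j with
  | zero => rwa [pow_zero, one_mul]
  | succ j ih => 
    rw [pow_succ', mul_assoc]
    exact ih.X_mul hd

lemma HF_homogenize {d : ℕ} [Algebra (MvPolynomial (Fin d) K) k] [IsScalarTower K (MvPolynomial (Fin d) K) k] (N : ℕ) (p : MvPolynomial (Fin d) K) 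
    (hp : p.totalDegree ≤ N) : ∃ F : MvPolynomial ℕ K, HF (d + 1) N F ∧ aeval (uU (K := K) k d) F = algebraMap _ k p := by
  classical
  have main : ∀ s : Finset (Fin d →₀ ℕ), s ⊆ p.support → ∃ F : MvPolynomial ℕ K, HF (d + 1) N F ∧ 
      aeval (uU (K := K) k d) F = algebraMap _ k (∑ m ∈ s, monomial m (coeff m p)) := by
    intro s
    induction s using Finset.induction_on with
    | empty => intro _; exact ⟨0, HF.zero _ _, by simp⟩
    | insert m s hm ih => 
      intro hs
      obtain ⟨F, hF, hFe⟩ := ih ((Finset.subset_insert _ _).trans hs)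
      have hdeg : m.degree ≤ N := (le_totalDegree (hs (Finset.mem_insert_self _ _))).trans' (le_of_eq (by simp [Finsupp.degree_apply, Finsupp.sum])) |>.trans hp
      let G0 : MvPolynomial ℕ K := rename (fun i : Fin d => (i : ℕ) + 1) (monomial m (coeff m p))
      have hG0 : HF (d + 1) m.degree G0 := by
        intro e he
        have he' : e ∈ G0.support := mem_support_iff.mpr he
        simp only [G0, rename_monomial] at he
        rw [coeff_monomial] at he
        split_ifs at he with h1
        · rw [← h1]
          refine ⟨?_, fun i hi => ?_⟩
          · rw [Finsupp.mapDomain, Finsupp.sum, map_sum]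
            simp_rw [Finsupp.degree_single]
            rw [Finsupp.degree_apply]
          · rw [Finsupp.mapDomain_of_notMem_range]
            rintro ⟨l, hl⟩
            simp only at hl
            omega
        · exact absurd rfl he
      have hG0e : aeval (uU (K := K) k d) G0 = algebraMap _ k (monomial m (coeff m p)) := by
        have : (aeval (uU (K := K) k d)).comp (rename (R := K) (fun i : Fin d => (i : ℕ) + 1)) = IsScalarTower.toAlgHom K (MvPolynomial (Fin d) K) k := by
          apply MvPolynomial.algHom_ext
          intro i
          rw [AlgHom.comp_apply, rename_X, aeval_X]
          exact (uU_fin (K := K) k i.succ).trans (by rw [Uu, Fin.cons_succ]; rfl)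
        exact AlgHom.congr_fun this _
      refine ⟨X 0 ^ (N - m.degree) * G0 + F, ?_, ?_⟩
      · have := HF_monomial G0 hG0 (by omega) (N - m.degree)
        rw [Nat.add_sub_cancel' hdeg] at this
        exact this.add hF
      · rw [map_add, map_mul, map_pow, aeval_X, uU_zero, one_pow, one_mul, hFe, hG0e, Finset.sum_insert hm, map_add]
  obtain ⟨F, hF, hFe⟩ := main p.support subset_rfl
  exact ⟨F, hF, by rw [hFe, support_sum_monomial_coeff]⟩

lemma den_of {d : ℕ} [Algebra (MvPolynomial (Fin d) K) k] [IsScalarTower K (MvPolynomial (Fin d) K) k] 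
    [IsFractionRing (MvPolynomial (Fin d) K) k] (s : Finset k) : 
    ∃ N, ∃ D : k, D ≠ 0 ∧ ∀ a ∈ s, ∃ F : MvPolynomial ℕ K, HF (d + 1) N F ∧ aeval (uU (K := K) k d) F = D * a := by
  obtain ⟨b, hb⟩ := IsLocalization.exist_integer_multiples_of_finset (nonZeroDivisors (MvPolynomial (Fin d) K)) s
  have : ∀ a : k, ∃ p : MvPolynomial (Fin d) K, a ∈ s → algebraMap _ k p = algebraMap _ k (b : MvPolynomial (Fin d) K) * a := by
    intro a
    by_cases ha : a ∈ s
    · obtain ⟨p, hp⟩ := hb a ha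
      exact ⟨p, fun _ => by rw [hp, Algebra.smul_def]⟩
    · exact ⟨0, fun h => absurd h ha⟩
  choose p hp using this
  refine ⟨s.sup fun a => (p a).totalDegree, algebraMap _ k (b : MvPolynomial (Fin d) K), 
    IsFractionRing.to_map_ne_zero_of_mem_nonZeroDivisors b.2, fun a ha => ?_⟩
  rw [← hp a ha]
  exact HF_homogenize _ _ (Finset.le_sup (f := fun a => (p a).totalDegree) ha)

end Psi
end QC

namespace QC

section SelEx
variable {K : Type} [Field K] {r : ℕ} {I : Ideal (PS K r)} {w : ℕ → PS K r}

theorem Prm.exists_sel [IsAlgClosed K] {d N : ℕ} {a : PS K r} {f α β : Polynomial (MvPolynomial (Fin (d+2)) K)} {g D : MvPolynomial (Fin (d+2)) K}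
    (h : Prm I w (d+2) a f α β g D) (hI : HI I) (hpr : I.IsPrime) (wh : ∀ i < d+2, (w i).IsHomogeneous 1) (hN : mI K r ^ N ≤ Jy I w (d+2)) 
    {x : ℕ → PS K r} (hxm : ∀ i < d+1, x i ∈ mI K r) (hxr : RegY I x (d+1)) 
    (k : Type) [Field k] [Algebra K k] [Algebra (MvPolynomial (Fin d) K) k] [IsScalarTower K (MvPolynomial (Fin d) K) k]
    [IsFractionRing (MvPolynomial (Fin d) K) k] : 
    ∃ (φ : PS K r →ₐ[K] PowerSeries k) (y0 : PS K r) (y : ℕ → PS K r) (u : ℕ → k), Sel I (d+1) φ y0 y u := by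
  have hinf : Infinite K := IsAlgClosed.instInfinite
  obtain ⟨η, hη⟩ : ∃ η : Fin (d+2) → K, eval η (g * D * X 0) ≠ 0 := by
    by_contra! hcon
    have : g * D * X 0 = 0 := MvPolynomial.funext fun η => by rw [hcon, map_zero]
    exact mul_ne_zero (mul_ne_zero h.g0 h.D0) (X_ne_zero _) this
  rw [map_mul, map_mul, eval_X] at hη
  have hη0 : η 0 ≠ 0 := right_ne_zero_of_mul hη
  have hgη : aeval η g ≠ 0 := by
    rw [aeval_eq_eval]; exact left_ne_zero_of_mul (left_ne_zero_of_mul hη)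
  have hDη : aeval η D ≠ 0 := by
    rw [aeval_eq_eval]; exact right_ne_zero_of_mul (left_ne_zero_of_mul hη)
  let b : Fin (d+2) → K := Pi.single 0 (η 0)⁻¹
  have hb : ηf η b = 1 := by
    rw [ηf, Fintype.linearCombination_apply_single, smul_eq_mul, inv_mul_cancel₀ hη0]
  obtain ⟨c, hc1, hc2, hc3⟩ := h.exists_c hI wh hN hb hgη hxm hxr
  obtain ⟨B, hB0, hB1⟩ := exists_basis hb hc1 hc2
  obtain ⟨ψ, hψ1, hψ2, hψ3, hψ4⟩ := exists_psi (k := k) (IsFractionRing.injective (MvPolynomial (Fin d) K) k) B (η := η)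
    (by rw [hB0, hb]) (fun i => by rw [hB1]; exact LinearMap.mem_ker.mp (hc1 i i.2))
  obtain ⟨φ, hφ1, hφ2⟩ := h.exists_phi hpr ψ hψ1 hDη hgη
  refine ⟨φ, θw w (d+2) (Lf K (d+2) b), fun i => θw w (d+2) (Lf K (d+2) (c i)), uU (K := K) k d, ?_⟩
  refine ⟨by omega, θLf_homog wh b, fun i _ => θLf_homog wh (c i), hc3, hφ2, h.phi_inj hI wh ψ hψ2 φ hφ1 hφ2, ?_, ?_, uU_zero k, 
    den_of, ?_⟩
  · rw [hφ1, ← hB0, hψ3]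
  · intro i hi
    rw [hφ1, ← hB1 ⟨i, hi⟩, hψ4, ← uU_fin]
  · refine ⟨N, fun p hp => ?_⟩
    have h1 := hN (homog_mem_pow le_rfl hp)
    refine (sup_le ?_ ?_ : Jy I w (d+2) ≤ _) h1
    · exact le_sup_of_le_left (le_sup_left)
    · rw [Ideal.span_le]
      rintro _ ⟨i, hi, rfl⟩
      set J := Jy I (fun i => θw w (d+2) (Lf K (d+2) (c i))) (d+1) ⊔ Ideal.span {θw w (d+2) (Lf K (d+2) b)} with hJ
      have hall : ∀ v : Fin (d+2) → K, θw w (d+2) (Lf K (d+2) v) ∈ J := by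
        intro v
        let T : (Fin (d+2) → K) →ₗ[K] PS K r := (θw w (d+2)).toLinearMap ∘ₗ Lf K (d+2)
        have hle : ⊤ ≤ (J.restrictScalars K).comap T := by
          rw [← B.span_eq, Submodule.span_le]
          rintro _ ⟨j, rfl⟩
          change θw w (d+2) (Lf K (d+2) (B j)) ∈ J
          refine Fin.cases ?_ (fun l => ?_) j
          · rw [hB0]
            exact Ideal.mem_sup_right (Ideal.subset_span rfl)
          · rw [hB1]
            exact Ideal.mem_sup_left (Ideal.mem_sup_right (Ideal.subset_span ⟨l, l.2, rfl⟩))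
        exact hle trivial
      have := hall (Pi.single ⟨i, hi⟩ 1)
      rw [Lf_single, θw, aeval_X] at this
      exact this

theorem exists_sel [IsAlgClosed K] {d : ℕ} (hI : HI I) (hpr : I.IsPrime) (hdim : AMD.DimEq K r I (d+1))
    {x : ℕ → PS K r} (hxm : ∀ i < d+1, x i ∈ mI K r) (hxr : RegY I x (d+1)) : 
    ∃ (k : Type) (_ : Field k) (_ : Algebra K k) (φ : PS K r →ₐ[K] PowerSeries k) (y0 : PS K r) (y : ℕ → PS K r) (u : ℕ → k), 
      Sel I (d+1) φ y0 y u := by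
  have hinf : Infinite K := IsAlgClosed.instInfinite
  obtain ⟨w, wh, ⟨N, hN⟩, a, f, α, β, g, D, h⟩ := exists_prm hI hpr hdim
  exact ⟨FractionRing (MvPolynomial (Fin d) K), inferInstance, inferInstance, 
    h.exists_sel hI hpr wh hN hxm hxr (FractionRing (MvPolynomial (Fin d) K))⟩

end SelEx

section Dep
variable {K : Type} [Field K] {r : ℕ} {I : Ideal (PS K r)}

lemma mem_Jy_list (rs : List (PS K r ⧸ I)) (x : ℕ → PS K r) (hx : ∀ i (h : i < rs.length), rs[i] = Ideal.Quotient.mk I (x i)) 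
    (i : ℕ) (hi : i ≤ rs.length) (f : PS K r) : 
    f ∈ Jy I x i ↔ Ideal.Quotient.mk I f ∈ Ideal.span {z | z ∈ rs.take i} := by
  have e : {z | z ∈ rs.take i} = Ideal.Quotient.mk I '' (x '' Set.Iio i) := by
    ext z
    rw [Set.mem_ofPred_eq, List.mem_take_iff_getElem]
    constructor
    · rintro ⟨j, hj, rfl⟩
      exact ⟨x j, ⟨j, (lt_min_iff.mp hj).1, rfl⟩, (hx j (lt_min_iff.mp hj).2).symm⟩
    · rintro ⟨_, ⟨j, hj, rfl⟩, rfl⟩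
      have hj' : j < i := hj
      exact ⟨j, lt_min hj' (by omega), hx j (by omega)⟩
  rw [e, ← Ideal.map_span, ← Ideal.mem_comap, Ideal.comap_map_quotientMk, Jy]

lemma RegY_iff (rs : List (PS K r ⧸ I)) (x : ℕ → PS K r) (hx : ∀ i (h : i < rs.length), rs[i] = Ideal.Quotient.mk I (x i)) : 
    RegY I x rs.length ↔ AMD.IsRegSeq rs := by
  constructor
  · intro h i y hy
    obtain ⟨f, rfl⟩ := Ideal.Quotient.mk_surjective y
    rw [← mem_Jy_list rs x hx i i.2.le]
    apply h i i.2
    rw [mem_Jy_list rs x hx i i.2.le, map_mul, ← hx i i.2]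
    exact hy
  · intro h i hi f hf
    rw [mem_Jy_list rs x hx i hi.le] at hf ⊢
    apply h ⟨i, hi⟩
    rw [map_mul, ← hx i hi] at hf
    exact hf

theorem depth_exists {t : ℕ} (hm : I ≤ mI K r) (h : AMD.DepthEq K r I t) : ∃ x : ℕ → PS K r, (∀ i < t, x i ∈ mI K r) ∧ RegY I x t := by
  obtain ⟨⟨rs, rfl, h1, h2⟩, -⟩ := h
  let x : ℕ → PS K r := fun i => if h : i < rs.length then (Ideal.Quotient.mk_surjective rs[i]).choose else 0
  have hx : ∀ i (h : i < rs.length), rs[i] = Ideal.Quotient.mk I (x i) := fun i h => by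
    simp only [x, dif_pos h]
    exact (Ideal.Quotient.mk_surjective rs[i]).choose_spec.symm
  refine ⟨x, fun i hi => ?_, (RegY_iff rs x hx).mpr h2⟩
  have h3 := h1 _ (List.getElem_mem hi)
  rw [hx i hi, AMD.maxIdl, ← Ideal.mem_comap, Ideal.comap_map_quotientMk] at h3
  exact (sup_le hm le_rfl : _ ≤ mI K r) h3

theorem depth_le {t n : ℕ} (h : AMD.DepthEq K r I t) (x : ℕ → PS K r) (hx : ∀ i < n, x i ∈ mI K r) (hr : RegY I x n) : n ≤ t := by
  let rs : List (PS K r ⧸ I) := List.ofFn (fun i : Fin n => Ideal.Quotient.mk I (x i))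
  have hl : rs.length = n := List.length_ofFn
  have hx' : ∀ i (h : i < rs.length), rs[i] = Ideal.Quotient.mk I (x i) := fun i h => by
    simp only [rs, List.getElem_ofFn]
  rw [← hl]
  refine h.2 rs ?_ ((RegY_iff rs x hx').mp (by rwa [hl]))
  intro z hz
  obtain ⟨i, rfl⟩ := List.mem_ofFn.mp hz
  exact Ideal.mem_map_of_mem _ (hx i i.2)

end Dep

theorem main_thm (K : Type) [Field K] [IsAlgClosed K] (r : ℕ)
    (I : Ideal (PS K r)) (hprime : I.IsPrime)
    (hhom : AMD.IsHomIdeal K r I) (hnd : AMD.Nondeg K r I)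
    (d c : ℕ) (hdim : AMD.DimEq K r I d) (hcodim : d + c = r)
    (hdeg : AMD.DegreeEq K r I d (c + 2))
    (hdepth : AMD.DepthEq K r I d) (hc : 4 ≤ c) :
    ∃ b : ℕ → ℕ → ℕ, AMD.HasBettiDiagram K r I b ∧
      b 1 1 + 2 = Nat.choose (c + 1) 2 ∧ b 1 2 ≤ 1 ∧
      ∀ j : ℕ, b 1 j ≠ 0 → j = 1 ∨ j = 2 := by
  have hI : HI I := hhom
  have hI0 : ∀ p ∈ I, homogeneousComponent 0 p = 0 := by
    intro p hp
    by_contra h0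
    have h1 := hI p hp 0
    rw [homogeneousComponent_zero] at h1 h0
    have hne : coeff 0 p ≠ 0 := fun h => h0 (by rw [h, map_zero])
    apply hprime.one_notMem
    have := I.mul_mem_left (MvPolynomial.C (coeff 0 p)⁻¹) h1
    rwa [← map_mul, inv_mul_cancel₀ hne, map_one] at this
  have hm : I ≤ mI K r := fun p hp => mem_mI.mpr (hI0 p hp)
  have hd : d ≠ 0 := by
    rintro rfl
    have hX : (X 0 : PS K r) ∉ I := fun h => X_ne_zero (R := K) (0 : Fin (r + 1)) (hnd _ h (isHomogeneous_X _ _))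
    have := depth_le hdepth (n := 1) (fun _ => X 0) (fun _ _ => lin_mem_mI (isHomogeneous_X _ _)) (by
      intro i hi f hf
      obtain rfl : i = 0 := by omega
      rw [Jy_zero] at hf ⊢
      exact (hprime.mem_or_mem hf).resolve_left hX)
    omega
  obtain ⟨d', rfl⟩ := Nat.exists_eq_succ_of_ne_zero hd
  obtain ⟨x, hx1, hx2⟩ := depth_exists hm hdepth
  obtain ⟨k, _, _, φ, y0, y, u, H⟩ := exists_sel hI hprime hdim hx1 hx2
  have hz : ∃ f, f ∉ Jy I y (d' + 1) ∧ y0 * f ∈ Jy I y (d' + 1) := by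
    by_contra! hcon
    let z : ℕ → PS K r := fun i => if i < d' + 1 then y i else y0
    have hJ : ∀ i ≤ d' + 1, Jy I z i = Jy I y i := fun i hi => Jy_congr fun j hj => by
      simp only [z]; rw [if_pos (by omega)]
    have := depth_le hdepth (n := d' + 2) z (fun i _ => lin_mem_mI (by
      simp only [z]
      split_ifs with h
      · exact H.yh i h
      · exact H.y0h)) (by
      intro i hi f hf
      rw [hJ i (by omega)] at hf ⊢
      by_cases h : i < d' + 1
      · simp only [z, if_pos h] at hf
        exact H.reg i h f hf
      · obtain rfl : i = d' + 1 := by omega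
        simp only [z, lt_irrefl, if_false] at hf
        by_contra hf'
        exact hcon f hf' hf)
    omega
  have hC := H.toCH hI hI0 hnd c hcodim hc hdeg hz
  have hq := H.quadrics hI hI0 hnd c hcodim hC
  have hcu := H.cubics hI hnd hC
  have hh := H.higher hI hC
  obtain ⟨b, hb, hbf⟩ := exists_betti I hI hI0
  have hp1 : (GrS K r).part I 1 = ⊥ := by
    rw [eq_bot_iff]
    intro p hp
    rw [mem_part] at hp
    exact (Submodule.mem_bot K).mpr (hnd p hp.1 hp.2)
  have hS1 : (GrS K r).S1 I 1 = ⊥ := by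
    rw [eq_bot_iff, Gr.S1, Submodule.span_le]
    rintro _ ⟨i, x, hx, rfl⟩
    rw [hp1, Submodule.mem_bot] at hx
    rw [hx, smul_zero]
    exact Submodule.zero_mem _
  refine ⟨b, hb, ?_, ?_, ?_⟩
  · have h1 := hbf 1
    rw [hS1, finrank_bot, add_zero] at h1
    rw [h1]; exact hq
  · have h2 : b 1 2 + Module.finrank K ((GrS K r).S1 I 2) = Module.finrank K ((GrS K r).part I 3) := hbf 2
    omega
  · intro j hj
    by_contra! hcon
    apply hj
    have h1 := hbf j
    rcases Nat.eq_zero_or_pos j with rfl | hpos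
    · rw [zero_add, hp1, finrank_bot] at h1
      omega
    · have e : (GrS K r).S1 I j = (GrS K r).part I (j + 1) := le_antisymm ((GrS K r).S1_le I j) (hh j (by omega))
      rw [e] at h1
      omega

end QC


/-- **Lemma 3.5.**  The defining ideal of a variety `X ⊆ ℙ^r_K` of almost minimal
degree with `codepth A_X = 1` and `c = codim X ≥ 4` is minimally generated by
`C(c+1,2) - 2` quadrics and at most one cubic. -/
theorem quadrics_and_at_most_one_cubic
    (K : Type) [Field K] [IsAlgClosed K] (r : ℕ)
    (I : Ideal (PS K r)) (hprime : I.IsPrime)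
    (hhom : AMD.IsHomIdeal K r I) (hnd : AMD.Nondeg K r I)
    (d c t : ℕ) (hdim : AMD.DimEq K r I d) (hcodim : d + c = r)
    (hdeg : AMD.DegreeEq K r I d (c + 2))
    (hdepth : AMD.DepthEq K r I t) (hcodepth : t + 1 = d + 1)
    (hc : 4 ≤ c) :
    ∃ b : ℕ → ℕ → ℕ, AMD.HasBettiDiagram K r I b ∧
      b 1 1 + 2 = Nat.choose (c + 1) 2 ∧ b 1 2 ≤ 1 ∧
      ∀ j : ℕ, b 1 j ≠ 0 → j = 1 ∨ j = 2 := by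
  obtain rfl : t = d := by omega
  exact QC.main_thm K r I hprime hhom hnd t c hdim hcodim hdeg hdepth hc
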